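/- Atomic (spline) decomposition (Corollary 4.4): Let p, q, r ∈ (0,∞], θ ∈ (0, min{r,p}], l ∈ ℕ, and let {t_k} ∈ X^{α₃}_{α,σ,p} be a p-admissible weight sequence with α₁ > n·(1/θ − 1/r), l > α₂, σ₁ = θ·p̄_θ (p̄_θ the conjugate exponent of p_θ := p/θ), σ₂ = p, α₃ ≥ 0, and let {t_{k,m}} be its associated multiple sequence. Then: (1) every φ ∈ B̃^l_{p,q,r}(ℝⁿ,{t_k}) admits a representation φ = Σ_{k=0}^∞ Σ_{m∈ℤⁿ} β_{k,m} N^l_{k,m} converging in L_r^{loc}(ℝⁿ) with coefficients satisfying (Σ_{k=0}^∞ (Σ_{m∈ℤⁿ} t^p_{k,m} |β_{k,m}|^p)^{q/p})^{1/q} ≤ C·‖φ | B̃^l_{p,q,r}(ℝⁿ,{t_k})‖; (2) conversely, if a multiple sequence {β_{k,m}} of reals satisfies (Σ_{k=0}^∞ (Σ_{m∈ℤⁿ} t^p_{k,m} |β_{k,m}|^p)^{q/p})^{1/q} < ∞, then the series Σ_{k=0}^∞ Σ_{m∈ℤⁿ} β_{k,m} N^l_{k,m} converges in L_r^{loc}(ℝⁿ)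 to a function φ ∈ B̃^l_{p,q,r}(ℝⁿ,{t_k}) with ‖φ | B̃^l_{p,q,r}(ℝⁿ,{t_k})‖ ≤ C·(Σ_{k=0}^∞ (Σ_{m∈ℤⁿ} t^p_{k,m} |β_{k,m}|^p)^{q/p})^{1/q}. The constants C are independent of φ and of {β_{k,m}}. -/

import Mathlib

open MeasureTheory ENNReal Filter
open scoped Classical

noncomputable section

/-- `ℓ_q` quasinorm of a family of extended nonnegative reals (supremum when `q = ∞`). -/
def lqNorm {ι : Type*} (q : ℝ≥0∞) (c : ι → ℝ≥0∞) : ℝ≥0∞ :=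
  if q = ∞ then ⨆ i, c i else (∑' i, c i ^ q.toReal) ^ (1 / q.toReal)

/-- `L_p` quasinorm of an `ℝ≥0∞`-valued function (essential supremum when `p = ∞`). -/
def lpNormE {α : Type*} [MeasurableSpace α] (p : ℝ≥0∞) (μ : Measure α) (f : α → ℝ≥0∞) : ℝ≥0∞ :=
  if p = ∞ then essSup f μ else (∫⁻ x, f x ^ p.toReal ∂μ) ^ (1 / p.toReal)

abbrev Rn (n : ℕ) := Fin n → ℝ

/-- Open cube centred at `x` of half-side `s` (i.e. `x + s·Iⁿ`). -/
def openCube {n : ℕ} (x : Rn n) (s : ℝ) : Set (Rn n) := {y | ∀ i, |y i - x i| < s}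

/-- Open axis-parallel cube with lower corner `c` and side `s`. -/
def cubeAt {n : ℕ} (c : Rn n) (s : ℝ) : Set (Rn n) := {x | ∀ i, c i < x i ∧ x i < c i + s}

/-- Open dyadic cube `Q^n_{k,m}` of side `2^{-k}`. -/
def dyadicCube (n k : ℕ) (m : Fin n → ℤ) : Set (Rn n) :=
  {x | ∀ i, (m i : ℝ) / 2 ^ k < x i ∧ x i < ((m i : ℝ) + 1) / 2 ^ k}

/-- Half-open dyadic cube `Q̃^n_{k,m}`. -/
def dyadicCubeHalf (n k : ℕ) (m : Fin n → ℤ) : Set (Rn n) :=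
  {x | ∀ i, (m i : ℝ) / 2 ^ k ≤ x i ∧ x i < ((m i : ℝ) + 1) / 2 ^ k}

def dyadicCenter (n k : ℕ) (m : Fin n → ℤ) : Rn n := fun i => ((m i : ℝ) + 1 / 2) / 2 ^ k

/-- The concentric dilate `c·Q^n_{k,m}` of a dyadic cube. -/
def dilatedCube (n k : ℕ) (m : Fin n → ℤ) (c : ℝ) : Set (Rn n) :=
  openCube (dyadicCenter n k m) (c / 2 ^ (k + 1))

def euclNorm {d : ℕ} (y : Rn d) : ℝ := Real.sqrt (∑ i, y i ^ 2)

/-- The difference `Δ^l(h)g(x)`. -/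
def diffl {n : ℕ} (l : ℕ) (h : Rn n) (g : Rn n → ℝ) (x : Rn n) : ℝ :=
  ∑ j ∈ Finset.range (l + 1), ((l.choose j : ℝ) * (-1 : ℝ) ^ (l + j)) * g (x + (j : ℝ) • h)

/-- The difference `Δ^l(h,Ω)g(x)`, vanishing unless the segment `[x, x + l·h]` lies in `Ω`. -/
def difflOn {n : ℕ} (l : ℕ) (Ω : Set (Rn n)) (h : Rn n) (g : Rn n → ℝ) (x : Rn n) : ℝ :=
  if ∀ τ ∈ Set.Icc (0 : ℝ) 1, x + (τ * l) • h ∈ Ω then diffl l h g x else 0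

/-- `δ^l_r(Q)g`, where `s` is the side length of the cube `Q`. -/
def deltaE (n l : ℕ) (r : ℝ≥0∞) (s : ℝ) (Q : Set (Rn n)) (g : Rn n → ℝ) : ℝ≥0∞ :=
  ENNReal.ofReal s ^ (-(2 * (n : ℝ)) / r.toReal) *
    eLpNorm (fun hx : Rn n × Rn n => diffl l hx.1 g hx.2) r
      ((volume.restrict (openCube (0 : Rn n) s)).prod (volume.restrict Q))

/-- `δ^l_r(Q,Ω)g`, where `s` is the side length of the cube `Q`. -/
def deltaEOn (n l : ℕ) (r : ℝ≥0∞) (s : ℝ) (Q Ω : Set (Rn n)) (g : Rn n → ℝ) : ℝ≥0∞ :=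
  ENNReal.ofReal s ^ (-(2 * (n : ℝ)) / r.toReal) *
    eLpNorm (fun hx : Rn n × Rn n => difflOn l Ω hx.1 g hx.2) r
      ((volume.restrict (openCube (0 : Rn n) s)).prod (volume.restrict Q))

/-- `Δ̄^l_r(s)g(x)`. -/
def barDelta (n l : ℕ) (r : ℝ≥0∞) (s : ℝ) (g : Rn n → ℝ) (x : Rn n) : ℝ≥0∞ :=
  ENNReal.ofReal s ^ (-(n : ℝ) / r.toReal) *
    eLpNorm (fun h : Rn n => diffl l h g x) r (volume.restrict (openCube (0 : Rn n) s))

/-- Membership in `L_r^{loc}(ℝⁿ)`. -/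
def MemLrLoc (n : ℕ) (r : ℝ≥0∞) (φ : Rn n → ℝ) : Prop :=
  Measurable φ ∧ ∀ K : Set (Rn n), IsCompact K → eLpNorm φ r (volume.restrict K) < ∞

def IsWeight {n : ℕ} (w : Rn n → ℝ) : Prop := Measurable w ∧ ∀ x, 0 < w x

/-- A `p`-admissible weight sequence. -/
def pAdmissible (n : ℕ) (p : ℝ≥0∞) (t : ℕ → Rn n → ℝ) : Prop :=
  ∀ k, IsWeight (t k) ∧ MemLrLoc n p (t k)

/-- The multiple sequence `t_{k,m} = ‖t_k‖_{L_p(Q^n_{k,m})}` associated with a weight sequence. -/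
def tkm (n : ℕ) (p : ℝ≥0∞) (t : ℕ → Rn n → ℝ) (k : ℕ) (m : Fin n → ℤ) : ℝ≥0∞ :=
  eLpNorm (t k) p (volume.restrict (dyadicCube n k m))

/-- The weight `t̄_k` built from a multiple sequence `T`. -/
def tbarOf (n : ℕ) (p : ℝ≥0∞) (T : ℕ → (Fin n → ℤ) → ℝ≥0∞) (k : ℕ) (x : Rn n) : ℝ≥0∞ :=
  (2 : ℝ≥0∞) ^ (((k * n : ℕ) : ℝ) / p.toReal) *
    ∑' m : Fin n → ℤ, (dyadicCubeHalf n k m).indicator (fun _ => T k m) x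

/-- `(2^{kn} ∫_Q f^e)^{1/e}`, with the essential supremum modification for `e = ∞`. -/
def avgNorm (n k : ℕ) (e : ℝ≥0∞) (Q : Set (Rn n)) (f : Rn n → ℝ≥0∞) : ℝ≥0∞ :=
  if e = ∞ then essSup f (volume.restrict Q)
  else ((2 : ℝ≥0∞) ^ (k * n) * ∫⁻ x in Q, f x ^ e.toReal) ^ (1 / e.toReal)

/-- Conditions (2.14)–(2.16) of the class `X^{α₃}_{α,σ,p}`, expressed for a multiple
sequence `T`. -/
def MemXseq (n : ℕ) (α₁ α₂ α₃ : ℝ) (σ₁ σ₂ p : ℝ≥0∞) (T : ℕ → (Fin n → ℤ) → ℝ≥0∞) : Prop :=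
  (∃ C₁ : ℝ≥0∞, 0 < C₁ ∧ C₁ < ∞ ∧ ∀ k j : ℕ, k ≤ j → ∀ m : Fin n → ℤ,
    avgNorm n k p (dyadicCube n k m) (tbarOf n p T k) *
      avgNorm n k σ₁ (dyadicCube n k m) (fun x => (tbarOf n p T j x)⁻¹) ≤
      C₁ * (2 : ℝ≥0∞) ^ (α₁ * ((k : ℝ) - (j : ℝ)))) ∧
  (∃ C₂ : ℝ≥0∞, 0 < C₂ ∧ C₂ < ∞ ∧ ∀ k j : ℕ, k ≤ j → ∀ m : Fin n → ℤ,
    (avgNorm n k p (dyadicCube n k m) (tbarOf n p T k))⁻¹ *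
      avgNorm n k σ₂ (dyadicCube n k m) (tbarOf n p T j) ≤
      C₂ * (2 : ℝ≥0∞) ^ (α₂ * ((j : ℝ) - (k : ℝ)))) ∧
  (∀ k : ℕ, ∀ m m' : Fin n → ℤ, (∀ i, |m i - m' i| ≤ 1) →
    0 < T k m ∧ T k m ≤ (2 : ℝ≥0∞) ^ (α₃ : ℝ) * T k m')

/-- The weighted class `X^{α₃}_{α,σ,p}` of weight sequences. -/
def MemX (n : ℕ) (α₁ α₂ α₃ : ℝ) (σ₁ σ₂ p : ℝ≥0∞) (t : ℕ → Rn n → ℝ) : Prop :=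
  pAdmissible n p t ∧ MemXseq n α₁ α₂ α₃ σ₁ σ₂ p (tkm n p t)

/-- Quasinorm of `B̃^l_{p,q,r}(ℝⁿ, T)` with an `ℝ≥0∞`-valued weight sequence `T`. -/
def tildeBnormE (n l : ℕ) (p q r : ℝ≥0∞) (T : ℕ → Rn n → ℝ≥0∞) (φ : Rn n → ℝ) : ℝ≥0∞ :=
  lqNorm q (fun k : ℕ =>
    lpNormE p volume (fun x =>
      T (k + 1) x *
        deltaE n l r ((2 : ℝ) ^ (1 - ((k : ℤ) + 1))) (openCube x ((2 : ℝ) ^ (-((k : ℤ) + 1)))) φ)) +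
  lpNormE p volume (fun x => T 0 x * eLpNorm φ r (volume.restrict (openCube x 1)))

/-- Quasinorm of `B̃^l_{p,q,r}(ℝⁿ, {t_k})`. -/
def tildeBnorm (n l : ℕ) (p q r : ℝ≥0∞) (t : ℕ → Rn n → ℝ) (φ : Rn n → ℝ) : ℝ≥0∞ :=
  tildeBnormE n l p q r (fun k x => ENNReal.ofReal (t k x)) φ

/-- Membership in `B̃^l_{p,q,r}(ℝⁿ, {t_k})`. -/
def MemTildeB (n l : ℕ) (p q r : ℝ≥0∞) (t : ℕ → Rn n → ℝ) (φ : Rn n → ℝ) : Prop :=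
  MemLrLoc n r φ ∧ tildeBnorm n l p q r t φ < ∞

/-- Quasinorm of `B̄^l_{p,q,r}(ℝⁿ, {t_k})`. -/
def barBnorm (n l : ℕ) (p q r : ℝ≥0∞) (t : ℕ → Rn n → ℝ) (φ : Rn n → ℝ) : ℝ≥0∞ :=
  lqNorm q (fun k : ℕ =>
    lpNormE p volume (fun x =>
      ENNReal.ofReal (t (k + 1) x) * barDelta n l r ((2 : ℝ) ^ (-((k : ℤ) + 1))) φ x)) +
  lpNormE p volume (fun x => ENNReal.ofReal (t 0 x) * eLpNorm φ r (volume.restrict (openCube x 1)))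

/-- Membership in `B̄^l_{p,q,r}(ℝⁿ, {t_k})`. -/
def MemBarB (n l : ℕ) (p q r : ℝ≥0∞) (t : ℕ → Rn n → ℝ) (φ : Rn n → ℝ) : Prop :=
  MemLrLoc n r φ ∧ barBnorm n l p q r t φ < ∞

/-- The class `A^{loc}_∞`. -/
def MemAlocInfty (n : ℕ) (w : Rn n → ℝ) : Prop :=
  ∃ α : ℝ, α ∈ Set.Ioo (0 : ℝ) 1 ∧ ∃ M : ℝ≥0∞, M < ∞ ∧
    ∀ (c : Rn n) (s : ℝ), 0 < s → s ≤ 1 →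
      ∀ F : Set (Rn n), F ⊆ cubeAt c s → MeasurableSet F →
        ENNReal.ofReal α * volume (cubeAt c s) ≤ volume F →
        (∫⁻ x in cubeAt c s, ENNReal.ofReal (w x)) ≤ M * ∫⁻ x in F, ENNReal.ofReal (w x)

/-- The class `A^{loc}_1`. -/
def MemAloc1 (n : ℕ) (w : Rn n → ℝ) : Prop :=
  ∃ C : ℝ≥0∞, C < ∞ ∧ ∀ (c : Rn n) (s : ℝ), 0 < s → s ≤ 1 →
    ∀ᵐ x ∂volume.restrict (cubeAt c s),
      (∫⁻ y in cubeAt c s, ENNReal.ofReal (w y)) ≤ C * volume (cubeAt c s) * ENNReal.ofReal (w x)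

/-- The class `A^{loc}_{p₀}` for `p₀ > 1`. -/
def MemAlocGt (n : ℕ) (p₀ : ℝ) (w : Rn n → ℝ) : Prop :=
  ∃ C : ℝ≥0∞, C < ∞ ∧ ∀ (c : Rn n) (s : ℝ), 0 < s → s ≤ 1 →
    ((volume (cubeAt c s))⁻¹ * ∫⁻ y in cubeAt c s, ENNReal.ofReal (w y)) *
      ((volume (cubeAt c s))⁻¹ *
        ∫⁻ y in cubeAt c s, ENNReal.ofReal (w y) ^ (-(1 : ℝ) / (p₀ - 1))) ^ (p₀ - 1) ≤ C

/-- The class `A^{loc}_{p₀}` for `p₀ ∈ [1,∞)`. -/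
def MemAlocP (n : ℕ) (p₀ : ℝ) (w : Rn n → ℝ) : Prop :=
  if p₀ = 1 then MemAloc1 n w else MemAlocGt n p₀ w

/-- The class `{}^{loc}Y^{α₃}_{α₁,α₂}` of weight sequences of variable smoothness. -/
def MemLocY (n : ℕ) (α₁ α₂ α₃ : ℝ) (s : ℕ → Rn n → ℝ) : Prop :=
  (∀ k, IsWeight (s k)) ∧
  (∃ C : ℝ, 0 < C ∧ ∀ j k : ℕ, j ≤ k → ∀ x : Rn n,
    C⁻¹ * (2 : ℝ) ^ (α₁ * ((k : ℝ) - (j : ℝ))) ≤ s k x / s j x ∧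
      s k x / s j x ≤ C * (2 : ℝ) ^ (α₂ * ((k : ℝ) - (j : ℝ)))) ∧
  (∀ k : ℕ, ∀ x y : Rn n, euclNorm (x - y) ≤ (2 : ℝ) ^ (-(k : ℤ)) →
    s k x ≤ (2 : ℝ) ^ α₃ * s k y)

/-- The set `Ξ^{d,n}_{k,m} = Q^n_{k,m} × (2^{-k}B^d ∖ 2^{-k-1}B^d) ⊂ ℝ^{n+d}`. -/
def Xi (n d k : ℕ) (m : Fin n → ℤ) : Set (Rn (n + d)) :=
  {z | (fun i => z (Fin.castAdd d i)) ∈ dyadicCube n k m ∧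
       euclNorm (fun i : Fin d => z (Fin.natAdd n i)) < (2 : ℝ) ^ (-(k : ℤ)) ∧
       (2 : ℝ) ^ (-(k : ℤ) - 1) ≤ euclNorm (fun i : Fin d => z (Fin.natAdd n i))}

/-- The multiple sequence `γ̂_{k,m} = ‖γ‖_{L_p(Ξ^{d,n}_{k,m})}` generated by a weight `γ`. -/
def gammaHat (n d : ℕ) (p : ℝ≥0∞) (γ : Rn (n + d) → ℝ) (k : ℕ) (m : Fin n → ℤ) : ℝ≥0∞ :=
  eLpNorm γ p (volume.restrict (Xi n d k m))

def delta1Good (n d : ℕ) (p : ℝ≥0∞) (γ : Rn (n + d) → ℝ) (δ : ℝ) : Prop :=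
  ∃ C : ℝ≥0∞, C < ∞ ∧ ∀ k j : ℕ, k ≤ j → ∀ m : Fin n → ℤ,
    (∑' m' : {m' : Fin n → ℤ // dyadicCube n j m' ⊆ dyadicCube n k m},
        gammaHat n d p γ j m'.1 ^ p.toReal) ≤
      C * (2 : ℝ≥0∞) ^ ((((k : ℝ) - (j : ℝ)) * (d : ℝ)) * δ) * gammaHat n d p γ k m ^ p.toReal

/-- `δ₁(γ,n,d)`. -/
def delta1 (n d : ℕ) (p : ℝ≥0∞) (γ : Rn (n + d) → ℝ) : ℝ :=
  sSup {δ : ℝ | 0 < δ ∧ delta1Good n d p γ δ}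

def delta2Good (n d : ℕ) (p : ℝ≥0∞) (γ : Rn (n + d) → ℝ) (δ : ℝ) : Prop :=
  ∃ C : ℝ≥0∞, C < ∞ ∧ ∀ k j : ℕ, k ≤ j → ∀ m : Fin n → ℤ,
    ∀ G : Set (Fin n → ℤ), (∀ m' ∈ G, dyadicCube n j m' ⊆ dyadicCube n k m) →
      (∑' m' : G, gammaHat n d p γ j m'.1 ^ p.toReal) ≤
        C * (volume (⋃ m' ∈ G, dyadicCube n j m') / volume (dyadicCube n k m)) ^ δ *
          ∑' m' : {m' : Fin n → ℤ // dyadicCube n j m' ⊆ dyadicCube n k m},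
            gammaHat n d p γ j m'.1 ^ p.toReal

/-- `δ₂(γ,n,d)`. -/
def delta2 (n d : ℕ) (p : ℝ≥0∞) (γ : Rn (n + d) → ℝ) : ℝ :=
  sSup {δ : ℝ | 0 < δ ∧ delta2Good n d p γ δ}

/-- The cardinal B-spline of degree `deg` with knots `0, 1, …, deg + 1`. -/
def cardB : ℕ → ℝ → ℝ
  | 0, x => if 0 ≤ x ∧ x < 1 then 1 else 0
  | (d + 1), x => (x / (d + 1)) * cardB d x + (((d : ℝ) + 2 - x) / (d + 1)) * cardB d (x - 1)

/-- The tensor-product B-spline `N^{deg}_{k,m}` on `ℝⁿ`. -/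
def Bspl (n deg k : ℕ) (m : Fin n → ℤ) (x : Rn n) : ℝ :=
  ∏ i, cardB deg (2 ^ k * x i - (m i : ℝ))

/-- The spline `Σ_m β_m N^{deg}_{k,m}`. -/
def splineSum (n deg k : ℕ) (β : (Fin n → ℤ) → ℝ) (x : Rn n) : ℝ :=
  ∑' m, β m * Bspl n deg k m x

/-- A dyadic spline of degree `deg` (an element of `Σ^{deg} = ⋃_k Σ^{deg}_k`). -/
def IsSplineFn (n deg : ℕ) (S : Rn n → ℝ) : Prop :=
  ∃ (k : ℕ) (β : (Fin n → ℤ) → ℝ), S = splineSum n deg k β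

/-- The weighted best spline approximation `s_k(φ)` by splines of degree `deg`. -/
def sApprox (n deg : ℕ) (p r : ℝ≥0∞) (T : ℕ → (Fin n → ℤ) → ℝ≥0∞) (φ : Rn n → ℝ) (k : ℕ) :
    ℝ≥0∞ :=
  ⨅ β : (Fin n → ℤ) → ℝ,
    lqNorm p (fun m => T k m *
      eLpNorm (fun x => φ x - splineSum n deg k β x) r (volume.restrict (dyadicCube n k m)))

/-- `s_j(φ)` for `j ∈ {-1, 0, 1, 2, …}`, including the term `s_{-1}`. -/
def sApproxZ (n deg : ℕ) (p r : ℝ≥0∞) (T : ℕ → (Fin n → ℤ) → ℝ≥0∞) (φ : Rn n → ℝ) (j : ℤ) :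
    ℝ≥0∞ :=
  if j < 0 then
    lqNorm p (fun m => T 0 m * eLpNorm φ r (volume.restrict (dyadicCube n 0 m)))
  else sApprox n deg p r T φ j.toNat

/-- Local best polynomial approximation `E_l(φ,Q)_r` by polynomials of total degree `< l`. -/
def bestApproxE (n l : ℕ) (r : ℝ≥0∞) (φ : Rn n → ℝ) (Q : Set (Rn n)) : ℝ≥0∞ :=
  ⨅ P : {P : MvPolynomial (Fin n) ℝ // P.totalDegree < l},
    eLpNorm (fun x => φ x - MvPolynomial.eval x P.1) r (volume.restrict Q)

/-- The modulus of continuity `ω_l(φ,Q)_r`. -/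
def modulusE (n l : ℕ) (r : ℝ≥0∞) (φ : Rn n → ℝ) (Q : Set (Rn n)) : ℝ≥0∞ :=
  ⨆ h : Rn n, eLpNorm (difflOn l Q h φ) r (volume : Measure (Rn n))

def partialDeriv {N : ℕ} (i : Fin N) (ψ : Rn N → ℝ) : Rn N → ℝ :=
  fun x => fderiv ℝ ψ x (Pi.single i 1)

def iterPD {N : ℕ} : List (Fin N) → (Rn N → ℝ) → Rn N → ℝ
  | [], ψ => ψ
  | i :: L, ψ => partialDeriv i (iterPD L ψ)

def multiIdxList {N : ℕ} (α : Fin N → ℕ) : List (Fin N) :=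
  (List.finRange N).foldr (fun i L => List.replicate (α i) i ++ L) []

/-- Iterated partial derivative `D^α`. -/
def multiDeriv {N : ℕ} (α : Fin N → ℕ) (ψ : Rn N → ℝ) : Rn N → ℝ :=
  iterPD (multiIdxList α) ψ

/-- `g` is the weak (Sobolev) derivative `D^α f`. -/
def IsWeakDeriv {N : ℕ} (α : Fin N → ℕ) (f g : Rn N → ℝ) : Prop :=
  ∀ ψ : Rn N → ℝ, ContDiff ℝ (⊤ : ℕ∞) ψ → HasCompactSupport ψ →
    ∫ x, f x * multiDeriv α ψ x = (-1 : ℝ) ^ (∑ i, α i) * ∫ x, g x * ψ x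

/-- The weighted Sobolev norm `Σ_{|α| ≤ l} ‖γ · D^α f‖_{L_p}` computed from a system `D` of
weak derivatives. -/
def sobNorm (N : ℕ) (p : ℝ≥0∞) (l : ℕ) (γ : Rn N → ℝ) (D : (Fin N → ℕ) → Rn N → ℝ) : ℝ≥0∞ :=
  ∑' α : Fin N → ℕ,
    if (∑ i, α i) ≤ l then eLpNorm (fun x => γ x * D α x) p volume else 0

/-- Membership in the weighted Sobolev space `W^l_p(ℝ^N, γ)`, witnessed by the system `D`
of weak derivatives of `f`. -/
def MemW (N : ℕ) (p : ℝ≥0∞) (l : ℕ) (γ : Rn N → ℝ) (f : Rn N → ℝ)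
    (D : (Fin N → ℕ) → Rn N → ℝ) : Prop :=
  MeasureTheory.LocallyIntegrable f volume ∧ D 0 = f ∧
    (∀ α : Fin N → ℕ, (∑ i, α i) ≤ l →
      MeasureTheory.LocallyIntegrable (D α) volume ∧ IsWeakDeriv α f (D α)) ∧
    sobNorm N p l γ D < ∞

/-- `φ` is the trace of `f` on the plane `y = 0`. -/
def IsTraceSob {n d : ℕ} (f : Rn (n + d) → ℝ) (φ : Rn n → ℝ) : Prop :=
  ∃ f' : Rn (n + d) → ℝ, f' =ᵐ[volume] f ∧
    ∀ (c : Rn n) (s : ℝ), 0 < s →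
      Filter.Tendsto (fun y : Rn d => ∫ x in cubeAt c s, |f' (Fin.append x y) - φ x|)
        (nhds 0) (nhds 0)

/-- The weight sequence `γ_k(x) = 2^{k(l+n/p)} Σ_m χ_{Q̃^n_{k,m}}(x) γ̂_{k,m}`. -/
def gammaSeq (n d : ℕ) (p : ℝ≥0∞) (l : ℕ) (γ : Rn (n + d) → ℝ) (k : ℕ) (x : Rn n) : ℝ≥0∞ :=
  (2 : ℝ≥0∞) ^ ((k : ℝ) * ((l : ℝ) + (n : ℝ) / p.toReal)) *
    ∑' m : Fin n → ℤ, (dyadicCubeHalf n k m).indicator (fun _ => gammaHat n d p γ k m) x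

/-- Conjugate exponent in `ℝ≥0∞`. -/
def conjE (e : ℝ≥0∞) : ℝ≥0∞ := (1 - e⁻¹)⁻¹

/-- The exponent `p_θ`. -/
def pTheta (p θ : ℝ≥0∞) : ℝ≥0∞ := if θ = ∞ ∧ p = ∞ then 1 else p / θ

section Norms
variable {α : Type*} [MeasurableSpace α] {μ : Measure α} {ι : Type*}

lemma lpNormE_mono_ae {p : ℝ≥0∞} {f g : α → ℝ≥0∞} (h : f ≤ᵐ[μ] g) :
    lpNormE p μ f ≤ lpNormE p μ g := by
  unfold lpNormE
  split_ifs
  · exact essSup_mono_ae h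
  · refine ENNReal.rpow_le_rpow (lintegral_mono_ae ?_) (by positivity)
    filter_upwards [h] with x hx
    exact ENNReal.rpow_le_rpow hx (by positivity)

lemma lpNormE_mono {p : ℝ≥0∞} {f g : α → ℝ≥0∞} (h : ∀ x, f x ≤ g x) :
    lpNormE p μ f ≤ lpNormE p μ g := lpNormE_mono_ae (Eventually.of_forall h)

lemma lpNormE_mono_measure {p : ℝ≥0∞} {ν : Measure α} {f : α → ℝ≥0∞} (h : μ ≤ ν) :
    lpNormE p μ f ≤ lpNormE p ν f := by
  unfold lpNormE
  split_ifs
  · exact essSup_mono_measure' h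
  · exact ENNReal.rpow_le_rpow (lintegral_mono' h le_rfl) (by positivity)

lemma toReal_pos_of {p : ℝ≥0∞} (hp : 0 < p) (hp' : p ≠ ∞) : 0 < p.toReal :=
  ENNReal.toReal_pos hp.ne' hp'

lemma lpNormE_const_mul {p : ℝ≥0∞} (hp : 0 < p) {c : ℝ≥0∞} (hc : c ≠ ∞) (f : α → ℝ≥0∞) :
    lpNormE p μ (fun x => c * f x) = c * lpNormE p μ f := by
  unfold lpNormE
  split_ifs with h
  · exact ENNReal.essSup_const_mul
  · have hp' := toReal_pos_of hp h
    simp_rw [ENNReal.mul_rpow_of_nonneg _ _ hp'.le]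
    rw [lintegral_const_mul' _ _ (ENNReal.rpow_ne_top_of_nonneg hp'.le hc),
      ENNReal.mul_rpow_of_nonneg _ _ (by positivity), ← ENNReal.rpow_mul,
      mul_one_div_cancel hp'.ne', ENNReal.rpow_one]

lemma eLpNorm_eq_lpNormE {r : ℝ≥0∞} (hr : 0 < r) (f : α → ℝ) :
    eLpNorm f r μ = lpNormE r μ (fun x => ‖f x‖ₑ) := by
  unfold lpNormE
  split_ifs with h
  · subst h; rw [eLpNorm_exponent_top]; rfl
  · rw [eLpNorm_eq_lintegral_rpow_enorm_toReal hr.ne' h]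

lemma lqNorm_eq_lpNormE [MeasurableSpace ι] [MeasurableSingletonClass ι] [Countable ι]
    (q : ℝ≥0∞) (c : ι → ℝ≥0∞) : lqNorm q c = lpNormE q Measure.count c := by
  unfold lpNormE lqNorm
  split_ifs with h
  · rw [essSup_count]
  · rw [lintegral_count]

/-- finite Minkowski -/
lemma minkowski_finset {s : ℝ} (hs : 1 ≤ s) (F : Finset ι) (G : ι → α → ℝ≥0∞)
    (hG : ∀ j, AEMeasurable (G j) μ) :
    (∫⁻ x, (∑ j ∈ F, G j x) ^ s ∂μ) ^ (1 / s) ≤ ∑ j ∈ F, (∫⁻ x, G j x ^ s ∂μ) ^ (1 / s) := by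
  have hs0 : 0 < s := by linarith
  induction F using Finset.induction_on with
  | empty => simp [hs0]
  | insert a F ha ih =>
    simp_rw [Finset.sum_insert ha]
    refine le_trans (ENNReal.lintegral_Lp_add_le (hG a)
      (Finset.aemeasurable_fun_sum F fun i _ => hG i) hs) ?_
    gcongr

lemma minkowski_tsum {s : ℝ} (hs : 1 ≤ s) (G : ℕ → α → ℝ≥0∞)
    (hG : ∀ j, AEMeasurable (G j) μ) :
    (∫⁻ x, (∑' j, G j x) ^ s ∂μ) ^ (1 / s) ≤ ∑' j, (∫⁻ x, G j x ^ s ∂μ) ^ (1 / s) := by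
  have hs0 : 0 < s := by linarith
  have h1 : ∀ x, (∑' j, G j x) ^ s = ⨆ N : ℕ, (∑ j ∈ Finset.range N, G j x) ^ s := by
    intro x
    rw [ENNReal.tsum_eq_iSup_nat]
    exact (ENNReal.orderIsoRpow s hs0).map_iSup _
  simp_rw [h1]
  rw [lintegral_iSup']
  · have := (ENNReal.orderIsoRpow (1/s) (by positivity)).map_iSup
      (fun N : ℕ => ∫⁻ x, (∑ j ∈ Finset.range N, G j x) ^ s ∂μ)
    simp only [ENNReal.orderIsoRpow_apply] at this
    rw [this]
    refine iSup_le fun N => (minkowski_finset hs _ G hG).trans (ENNReal.sum_le_tsum _)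
  · intro N
    exact (Finset.aemeasurable_fun_sum _ fun i _ => hG i).pow_const _
  · refine Eventually.of_forall fun x a b hab => ?_
    dsimp only
    gcongr

lemma lpNormE_tsum {p : ℝ≥0∞} {u : ℝ} (hu : 0 < u) (hup : ENNReal.ofReal u ≤ p)
    (F : ℕ → α → ℝ≥0∞) (hF : ∀ j, AEMeasurable (F j) μ) :
    lpNormE p μ (fun x => (∑' j, F j x ^ u) ^ (1 / u)) ^ u ≤ ∑' j, lpNormE p μ (F j) ^ u := by
  unfold lpNormE
  split_ifs with h
  · have h1 : ∀ᵐ x ∂μ, ∀ j, F j x ≤ essSup (F j) μ := ae_all_iff.2 fun j => ENNReal.ae_le_essSup _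
    have : essSup (fun x => (∑' j, F j x ^ u) ^ (1 / u)) μ
        ≤ (∑' j, essSup (F j) μ ^ u) ^ (1 / u) := by
      refine essSup_le_of_ae_le _ ?_
      filter_upwards [h1] with x hx
      gcongr
      exact hx _
    refine (ENNReal.rpow_le_rpow this hu.le).trans ?_
    rw [← ENNReal.rpow_mul, one_div_mul_cancel hu.ne', ENNReal.rpow_one]
  · have hpu : u ≤ p.toReal := by
      have := ENNReal.toReal_mono h hup
      rwa [ENNReal.toReal_ofReal hu.le] at this
    have hp' : 0 < p.toReal := by linarith
    set s := p.toReal / u with hs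
    have hs1 : 1 ≤ s := by rw [hs, le_div_iff₀ hu]; linarith
    have := minkowski_tsum hs1 (fun j x => F j x ^ u) (fun j => (hF j).pow_const u) (μ := μ)
    simp_rw [← ENNReal.rpow_mul] at this ⊢
    have e1 : u * s = p.toReal := by rw [hs]; field_simp
    have e2 : 1 / p.toReal * u = 1 / s := by rw [hs]; field_simp
    have e3 : 1 / u * p.toReal = s := by rw [hs]; field_simp
    simp_rw [e1] at this
    simp_rw [e2, e3]
    exact this

lemma rpow_finset_sum_le {u : ℝ} (hu0 : 0 ≤ u) (hu : u ≤ 1) (s : Finset ι) (a : ι → ℝ≥0∞)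
    (hu0' : 0 < u) : (∑ i ∈ s, a i) ^ u ≤ ∑ i ∈ s, a i ^ u := by
  induction s using Finset.induction_on with
  | empty => simp [hu0']
  | insert b s hb ih =>
    rw [Finset.sum_insert hb, Finset.sum_insert hb]
    exact (ENNReal.rpow_add_le_add_rpow _ _ hu0 hu).trans (by gcongr)

lemma rpow_tsum_le {u : ℝ} (hu0 : 0 < u) (hu : u ≤ 1) (a : ℕ → ℝ≥0∞) :
    (∑' i, a i) ^ u ≤ ∑' i, a i ^ u := by
  rw [ENNReal.tsum_eq_iSup_nat]
  have := (ENNReal.orderIsoRpow u hu0).map_iSup (fun N : ℕ => ∑ i ∈ Finset.range N, a i)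
  simp only [ENNReal.orderIsoRpow_apply] at this
  rw [this]
  exact iSup_le fun N => (rpow_finset_sum_le hu0.le hu _ _ hu0).trans (ENNReal.sum_le_tsum _)

lemma rpow_one_div_self {u : ℝ} (hu : 0 < u) (a : ℝ≥0∞) : (a ^ u) ^ (1 / u) = a := by
  rw [← ENNReal.rpow_mul, mul_one_div_cancel hu.ne', ENNReal.rpow_one]

lemma rpow_self_one_div {u : ℝ} (hu : 0 < u) (a : ℝ≥0∞) : (a ^ (1 / u)) ^ u = a := by
  rw [← ENNReal.rpow_mul, one_div_mul_cancel hu.ne', ENNReal.rpow_one]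

/-- countable `u`-triangle inequality -/
lemma lpNormE_le_tsum {p : ℝ≥0∞} {u : ℝ} (hu : 0 < u) (hu1 : u ≤ 1) (hup : ENNReal.ofReal u ≤ p)
    (f : α → ℝ≥0∞) (F : ℕ → α → ℝ≥0∞) (hF : ∀ j, AEMeasurable (F j) μ)
    (h : ∀ᵐ x ∂μ, f x ≤ ∑' j, F j x) :
    lpNormE p μ f ^ u ≤ ∑' j, lpNormE p μ (F j) ^ u := by
  refine le_trans (ENNReal.rpow_le_rpow (lpNormE_mono_ae ?_) hu.le) (lpNormE_tsum hu hup F hF)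
  filter_upwards [h] with x hx
  refine hx.trans ?_
  conv_lhs => rw [← rpow_one_div_self hu (∑' j, F j x)]
  exact ENNReal.rpow_le_rpow (rpow_tsum_le hu hu1 _) (by positivity)

/-- variant with `u`-powers inside -/
lemma lpNormE_le_tsum' {p : ℝ≥0∞} {u : ℝ} (hu : 0 < u) (hup : ENNReal.ofReal u ≤ p)
    (f : α → ℝ≥0∞) (F : ℕ → α → ℝ≥0∞) (hF : ∀ j, AEMeasurable (F j) μ)
    (h : ∀ᵐ x ∂μ, f x ^ u ≤ ∑' j, F j x ^ u) :
    lpNormE p μ f ^ u ≤ ∑' j, lpNormE p μ (F j) ^ u := by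
  refine le_trans (ENNReal.rpow_le_rpow (lpNormE_mono_ae ?_) hu.le) (lpNormE_tsum hu hup F hF)
  filter_upwards [h] with x hx
  conv_lhs => rw [← rpow_one_div_self hu (f x)]
  exact ENNReal.rpow_le_rpow hx (by positivity)

/-- the exponent `min 1 p` -/
def uu (p : ℝ≥0∞) : ℝ := (min 1 p).toReal

lemma uu_pos {p : ℝ≥0∞} (hp : 0 < p) : 0 < uu p :=
  ENNReal.toReal_pos (by simp [hp.ne']) (by simp)
lemma uu_le_one {p : ℝ≥0∞} : uu p ≤ 1 := by
  have := ENNReal.toReal_mono (by simp) (min_le_left 1 p)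
  simpa [uu] using this
lemma uu_le {p : ℝ≥0∞} : ENNReal.ofReal (uu p) ≤ p := by
  rw [uu, ENNReal.ofReal_toReal (by simp)]; exact min_le_right _ _

/-- quasi-triangle constant -/
def Kq (p : ℝ≥0∞) (N : ℕ) : ℝ≥0∞ := (N : ℝ≥0∞) ^ (1 / uu p)

lemma Kq_lt_top {p : ℝ≥0∞} (hp : 0 < p) (N : ℕ) : Kq p N < ∞ :=
  ENNReal.rpow_lt_top_of_nonneg (by have := uu_pos hp; positivity) (by simp)

lemma lpNormE_sum_le {p : ℝ≥0∞} (hp : 0 < p) (s : Finset ι) (f : α → ℝ≥0∞) (F : ι → α → ℝ≥0∞)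
    (hF : ∀ j, AEMeasurable (F j) μ) (h : ∀ᵐ x ∂μ, f x ≤ ∑ j ∈ s, F j x) :
    lpNormE p μ f ≤ Kq p s.card * ∑ j ∈ s, lpNormE p μ (F j) := by
  have hu := uu_pos hp
  set u := uu p with hu'
  obtain ⟨e⟩ : Nonempty (Fin s.card ≃ s) := ⟨s.equivFin.symm⟩
  set G : ℕ → α → ℝ≥0∞ := fun j => if hj : j < s.card then F (e ⟨j, hj⟩) else 0 with hG
  have hsum : ∀ φ : (α → ℝ≥0∞) → ℝ≥0∞, φ 0 = 0 →
      ∑' j, φ (G j) = ∑ j ∈ s, φ (F j) := by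
    intro φ hφ
    rw [tsum_eq_sum (s := Finset.range s.card)]
    · rw [Finset.sum_range]
      rw [← Finset.sum_coe_sort s, ← e.sum_comp]
      refine Finset.sum_congr rfl fun i _ => ?_
      simp [hG]
    · intro b hb
      simp only [Finset.mem_range, not_lt] at hb
      simp only [hG, dif_neg (not_lt.2 hb)]
      exact hφ
  have hz : lpNormE p μ (0 : α → ℝ≥0∞) = 0 := by
    have := lpNormE_const_mul (μ := μ) hp (c := 0) (by simp) (0 : α → ℝ≥0∞)
    simpa [Pi.zero_def] using this
  have key := lpNormE_le_tsum (μ := μ) hu uu_le_one uu_le f G ?_ ?_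
  · rw [hsum (fun g => lpNormE p μ g ^ u) (by simp only [hz]; exact ENNReal.zero_rpow_of_pos hu)] at key
    have h2 : ∑ j ∈ s, lpNormE p μ (F j) ^ u
        ≤ (s.card : ℝ≥0∞) * (∑ j ∈ s, lpNormE p μ (F j)) ^ u := by
      rw [← nsmul_eq_mul, ← Finset.sum_const]
      refine Finset.sum_le_sum fun i hi => ENNReal.rpow_le_rpow ?_ hu.le
      exact Finset.single_le_sum (f := fun j => lpNormE p μ (F j)) (fun _ _ => zero_le) hi
    have := ENNReal.rpow_le_rpow (key.trans h2) (by positivity : (0:ℝ) ≤ 1 / u)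
    rw [rpow_one_div_self hu, ENNReal.mul_rpow_of_nonneg _ _ (by positivity),
      rpow_one_div_self hu] at this
    exact this
  · intro j
    simp only [hG]
    split_ifs
    · exact hF _
    · exact aemeasurable_const
  · filter_upwards [h] with x hx
    rw [hsum (fun g => g x) rfl]
    exact hx

end Norms

section Seq
variable {ι κ : Type*}

lemma lqNorm_mono {q : ℝ≥0∞} {a b : ι → ℝ≥0∞} (h : ∀ i, a i ≤ b i) : lqNorm q a ≤ lqNorm q b := by
  unfold lqNorm
  split_ifs
  · exact iSup_mono h
  · refine ENNReal.rpow_le_rpow (ENNReal.tsum_le_tsum fun i => ?_) (by positivity)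
    exact ENNReal.rpow_le_rpow (h i) (by positivity)

lemma lqNorm_const_mul {q : ℝ≥0∞} (hq : 0 < q) (c : ℝ≥0∞) (a : ι → ℝ≥0∞) :
    lqNorm q (fun i => c * a i) = c * lqNorm q a := by
  unfold lqNorm
  split_ifs with h
  · rw [ENNReal.mul_iSup]
  · have hp' := toReal_pos_of hq h
    simp_rw [ENNReal.mul_rpow_of_nonneg _ _ hp'.le]
    rw [ENNReal.tsum_mul_left,
      ENNReal.mul_rpow_of_nonneg _ _ (by positivity), ← ENNReal.rpow_mul,
      mul_one_div_cancel hp'.ne', ENNReal.rpow_one]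

lemma le_lqNorm {q : ℝ≥0∞} (hq : 0 < q) (a : ι → ℝ≥0∞) (i : ι) : a i ≤ lqNorm q a := by
  unfold lqNorm
  split_ifs with h
  · exact le_iSup a i
  · have hp' := toReal_pos_of hq h
    conv_lhs => rw [← rpow_one_div_self hp' (a i)]
    exact ENNReal.rpow_le_rpow (ENNReal.le_tsum i) (by positivity)

lemma lqNorm_comp_le {q : ℝ≥0∞} (a : ι → ℝ≥0∞) {e : κ → ι} (he : Function.Injective e) :
    lqNorm q (fun i => a (e i)) ≤ lqNorm q a := by
  unfold lqNorm
  split_ifs with h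
  · exact iSup_comp_le a e
  · exact ENNReal.rpow_le_rpow (ENNReal.tsum_comp_le_tsum_of_injective he (fun i => a i ^ q.toReal)) (by positivity)

lemma lqNorm_zero {q : ℝ≥0∞} (hq : 0 < q) : lqNorm q (fun _ : ι => 0) = 0 := by
  have := lqNorm_const_mul (ι := ι) hq 0 (fun _ => 0)
  simpa using this

lemma lqNorm_antitone {q q' : ℝ≥0∞} (hq : 0 < q) (h : q ≤ q') (a : ι → ℝ≥0∞) :
    lqNorm q' a ≤ lqNorm q a := by
  by_cases h' : q' = ∞
  · conv_lhs => unfold lqNorm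
    rw [if_pos h']
    exact iSup_le fun i => le_lqNorm hq a i
  have hq' : q ≠ ∞ := fun h2 => h' (top_le_iff.1 (h2 ▸ h))
  have p1 := toReal_pos_of hq hq'
  have p2 : q.toReal ≤ q'.toReal := ENNReal.toReal_mono h' h
  have p3 : 0 < q'.toReal := by linarith
  have hle := le_lqNorm hq a
  set A := lqNorm q a with hA
  have hAeq : A = (∑' i, a i ^ q.toReal) ^ (1 / q.toReal) := by rw [hA, lqNorm, if_neg hq']
  by_cases hAt : A = ∞
  · rw [hAt]; exact le_top
  rw [lqNorm, if_neg h']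
  have e1 : ∑' i, a i ^ q.toReal = A ^ q.toReal := by rw [hAeq, rpow_self_one_div p1]
  have : ∑' i, a i ^ q'.toReal ≤ A ^ q'.toReal := by
    calc ∑' i, a i ^ q'.toReal ≤ ∑' i, A ^ (q'.toReal - q.toReal) * a i ^ q.toReal := by
          refine ENNReal.tsum_le_tsum fun i => ?_
          have : q'.toReal = (q'.toReal - q.toReal) + q.toReal := by ring
          conv_lhs => rw [this]
          rw [ENNReal.rpow_add_of_nonneg _ _ (by linarith) p1.le]
          gcongr
          exact hle i
      _ = A ^ (q'.toReal - q.toReal) * A ^ q.toReal := by rw [ENNReal.tsum_mul_left, e1]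
      _ = A ^ q'.toReal := by
          rw [← ENNReal.rpow_add_of_nonneg _ _ (by linarith) p1.le]; ring_nf
  have := ENNReal.rpow_le_rpow this (by positivity : 0 ≤ 1 / q'.toReal)
  rwa [rpow_one_div_self p3] at this

/-- fibering -/
lemma lqNorm_fiber [DecidableEq ι] {q : ℝ≥0∞} (hq : 0 < q) (g : κ → ι) (a : κ → ℝ≥0∞) :
    lqNorm q (fun i => lqNorm q (fun k => if g k = i then a k else 0)) = lqNorm q a := by
  unfold lqNorm
  split_ifs with h
  · apply le_antisymm
    · refine iSup_le fun i => iSup_le fun k => ?_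
      dsimp only
      split_ifs
      · exact le_iSup a k
      · exact zero_le
    · refine iSup_le fun k => ?_
      refine le_iSup_of_le (g k) (le_iSup_of_le k ?_)
      simp
  · have p1 := toReal_pos_of hq h
    simp_rw [rpow_self_one_div p1]
    rw [ENNReal.tsum_comm]
    congr 2
    funext k
    rw [tsum_eq_single (g k)]
    · simp
    · intro b hb
      rw [if_neg (Ne.symm hb), ENNReal.zero_rpow_of_pos p1]

lemma lqNorm_sum_le [Countable ι] {p : ℝ≥0∞} (hp : 0 < p) (s : Finset κ) (f : ι → ℝ≥0∞)
    (F : κ → ι → ℝ≥0∞) (h : ∀ x, f x ≤ ∑ j ∈ s, F j x) :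
    lqNorm p f ≤ Kq p s.card * ∑ j ∈ s, lqNorm p (F j) := by
  let _ : MeasurableSpace ι := ⊤
  simp_rw [lqNorm_eq_lpNormE]
  exact lpNormE_sum_le hp s f F (fun j => (measurable_of_countable _).aemeasurable)
    (Eventually.of_forall h)

lemma lqNorm_le_tsum' [Countable ι] {p : ℝ≥0∞} {u : ℝ} (hu : 0 < u) (hup : ENNReal.ofReal u ≤ p)
    (f : ι → ℝ≥0∞) (F : ℕ → ι → ℝ≥0∞) (h : ∀ x, f x ^ u ≤ ∑' j, F j x ^ u) :
    lqNorm p f ^ u ≤ ∑' j, lqNorm p (F j) ^ u := by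
  let _ : MeasurableSpace ι := ⊤
  simp_rw [lqNorm_eq_lpNormE]
  exact lpNormE_le_tsum' hu hup f F (fun j => (measurable_of_countable _).aemeasurable)
    (Eventually.of_forall h)

end Seq

section Geom
variable {n : ℕ}

abbrev Zn (n : ℕ) := Fin n → ℤ

/-- level-k index of the half-open dyadic cube containing `x` -/
def fl (k : ℕ) (x : Rn n) : Zn n := fun i => ⌊(2 : ℝ) ^ k * x i⌋

/-- ancestor -/
def anc (d : ℕ) (m : Zn n) : Zn n := fun i => m i / 2 ^ d

lemma anc_zero (m : Zn n) : anc 0 m = m := by funext i; simp [anc]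

lemma mem_half_iff (k : ℕ) (m : Zn n) (x : Rn n) : x ∈ dyadicCubeHalf n k m ↔ fl k x = m := by
  have h2 : (0 : ℝ) < 2 ^ k := by positivity
  simp only [dyadicCubeHalf, Set.mem_ofPred_eq, funext_iff, fl, Int.floor_eq_iff]
  refine forall_congr' fun i => ?_
  rw [div_le_iff₀ h2, lt_div_iff₀ h2, mul_comm]

lemma half_eq_preimage (k : ℕ) (m : Zn n) : dyadicCubeHalf n k m = fl k ⁻¹' {m} := by
  ext x; rw [mem_half_iff]; rfl

lemma measurable_fl (k : ℕ) : Measurable (fl k : Rn n → Zn n) := by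
  unfold fl
  refine measurable_pi_lambda _ fun i => ?_
  exact Int.measurable_floor.comp (by fun_prop)

lemma measurableSet_half (k : ℕ) (m : Zn n) : MeasurableSet (dyadicCubeHalf n k m) := by
  rw [half_eq_preimage]; exact measurable_fl k (MeasurableSet.singleton m)

lemma anc_fl {k j : ℕ} (h : k ≤ j) (x : Rn n) : anc (j - k) (fl j x) = fl k x := by
  funext i
  simp only [anc, fl]
  have := Int.floor_div_natCast ((2 : ℝ) ^ j * x i) (2 ^ (j - k))
  push_cast at this
  rw [← this]
  congr 1
  have e : (2 : ℝ) ^ j = 2 ^ k * 2 ^ (j - k) := by rw [← pow_add]; congr 1; omega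
  rw [e]; field_simp

lemma half_eq_pi (k : ℕ) (m : Zn n) : dyadicCubeHalf n k m =
    Set.pi Set.univ (fun i => Set.Ico ((m i : ℝ) / 2 ^ k) (((m i : ℝ) + 1) / 2 ^ k)) := by
  ext x; simp [dyadicCubeHalf]

lemma cube_eq_pi (k : ℕ) (m : Zn n) : dyadicCube n k m =
    Set.pi Set.univ (fun i => Set.Ioo ((m i : ℝ) / 2 ^ k) (((m i : ℝ) + 1) / 2 ^ k)) := by
  ext x; simp [dyadicCube]

lemma restrict_cube (k : ℕ) (m : Zn n) :
    (volume : Measure (Rn n)).restrict (dyadicCube n k m) = volume.restrict (dyadicCubeHalf n k m) := by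
  apply Measure.restrict_congr_set
  rw [cube_eq_pi, half_eq_pi]
  exact (Measure.univ_pi_Ioo_ae_eq_Icc).trans (Measure.univ_pi_Ico_ae_eq_Icc).symm

lemma volume_half (k : ℕ) (m : Zn n) :
    (volume : Measure (Rn n)) (dyadicCubeHalf n k m) = (2 : ℝ≥0∞) ^ (-((k * n : ℕ) : ℝ)) := by
  rw [half_eq_pi, Real.volume_pi_Ico]
  have : ∀ i, ((m i : ℝ) + 1) / 2 ^ k - (m i : ℝ) / 2 ^ k = (2 ^ k)⁻¹ := by
    intro i; field_simp; ring
  simp only [this, Finset.prod_const, Finset.card_univ, Fintype.card_fin]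
  rw [ENNReal.ofReal_inv_of_pos (by positivity), ENNReal.ofReal_pow (by norm_num), ENNReal.rpow_neg,
    ENNReal.rpow_natCast, ← ENNReal.inv_pow, ← pow_mul]
  simp

lemma two_rpow_add (a b : ℝ) : (2 : ℝ≥0∞) ^ (a + b) = 2 ^ a * 2 ^ b :=
  ENNReal.rpow_add _ _ (by norm_num) (by norm_num)
lemma two_rpow_pos (a : ℝ) : 0 < (2 : ℝ≥0∞) ^ a :=
  ENNReal.rpow_pos (by norm_num) (by norm_num)
lemma two_rpow_lt (a : ℝ) : (2 : ℝ≥0∞) ^ a < ∞ :=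
  lt_top_iff_ne_top.2 (ENNReal.rpow_ne_top_of_ne_zero (by norm_num) (by norm_num))
lemma two_rpow_neg_mul (a : ℝ) : (2 : ℝ≥0∞) ^ (-a) * 2 ^ a = 1 := by
  rw [← two_rpow_add]; simp
lemma two_rpow_mul_neg (a : ℝ) : (2 : ℝ≥0∞) ^ a * 2 ^ (-a) = 1 := by
  rw [← two_rpow_add]; simp
lemma two_rpow_inv (a : ℝ) : ((2 : ℝ≥0∞) ^ a)⁻¹ = 2 ^ (-a) := (ENNReal.rpow_neg _ _).symm

lemma lpNormE_zero_measure {α : Type*} [MeasurableSpace α] {p : ℝ≥0∞} (hp : 0 < p)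
    (f : α → ℝ≥0∞) : lpNormE p (0 : Measure α) f = 0 := by
  unfold lpNormE
  split_ifs with h
  · simp
  · have := toReal_pos_of hp h
    simp [this]

lemma lpNormE_fiber {α ι : Type*} [MeasurableSpace α] [Countable ι] {μ : Measure α}
    {p : ℝ≥0∞} (hp : 0 < p) (s : ι → Set α) (hs : ∀ i, MeasurableSet (s i))
    (hd : Pairwise (Function.onFun Disjoint s)) (hU : ⋃ i, s i = Set.univ) (f : α → ℝ≥0∞) :
    lpNormE p μ f = lqNorm p (fun i => lpNormE p (μ.restrict (s i)) f) := by
  unfold lpNormE lqNorm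
  split_ifs with h
  · apply le_antisymm
    · refine essSup_le_of_ae_le _ ?_
      have h1 : ∀ i, ∀ᵐ x ∂μ, x ∈ s i → f x ≤ essSup f (μ.restrict (s i)) := by
        intro i
        rw [← ae_restrict_iff' (hs i)]
        exact ENNReal.ae_le_essSup f
      filter_upwards [ae_all_iff.2 h1] with x hx
      have : x ∈ ⋃ i, s i := by rw [hU]; trivial
      obtain ⟨i, hi⟩ := Set.mem_iUnion.1 this
      exact (hx i hi).trans (le_iSup (fun i => essSup f (μ.restrict (s i))) i)
    · exact iSup_le fun i => essSup_mono_measure' Measure.restrict_le_self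
  · have hp' := toReal_pos_of hp h
    simp_rw [rpow_self_one_div hp']
    rw [← lintegral_iUnion hs hd, hU, Measure.restrict_univ]

lemma half_disj (k : ℕ) : Pairwise (Function.onFun Disjoint (dyadicCubeHalf n k)) := by
  intro a b hab
  rw [Function.onFun, Set.disjoint_left]
  intro x hx hx'
  rw [mem_half_iff] at hx hx'
  exact hab (hx.symm.trans hx')

lemma half_cover (k : ℕ) : ⋃ m, dyadicCubeHalf n k m = Set.univ := by
  ext x; simp [mem_half_iff]

lemma lpNormE_cubes {p : ℝ≥0∞} (hp : 0 < p) (k : ℕ) (f : Rn n → ℝ≥0∞) :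
    lpNormE p volume f = lqNorm p (fun m => lpNormE p (volume.restrict (dyadicCubeHalf n k m)) f) :=
  lpNormE_fiber hp _ (measurableSet_half k) (half_disj k) (half_cover k) f

lemma half_inter {k j : ℕ} (h : k ≤ j) (m m' : Zn n) :
    dyadicCubeHalf n j m' ∩ dyadicCubeHalf n k m =
      if anc (j - k) m' = m then dyadicCubeHalf n j m' else ∅ := by
  ext x
  simp only [Set.mem_inter_iff, mem_half_iff]
  constructor
  · rintro ⟨h1, h2⟩
    rw [if_pos (by rw [← h1, anc_fl h, h2]), mem_half_iff]; exact h1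
  · intro hx
    split_ifs at hx with hm
    · rw [mem_half_iff] at hx
      exact ⟨hx, by rw [← anc_fl h, hx, hm]⟩
    · exact hx.elim

lemma half_subset {k j : ℕ} (h : k ≤ j) (m' : Zn n) :
    dyadicCubeHalf n j m' ⊆ dyadicCubeHalf n k (anc (j - k) m') := by
  intro x hx
  rw [mem_half_iff] at *
  rw [← anc_fl h, hx]

lemma lpNormE_subcubes {p : ℝ≥0∞} (hp : 0 < p) {k j : ℕ} (h : k ≤ j) (m : Zn n) (f : Rn n → ℝ≥0∞) :
    lpNormE p (volume.restrict (dyadicCubeHalf n k m)) f =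
      lqNorm p (fun m' => if anc (j - k) m' = m then
        lpNormE p (volume.restrict (dyadicCubeHalf n j m')) f else 0) := by
  rw [lpNormE_fiber hp _ (measurableSet_half j) (half_disj j) (half_cover j) f]
  congr 1
  funext m'
  rw [Measure.restrict_restrict (measurableSet_half j m'), half_inter h]
  split_ifs
  · rfl
  · rw [Measure.restrict_empty, lpNormE_zero_measure hp]

lemma lpNormE_const_half {p : ℝ≥0∞} (hp : 0 < p) (k : ℕ) (m : Zn n) (c : ℝ≥0∞) :
    lpNormE p (volume.restrict (dyadicCubeHalf n k m)) (fun _ => c) =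
      c * 2 ^ (-((k * n : ℕ) : ℝ) / p.toReal) := by
  have hv := volume_half k m
  unfold lpNormE
  split_ifs with h
  · rw [h, essSup_const]
    · simp
    · rw [Ne, Measure.restrict_eq_zero, hv]; exact (two_rpow_pos _).ne'
  · have hp' := toReal_pos_of hp h
    rw [lintegral_const, Measure.restrict_apply_univ, hv, ENNReal.mul_rpow_of_nonneg _ _ (by positivity),
      rpow_one_div_self hp', ← ENNReal.rpow_mul]
    congr 2; ring

lemma lpNormE_congr_half {p : ℝ≥0∞} (k : ℕ) (m : Zn n) {f g : Rn n → ℝ≥0∞}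
    (h : ∀ x ∈ dyadicCubeHalf n k m, f x = g x) :
    lpNormE p (volume.restrict (dyadicCubeHalf n k m)) f =
    lpNormE p (volume.restrict (dyadicCubeHalf n k m)) g := by
  apply le_antisymm <;> apply lpNormE_mono_ae <;>
    filter_upwards [ae_restrict_mem (measurableSet_half k m)] with x hx
  · exact (h x hx).le
  · exact (h x hx).ge

lemma avgNorm_eq {e : ℝ≥0∞} (k : ℕ) (Q : Set (Rn n)) (f : Rn n → ℝ≥0∞) :
    avgNorm n k e Q f = 2 ^ (((k * n : ℕ) : ℝ) / e.toReal) * lpNormE e (volume.restrict Q) f := by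
  unfold avgNorm lpNormE
  split_ifs with h
  · simp [h]
  · rw [ENNReal.mul_rpow_of_nonneg _ _ (by positivity)]
    congr 1
    rw [← ENNReal.rpow_natCast, ← ENNReal.rpow_mul]
    congr 1; ring

lemma tbarOf_on (p : ℝ≥0∞) (T : ℕ → Zn n → ℝ≥0∞) (k : ℕ) (m : Zn n) {x : Rn n}
    (hx : x ∈ dyadicCubeHalf n k m) :
    tbarOf n p T k x = 2 ^ (((k * n : ℕ) : ℝ) / p.toReal) * T k m := by
  unfold tbarOf
  congr 1
  rw [tsum_eq_single m]
  · simp [hx]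
  · intro b hb
    rw [Set.indicator_of_notMem]
    intro h
    rw [mem_half_iff] at hx h
    exact hb (h.symm.trans hx)

end Geom

section Holder
variable {ι : Type*}

lemma lqNorm_holder [Countable ι] {θ p σ : ℝ≥0∞} (hθ : 0 < θ)
    (h : (σ = ∞ ∧ θ = p) ∨ (p = ∞ ∧ σ = θ) ∨
      (θ ≠ ∞ ∧ p ≠ ∞ ∧ σ ≠ ∞ ∧ 0 < σ ∧ θ < p ∧ 1 / θ.toReal = 1 / p.toReal + 1 / σ.toReal))
    (a b : ι → ℝ≥0∞) :
    lqNorm θ (fun i => a i * b i) ≤ lqNorm σ a * lqNorm p b := by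
  rcases h with ⟨rfl, rfl⟩ | ⟨rfl, rfl⟩ | ⟨h1, h2, h3, h4, h5, h6⟩
  · rw [← lqNorm_const_mul hθ]
    exact lqNorm_mono fun i => mul_le_mul_left (le_lqNorm (by simp) a i) _
  · rw [mul_comm, ← lqNorm_const_mul hθ]
    refine lqNorm_mono fun i => ?_
    rw [mul_comm]
    exact mul_le_mul_left (le_lqNorm (by simp) b i) _
  · letI : MeasurableSpace ι := ⊤
    have p0 := toReal_pos_of hθ h1
    have p1 : θ.toReal < p.toReal := (ENNReal.toReal_lt_toReal h1 h2).2 h5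
    have := ENNReal.lintegral_Lp_mul_le_Lq_mul_Lr p0 p1 h6 (Measure.count : Measure ι)
      (f := b) (g := a) (measurable_of_countable _).aemeasurable (measurable_of_countable _).aemeasurable
    simp only [lqNorm, if_neg h1, if_neg h2, if_neg h3]
    simp only [lintegral_count, Pi.mul_apply] at this
    rw [mul_comm]
    simpa only [mul_comm] using this

lemma sigma_tri {p θ : ℝ≥0∞} (hθ : 0 < θ) (hθp : θ ≤ p) :
    ((θ * conjE (pTheta p θ) = ∞ ∧ θ = p) ∨ (p = ∞ ∧ θ * conjE (pTheta p θ) = θ) ∨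
      (θ ≠ ∞ ∧ p ≠ ∞ ∧ θ * conjE (pTheta p θ) ≠ ∞ ∧ 0 < θ * conjE (pTheta p θ) ∧ θ < p ∧
      1 / θ.toReal = 1 / p.toReal + 1 / (θ * conjE (pTheta p θ)).toReal)) := by
  by_cases h1 : θ = p
  · left
    refine ⟨?_, h1⟩
    subst h1
    have : pTheta θ θ = 1 := by
      unfold pTheta; split_ifs with h
      · rfl
      · exact ENNReal.div_self hθ.ne' (by simpa using h)
    rw [this]; simp [conjE, hθ.ne']
  have hlt := lt_of_le_of_ne hθp h1
  have hθt : θ ≠ ∞ := hlt.ne_top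
  have e : pTheta p θ = p / θ := by unfold pTheta; rw [if_neg (by tauto)]
  by_cases h2 : p = ∞
  · right; left
    refine ⟨h2, ?_⟩
    rw [e, h2, ENNReal.top_div_of_ne_top hθt]; simp [conjE]
  · right; right
    have p0 := toReal_pos_of hθ hθt
    have p1 : θ.toReal < p.toReal := (ENNReal.toReal_lt_toReal hθt h2).2 hlt
    have key : θ * conjE (pTheta p θ) = ENNReal.ofReal (θ.toReal * (1 - θ.toReal / p.toReal)⁻¹) := by
      have h3 : (p / θ)⁻¹ = ENNReal.ofReal (θ.toReal / p.toReal) := by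
        rw [ENNReal.inv_div (Or.inl hθt) (Or.inl hθ.ne'), ENNReal.ofReal_div_of_pos (by linarith),
          ENNReal.ofReal_toReal hθt, ENNReal.ofReal_toReal h2]
      have h4 : 0 < 1 - θ.toReal / p.toReal := by
        rw [sub_pos, div_lt_one (by linarith)]; exact p1
      rw [e, conjE, h3, ← ENNReal.ofReal_one, ← ENNReal.ofReal_sub _ (by positivity),
        ← ENNReal.ofReal_inv_of_pos h4, ENNReal.ofReal_mul p0.le, ENNReal.ofReal_toReal hθt]
    have h4 : 0 < 1 - θ.toReal / p.toReal := by
        rw [sub_pos, div_lt_one (by linarith)]; exact p1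
    rw [key]
    refine ⟨hθt, h2, ENNReal.ofReal_ne_top, ENNReal.ofReal_pos.2 (by positivity), hlt, ?_⟩
    rw [ENNReal.toReal_ofReal (by positivity)]
    have : p.toReal ≠ 0 := by linarith
    field_simp
    ring

lemma sigma_sum {p θ σ : ℝ≥0∞} (h : (σ = ∞ ∧ θ = p) ∨ (p = ∞ ∧ σ = θ) ∨
      (θ ≠ ∞ ∧ p ≠ ∞ ∧ σ ≠ ∞ ∧ 0 < σ ∧ θ < p ∧ 1 / θ.toReal = 1 / p.toReal + 1 / σ.toReal)) :
    1 / θ.toReal = 1 / p.toReal + 1 / σ.toReal := by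
  rcases h with ⟨rfl, rfl⟩ | ⟨rfl, rfl⟩ | ⟨h1, h2, h3, h4, h5, h6⟩
  · simp
  · simp
  · exact h6

end Holder

section Weights
variable {n : ℕ}

/-- the facts on the weights which are used in the proof -/
structure WT (n : ℕ) (p r : ℝ≥0∞) (T : ℕ → Zn n → ℝ≥0∞) (ε α₂ : ℝ) (C A : ℝ≥0∞) : Prop where
  pos : ∀ k m, 0 < T k m
  fin : ∀ k m, T k m < ∞
  hC : C < ∞
  hA : A < ∞
  hA1 : 1 ≤ A
  near : ∀ k m o, (∀ i, |o i| ≤ 1) → T k m ≤ A * T k (m + o)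
  low : ∀ k j, k ≤ j → ∀ m, lqNorm p (fun m' => if anc (j - k) m' = m then T j m' else 0) ≤
    C * 2 ^ (α₂ * ((j : ℝ) - k)) * T k m
  high : ∀ k j, k ≤ j → ∀ m (d : Zn n → ℝ≥0∞),
    T k m * 2 ^ (-((j : ℝ) - k) * n / r.toReal) *
      lqNorm r (fun m' => if anc (j - k) m' = m then d m' else 0) ≤
    C * 2 ^ (-ε * ((j : ℝ) - k)) * lqNorm p (fun m' => if anc (j - k) m' = m then T j m' * d m' else 0)

lemma tkm_lt_top {p : ℝ≥0∞} {t : ℕ → Rn n → ℝ} (h : pAdmissible n p t) (k : ℕ) (m : Zn n) :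
    tkm n p t k m < ∞ := by
  refine lt_of_le_of_lt (eLpNorm_mono_measure _ (Measure.restrict_mono (s' :=
    Set.Icc (fun i => (m i : ℝ) / 2 ^ k) (fun i => ((m i : ℝ) + 1) / 2 ^ k)) ?_ le_rfl))
    ((h k).2.2 _ isCompact_Icc)
  intro x hx
  exact ⟨fun i => (hx i).1.le, fun i => (hx i).2.le⟩

lemma weights_WT {p r θ : ℝ≥0∞} (hp : 0 < p) (hθ0 : 0 < θ) (hθp : θ ≤ p) (hθr : θ ≤ r)
    {α₁ α₂ α₃ : ℝ} (hα₃ : 0 ≤ α₃) {t : ℕ → Rn n → ℝ}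
    (ht : MemX n α₁ α₂ α₃ (θ * conjE (pTheta p θ)) p p t) :
    ∃ C A, WT n p r (tkm n p t) (α₁ - n * (1 / θ.toReal - 1 / r.toReal)) α₂ C A := by
  obtain ⟨hadm, ⟨C₁, hC₁0, hC₁, h1⟩, ⟨C₂, hC₂0, hC₂, h2⟩, h3⟩ := ht
  set T := tkm n p t with hT
  have hpos : ∀ k m, 0 < T k m := fun k m => (h3 k m m (by simp)).1
  have hfin : ∀ k m, T k m < ∞ := tkm_lt_top hadm
  have htri := sigma_tri hθ0 hθp
  have hsum := sigma_sum htri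
  set σ := θ * conjE (pTheta p θ) with hσ
  have hσ0 : 0 < σ := by
    rcases htri with h | h | h
    · rw [h.1]; simp
    · rw [h.2]; exact hθ0
    · exact h.2.2.2.1
  have avgp : ∀ k j, k ≤ j → ∀ m, avgNorm n k p (dyadicCube n k m) (tbarOf n p T j) =
      2 ^ (((k * n : ℕ) : ℝ) / p.toReal) *
        lqNorm p (fun m' => if anc (j - k) m' = m then T j m' else 0) := by
    intro k j hkj m
    rw [avgNorm_eq, restrict_cube, lpNormE_subcubes hp hkj]
    congr 2
    funext m'
    split_ifs
    · rw [lpNormE_congr_half j m' (g := fun _ => 2 ^ (((j * n : ℕ) : ℝ) / p.toReal) * T j m')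
        (fun x hx => tbarOf_on p T j m' hx), lpNormE_const_half hp]
      rw [mul_comm, ← mul_assoc, ← two_rpow_add, neg_div]; simp
    · rfl
  have avgk : ∀ k m, avgNorm n k p (dyadicCube n k m) (tbarOf n p T k) =
      2 ^ (((k * n : ℕ) : ℝ) / p.toReal) * T k m := by
    intro k m
    rw [avgNorm_eq, restrict_cube, lpNormE_congr_half k m
      (g := fun _ => 2 ^ (((k * n : ℕ) : ℝ) / p.toReal) * T k m)
        (fun x hx => tbarOf_on p T k m hx), lpNormE_const_half hp]
    congr 1
    rw [mul_comm, ← mul_assoc, ← two_rpow_add, neg_div]; simp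
  have avgs : ∀ k j, k ≤ j → ∀ m, avgNorm n k σ (dyadicCube n k m) (fun x => (tbarOf n p T j x)⁻¹) =
      2 ^ (((k * n : ℕ) : ℝ) / σ.toReal) * (2 ^ (-((j * n : ℕ) : ℝ) / θ.toReal) *
        lqNorm σ (fun m' => if anc (j - k) m' = m then (T j m')⁻¹ else 0)) := by
    intro k j hkj m
    rw [avgNorm_eq, restrict_cube, lpNormE_subcubes hσ0 hkj, ← lqNorm_const_mul hσ0 (2 ^ (-((j * n : ℕ) : ℝ) / θ.toReal))]
    congr 2
    funext m'
    split_ifs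
    · rw [lpNormE_congr_half j m' (g := fun _ => (2 ^ (((j * n : ℕ) : ℝ) / p.toReal) * T j m')⁻¹)
        (fun x hx => by rw [tbarOf_on p T j m' hx]), lpNormE_const_half hσ0]
      rw [ENNReal.mul_inv (Or.inl (two_rpow_pos _).ne') (Or.inl (two_rpow_lt _).ne), two_rpow_inv,
        mul_right_comm, ← two_rpow_add]
      congr 2
      have : -((j * n : ℕ) : ℝ) / θ.toReal = -((j * n : ℕ) : ℝ) * (1 / θ.toReal) := by ring
      rw [this, hsum]; ring
    · simp
  refine ⟨max C₁ C₂, 2 ^ α₃, hpos, hfin, max_lt hC₁ hC₂, two_rpow_lt _, ?_, ?_, ?_, ?_⟩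
  · rcases hα₃.eq_or_lt with h | h
    · simp [← h]
    · exact ENNReal.one_le_rpow (by norm_num) h
  · intro k m o ho
    refine (h3 k m (m + o) ?_).2
    intro i; simpa using ho i
  · intro k j hkj m
    have := h2 k j hkj m
    rw [avgp k j hkj, avgk] at this
    have e : (2 ^ (((k * n : ℕ) : ℝ) / p.toReal) * T k m) ≠ 0 :=
      mul_ne_zero (two_rpow_pos _).ne' (hpos k m).ne'
    have e' : (2 ^ (((k * n : ℕ) : ℝ) / p.toReal) * T k m) ≠ ∞ :=
      ENNReal.mul_ne_top (two_rpow_lt _).ne (hfin k m).ne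
    rw [mul_comm, ← div_eq_mul_inv, ENNReal.div_le_iff e e'] at this
    set X := lqNorm p (fun m' => if anc (j - k) m' = m then T j m' else 0)
    have h5 := mul_le_mul_right this (2 ^ (-(((k * n : ℕ) : ℝ) / p.toReal)))
    rw [← mul_assoc, two_rpow_neg_mul, one_mul] at h5
    refine h5.trans ?_
    rw [show 2 ^ (-(((k * n : ℕ) : ℝ) / p.toReal)) * (C₂ * 2 ^ (α₂ * ((j : ℝ) - k)) *
      (2 ^ (((k * n : ℕ) : ℝ) / p.toReal) * T k m)) = (2 ^ (-(((k * n : ℕ) : ℝ) / p.toReal)) *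
      2 ^ (((k * n : ℕ) : ℝ) / p.toReal)) * (C₂ * 2 ^ (α₂ * ((j : ℝ) - k)) * T k m) by ring,
      two_rpow_neg_mul, one_mul]
    gcongr
    exact le_max_right _ _
  · intro k j hkj m d
    have := h1 k j hkj m
    rw [avgk, avgs k j hkj] at this
    set X := lqNorm σ (fun m' => if anc (j - k) m' = m then (T j m')⁻¹ else 0)
    have hold : lqNorm r (fun m' => if anc (j - k) m' = m then d m' else 0) ≤
        X * lqNorm p (fun m' => if anc (j - k) m' = m then T j m' * d m' else 0) := by
      refine (lqNorm_antitone hθ0 hθr _).trans ?_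
      refine le_trans (le_of_eq ?_) (lqNorm_holder hθ0 htri _ _)
      congr 1
      funext m'
      split_ifs
      · rw [← mul_assoc, ENNReal.inv_mul_cancel (hpos _ _).ne' (hfin _ _).ne, one_mul]
      · simp
    have hX : T k m * X ≤ C₁ * 2 ^ (((j : ℝ) - k) * (n / θ.toReal - α₁)) := by
      have h5 := mul_le_mul_right this (2 ^ (((j : ℝ) - k) * (n / θ.toReal)))
      refine le_trans (le_of_eq ?_) (h5.trans (le_of_eq ?_))
      · rw [show ∀ a b c d : ℝ≥0∞, a * (b * T k m * (c * (d * X))) = (a * b * c * d) * (T k m * X) by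
          intros; ring]
        rw [← two_rpow_add, ← two_rpow_add, ← two_rpow_add]
        rw [show ((j : ℝ) - k) * (n / θ.toReal) + ((k * n : ℕ) : ℝ) / p.toReal +
          ((k * n : ℕ) : ℝ) / σ.toReal + -((j * n : ℕ) : ℝ) / θ.toReal = 0 by
            have : (n : ℝ) / θ.toReal = n * (1 / θ.toReal) := by ring
            have h8 : -((j * n : ℕ) : ℝ) / θ.toReal = -((j * n : ℕ) : ℝ) * (1 / θ.toReal) := by ring
            rw [this, h8, hsum]; push_cast; ring]
        simp
      · rw [mul_left_comm, ← two_rpow_add]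
        congr 2; ring
    calc T k m * 2 ^ (-((j : ℝ) - k) * n / r.toReal) *
      lqNorm r (fun m' => if anc (j - k) m' = m then d m' else 0)
        ≤ T k m * 2 ^ (-((j : ℝ) - k) * n / r.toReal) *
         (X * lqNorm p (fun m' => if anc (j - k) m' = m then T j m' * d m' else 0)) := by gcongr
      _ = (T k m * X) * 2 ^ (-((j : ℝ) - k) * n / r.toReal) *
         lqNorm p (fun m' => if anc (j - k) m' = m then T j m' * d m' else 0) := by ring
      _ ≤ (C₁ * 2 ^ (((j : ℝ) - k) * (n / θ.toReal - α₁))) * 2 ^ (-((j : ℝ) - k) * n / r.toReal) *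
         lqNorm p (fun m' => if anc (j - k) m' = m then T j m' * d m' else 0) := by gcongr
      _ ≤ _ := by
        rw [mul_assoc C₁, ← two_rpow_add]
        refine mul_le_mul_left (mul_le_mul' (le_max_left _ _) (le_of_eq ?_)) _
        congr 1; ring

namespace WT
variable {p r : ℝ≥0∞} {T : ℕ → Zn n → ℝ≥0∞} {ε α₂ : ℝ} {C A : ℝ≥0∞}

lemma nearR (h : WT n p r T ε α₂ C A) (R : ℕ) (k : ℕ) (m o : Zn n) (ho : ∀ i, |o i| ≤ R) :
    T k m ≤ A ^ R * T k (m + o) := by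
  induction R generalizing m o with
  | zero =>
    have : o = 0 := by funext i; simpa using ho i
    simp [this]
  | succ R ih =>
    -- sign step
    set s : Zn n := fun i => (o i).sign with hs
    have hs1 : ∀ i, |s i| ≤ 1 := by
      intro i
      rcases lt_trichotomy (o i) 0 with h | h | h
      · simp [hs, Int.sign_eq_neg_one_of_neg h]
      · simp [hs, h]
      · simp [hs, Int.sign_eq_one_of_pos h]
    have h2 := h.near k m s hs1
    have h3 := ih (m + s) (o - s) (by
      intro i
      have := ho i
      push_cast at this
      rcases lt_trichotomy (o i) 0 with h | h | h
      · simp only [hs, Pi.sub_apply, Int.sign_eq_neg_one_of_neg h]; rw [abs_le] at *; omega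
      · simp [hs, h]
      · simp only [hs, Pi.sub_apply, Int.sign_eq_one_of_pos h]; rw [abs_le] at *; omega)
    rw [show m + s + (o - s) = m + o by abel] at h3
    calc T k m ≤ A * T k (m + s) := h2
      _ ≤ A * (A ^ R * T k (m + o)) := by gcongr
      _ = _ := by ring

lemma LOW (h : WT n p r T ε α₂ C A) (hp : 0 < p) (R : ℕ) {k K : ℕ} (hk : k ≤ K) (d : Zn n → ℝ≥0∞)
    (o : Zn n) (ho : ∀ i, |o i| ≤ R) :
    lqNorm p (fun m => T K m * d (anc (K - k) m + o)) ≤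
      C * A ^ R * 2 ^ (α₂ * ((K : ℝ) - k)) * lqNorm p (fun m => T k m * d m) := by
  rw [← lqNorm_fiber hp (anc (K - k)) (fun m => T K m * d (anc (K - k) m + o))]
  calc _ ≤ lqNorm p (fun i => (C * A ^ R * 2 ^ (α₂ * ((K : ℝ) - k))) *
            (T k (i + o) * d (i + o))) := by
        refine lqNorm_mono fun i => ?_
        calc _ = lqNorm p (fun m => d (i + o) * if anc (K - k) m = i then T K m else 0) := by
              congr 1; funext m
              split_ifs with hh
              · rw [hh, mul_comm]
              · simp
          _ = d (i + o) * lqNorm p (fun m => if anc (K - k) m = i then T K m else 0) :=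
              lqNorm_const_mul hp _ _
          _ ≤ d (i + o) * (C * 2 ^ (α₂ * ((K : ℝ) - k)) * (A ^ R * T k (i + o))) := by
              gcongr
              exact (h.low k K hk i).trans (by gcongr; exact h.nearR R k i o ho)
          _ = _ := by ring
    _ = C * A ^ R * 2 ^ (α₂ * ((K : ℝ) - k)) * lqNorm p (fun i => T k (i + o) * d (i + o)) :=
        lqNorm_const_mul hp _ _
    _ ≤ _ := by
        gcongr
        exact lqNorm_comp_le (fun m => T k m * d m) (e := fun i => i + o) (add_left_injective o)

/-- sum version of `high` : for all m simultaneously -/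
lemma HIGH (h : WT n p r T ε α₂ C A) (hp : 0 < p) (R : ℕ) {k j : ℕ} (hk : k ≤ j) (d : Zn n → ℝ≥0∞)
    (o : Zn n) (ho : ∀ i, |o i| ≤ R) :
    lqNorm p (fun m => T k m * (2 ^ (-((j : ℝ) - k) * n / r.toReal) *
      lqNorm r (fun m' => if anc (j - k) m' = m + o then d m' else 0))) ≤
      C * A ^ R * 2 ^ (-ε * ((j : ℝ) - k)) * lqNorm p (fun m => T j m * d m) := by
  rw [← lqNorm_fiber hp (anc (j - k)) (fun m => T j m * d m), ← lqNorm_const_mul hp]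
  generalize hG : (fun m => C * A ^ R * 2 ^ (-ε * ((j : ℝ) - k)) *
    lqNorm p (fun m' => if anc (j - k) m' = m then T j m' * d m' else 0)) = G
  have hG' : ∀ m, A ^ R * (C * 2 ^ (-ε * ((j : ℝ) - k)) *
    lqNorm p (fun m' => if anc (j - k) m' = m then T j m' * d m' else 0)) = G m := by
    intro m; rw [← hG]; ring
  have h2 : ∀ m, T k m * (2 ^ (-((j : ℝ) - k) * n / r.toReal) *
      lqNorm r (fun m' => if anc (j - k) m' = m + o then d m' else 0)) ≤ G (m + o) := by
    intro m
    rw [← hG' (m + o)]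
    refine le_trans (mul_le_mul_left (h.nearR R k m o ho) _) ?_
    refine le_trans (le_of_eq ?_) (mul_le_mul_right (h.high k j hk (m + o) d) (A ^ R))
    ring
  exact (lqNorm_mono h2).trans (lqNorm_comp_le G (e := fun i => i + o) (add_left_injective o))

end WT
end Weights

section Spline1

lemma cardB_zero_eq (x : ℝ) : cardB 0 x = if 0 ≤ x ∧ x < 1 then 1 else 0 := rfl
lemma cardB_succ (d : ℕ) (x : ℝ) : cardB (d + 1) x =
    (x / (d + 1)) * cardB d x + (((d : ℝ) + 2 - x) / (d + 1)) * cardB d (x - 1) := rfl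

lemma cardB_supp (d : ℕ) : ∀ x : ℝ, (x < 0 ∨ (d : ℝ) + 1 ≤ x) → cardB d x = 0 := by
  induction d with
  | zero =>
    intro x hx
    rw [cardB_zero_eq, if_neg]
    rintro ⟨h1, h2⟩
    rcases hx with h | h
    · linarith
    · push_cast at h; linarith
  | succ d ih =>
    intro x hx
    push_cast at hx
    rw [cardB_succ, ih x (by rcases hx with h | h <;> [left; right] <;> linarith),
      ih (x - 1) (by rcases hx with h | h <;> [left; right] <;> linarith)]
    ring

lemma cardB_bound (d : ℕ) : ∀ x : ℝ, |cardB d x| ≤ 4 ^ d := by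
  induction d with
  | zero =>
    intro x; rw [cardB_zero_eq]; split_ifs <;> simp
  | succ d ih =>
    intro x
    by_cases hx : x < 0 ∨ ((d + 1 : ℕ) : ℝ) + 1 ≤ x
    · rw [cardB_supp (d + 1) x hx]; simp
    · push Not at hx
      obtain ⟨h1, h2⟩ := hx
      push_cast at h2
      have hd : (0 : ℝ) ≤ d := by positivity
      have a1 : |x / ((d : ℝ) + 1)| ≤ 2 := by
        rw [abs_of_nonneg (by positivity), div_le_iff₀ (by linarith)]; linarith
      have a2 : |((d : ℝ) + 2 - x) / ((d : ℝ) + 1)| ≤ 2 := by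
        rw [abs_of_nonneg (div_nonneg (by linarith) (by linarith)), div_le_iff₀ (by linarith)]; linarith
      rw [cardB_succ]
      calc _ ≤ |x / ((d : ℝ) + 1)| * |cardB d x| + |((d : ℝ) + 2 - x) / ((d : ℝ) + 1)| * |cardB d (x - 1)| := by
            rw [← abs_mul, ← abs_mul]; exact abs_add_le _ _
        _ ≤ 2 * 4 ^ d + 2 * 4 ^ d := by
            gcongr
            · exact ih x
            · exact ih (x - 1)
        _ = 4 ^ (d + 1) := by ring

lemma cardB_measurable (d : ℕ) : Measurable (cardB d) := by
  induction d with
  | zero =>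
    refine Measurable.ite ?_ measurable_const measurable_const
    exact measurableSet_Ico (a := (0 : ℝ)) (b := 1)
  | succ d ih =>
    have : Measurable fun x => (x / ((d : ℝ) + 1)) * cardB d x + (((d : ℝ) + 2 - x) / (d + 1)) * cardB d (x - 1) := by
      fun_prop
    exact this

lemma cardB_one (x : ℝ) : cardB 1 x = max 0 (min x (2 - x)) := by
  rw [cardB_succ, cardB_zero_eq, cardB_zero_eq]
  push_cast
  by_cases h0 : 0 ≤ x
  · by_cases h1 : x < 1
    · rw [if_pos ⟨h0, h1⟩, if_neg (by rintro ⟨h, _⟩; linarith), min_eq_left (by linarith),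
        max_eq_right h0]; ring
    · push Not at h1
      rw [if_neg (by rintro ⟨_, h⟩; linarith)]
      rw [min_eq_right (by linarith)]
      by_cases h2 : x < 2
      · rw [if_pos ⟨by linarith, by linarith⟩, max_eq_right (by linarith)]; ring
      · push Not at h2
        rw [if_neg (by rintro ⟨_, h⟩; linarith), max_eq_left (by linarith)]; ring
  · push Not at h0
    rw [if_neg (by rintro ⟨h, _⟩; linarith), if_neg (by rintro ⟨h, _⟩; linarith),
      min_eq_left (by linarith), max_eq_left h0.le]; ring

lemma cardB_cont {d : ℕ} (hd : 0 < d) : Continuous (cardB d) := by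
  induction d with
  | zero => omega
  | succ d ih =>
    rcases Nat.eq_zero_or_pos d with rfl | h
    · have : cardB (0 + 1) = fun x => max 0 (min x (2 - x)) := funext cardB_one
      rw [this]; fun_prop
    · have := ih h
      have : Continuous fun x => (x / ((d : ℝ) + 1)) * cardB d x + (((d : ℝ) + 2 - x) / (d + 1)) * cardB d (x - 1) := by
        fun_prop
      exact this

lemma shift_within {f : ℝ → ℝ} {f' x : ℝ} (h : HasDerivWithinAt f f' (Set.Ici (x - 1)) (x - 1)) :
    HasDerivWithinAt (fun y => f (y - 1)) f' (Set.Ici x) x := by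
  have h2 : HasDerivWithinAt (fun y : ℝ => y - 1) 1 (Set.Ici x) x := by
    simpa using (hasDerivWithinAt_id x (Set.Ici x)).sub_const 1
  have := HasDerivWithinAt.comp x h h2 (by intro y hy; simp at *; linarith)
  rw [mul_one] at this
  exact this

lemma cardB_zero_deriv (x : ℝ) : HasDerivWithinAt (cardB 0) 0 (Set.Ici x) x := by
  have h : cardB 0 =ᶠ[nhdsWithin x (Set.Ici x)] fun _ => cardB 0 x := by
    by_cases h1 : x < 0
    · filter_upwards [nhdsWithin_le_nhds (Iio_mem_nhds h1)] with y hy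
      rw [cardB_supp 0 y (Or.inl hy), cardB_supp 0 x (Or.inl h1)]
    · push Not at h1
      by_cases h2 : x < 1
      · filter_upwards [nhdsWithin_le_nhds (Iio_mem_nhds h2), self_mem_nhdsWithin] with y hy hy'
        rw [cardB_zero_eq, cardB_zero_eq, if_pos (c := 0 ≤ x ∧ x < 1) ⟨h1, h2⟩, if_pos ⟨le_trans h1 hy', hy⟩]
      · push Not at h2
        filter_upwards [self_mem_nhdsWithin] with y hy'
        rw [cardB_supp 0 y (Or.inr (by push_cast; simpa using le_trans h2 hy')), cardB_supp 0 x (Or.inr (by push_cast; linarith))]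
  exact (hasDerivWithinAt_const x (Set.Ici x) (cardB 0 x)).congr_of_eventuallyEq h rfl

lemma cardB_deriv (d : ℕ) : ∀ x : ℝ,
    HasDerivWithinAt (cardB (d + 1)) (cardB d x - cardB d (x - 1)) (Set.Ici x) x := by
  have gen : ∀ (d : ℕ) (x a b : ℝ), HasDerivWithinAt (cardB d) a (Set.Ici x) x →
      HasDerivWithinAt (cardB d) b (Set.Ici (x - 1)) (x - 1) →
      HasDerivWithinAt (cardB (d + 1)) ((1 / ((d : ℝ) + 1) * cardB d x + x / (d + 1) * a) +
        (-1 / ((d : ℝ) + 1) * cardB d (x - 1) + (((d : ℝ) + 2 - x) / (d + 1)) * b)) (Set.Ici x) x := by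
    intro d x a b ha hb
    have h1 : HasDerivWithinAt (fun y : ℝ => y / ((d : ℝ) + 1)) (1 / ((d : ℝ) + 1)) (Set.Ici x) x :=
      (hasDerivWithinAt_id x _).div_const _
    have h2 : HasDerivWithinAt (fun y : ℝ => ((d : ℝ) + 2 - y) / ((d : ℝ) + 1)) (-1 / ((d : ℝ) + 1)) (Set.Ici x) x :=
      ((hasDerivWithinAt_id x _).const_sub _).div_const _
    exact (h1.mul ha).add (h2.mul (shift_within hb))
  induction d with
  | zero =>
    intro x
    refine (gen 0 x 0 0 (cardB_zero_deriv x) (cardB_zero_deriv _)).congr_deriv ?_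
    simp; ring
  | succ d ih =>
    intro x
    refine (gen (d + 1) x _ _ (ih x) (ih (x - 1))).congr_deriv ?_
    rw [cardB_succ d x, cardB_succ d (x - 1)]
    push_cast
    have : (d : ℝ) + 1 ≠ 0 := by positivity
    have : (d : ℝ) + 1 + 1 ≠ 0 := by positivity
    field_simp
    ring

/-- generic mean value estimate with right derivatives -/
lemma mv_right {f f' : ℝ → ℝ} {C : ℝ} (hf : Continuous f)
    (hd : ∀ x, HasDerivWithinAt f (f' x) (Set.Ici x) x) (hC : ∀ x, |f' x| ≤ C) (x y : ℝ) :
    |f y - f x| ≤ C * |y - x| := by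
  have key : ∀ a b, a ≤ b → |f b - f a| ≤ C * |b - a| := by
    intro a b hab
    have := norm_image_sub_le_of_norm_deriv_right_le_segment (f := f) (f' := f') (C := C) (a := a) (b := b)
      hf.continuousOn (fun x _ => hd x) (fun x _ => hC x) b (Set.right_mem_Icc.2 hab)
    rwa [Real.norm_eq_abs, ← abs_of_nonneg (sub_nonneg.2 hab)] at this
  rcases le_total x y with h | h
  · exact key x y h
  · rw [abs_sub_comm, abs_sub_comm y x]; exact key y x h

lemma fwd_iter_shift {G : Type*} [AddCommGroup G] (h : G) (i : ℕ) (f : G → ℝ) (c x : G) :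
    ((fwdDiff h)^[i] (fun y => f (y - c))) x = ((fwdDiff h)^[i] f) (x - c) := by
  rw [fwdDiff_iter_eq_sum_shift, fwdDiff_iter_eq_sum_shift]
  refine Finset.sum_congr rfl fun k _ => ?_
  congr 2; abel

lemma fwd_iter_sub {G : Type*} [AddCommGroup G] (h : G) (i : ℕ) (f g : G → ℝ) (x : G) :
    ((fwdDiff h)^[i] (fun y => f y - g y)) x = ((fwdDiff h)^[i] f) x - ((fwdDiff h)^[i] g) x := by
  simp only [fwdDiff_iter_eq_sum_shift, smul_sub, Finset.sum_sub_distrib]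

lemma fwd_cont (h : ℝ) (i : ℕ) (f : ℝ → ℝ) (hf : Continuous f) :
    Continuous ((fwdDiff h)^[i] f) := by
  have : (fwdDiff h)^[i] f = fun x => ∑ k ∈ Finset.range (i + 1), ((-1 : ℤ) ^ (i - k) * i.choose k) • f (x + k • h) :=
    funext fun x => fwdDiff_iter_eq_sum_shift h f i x
  rw [this]
  fun_prop

lemma fwd_deriv (h : ℝ) (i : ℕ) (f f' : ℝ → ℝ) (hf : ∀ x, HasDerivWithinAt f (f' x) (Set.Ici x) x) (x : ℝ) :
    HasDerivWithinAt ((fwdDiff h)^[i] f) (((fwdDiff h)^[i] f') x) (Set.Ici x) x := by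
  induction i generalizing f f' with
  | zero => exact hf x
  | succ i ih =>
    rw [Function.iterate_succ_apply, Function.iterate_succ_apply]
    refine ih _ _ fun y => ?_
    have h2 : HasDerivWithinAt (fun z : ℝ => z + h) 1 (Set.Ici y) y := by
      simpa using (hasDerivWithinAt_id y (Set.Ici y)).add_const h
    have := HasDerivWithinAt.comp y (hf (y + h)) h2 (by intro z hz; simp at *; linarith)
    rw [mul_one] at this
    exact HasDerivWithinAt.sub this (hf y)

lemma cardB_diff (d : ℕ) : ∀ i ≤ d, ∀ h x : ℝ,
    |((fwdDiff h)^[i] (cardB d)) x| ≤ 4 ^ d * (2 * |h|) ^ i := by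
  induction d with
  | zero =>
    intro i hi h x
    obtain rfl : i = 0 := by omega
    simpa using cardB_bound 0 x
  | succ d ih =>
    intro i hi h x
    rcases i with _ | i
    · simpa using cardB_bound (d + 1) x
    rw [Function.iterate_succ_apply', fwdDiff]
    have hb : ∀ y, |((fwdDiff h)^[i] (fun z => cardB d z - cardB d (z - 1))) y| ≤
        2 * (4 ^ d * (2 * |h|) ^ i) := by
      intro y
      rw [fwd_iter_sub, fwd_iter_shift h i (cardB d)]
      have h1 := ih i (by omega) h y
      have h2 := ih i (by omega) h (y - 1)
      have := abs_sub (((fwdDiff h)^[i] (cardB d)) y) (((fwdDiff h)^[i] (cardB d)) (y - 1))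
      linarith
    have := mv_right (fwd_cont h i (cardB (d + 1)) (cardB_cont (by omega)))
      (fwd_deriv h i _ _ (cardB_deriv d)) hb x (x + h)
    refine this.trans ?_
    have e : x + h - x = h := by ring
    rw [e, pow_succ (2 * |h|), pow_succ]
    have : 0 ≤ 4 ^ d * (2 * |h|) ^ i * |h| := by positivity
    nlinarith

/-! Two-scale relation -/

lemma choose_rec (N k : ℕ) : (N.choose (k + 1) : ℝ) * (k + 1) = N.choose k * ((N : ℝ) - k) := by
  by_cases h : k ≤ N
  · have := Nat.choose_succ_right_eq N k
    have h2 : ((N.choose (k + 1) * (k + 1) : ℕ) : ℝ) = ((N.choose k * (N - k) : ℕ) : ℝ) := by rw [this]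
    push_cast [Nat.cast_sub h] at h2
    exact h2
  · push Not at h
    rw [Nat.choose_eq_zero_of_lt h, Nat.choose_eq_zero_of_lt (by omega)]; simp

lemma two_scale (d : ℕ) : ∀ x : ℝ, (2 : ℝ) ^ d * cardB d x =
    ∑ j ∈ Finset.range (d + 2), ((d + 1).choose j : ℝ) * cardB d (2 * x - j) := by
  induction d with
  | zero =>
    intro x
    simp only [Finset.sum_range_succ, Finset.sum_range_zero, cardB_zero_eq]
    by_cases h0 : 0 ≤ x ∧ x < 1
    · rw [if_pos h0]
      by_cases h1 : x < 1 / 2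
      · rw [if_pos, if_neg]
        · simp
        · rintro ⟨h, _⟩; push_cast at h; linarith
        · push_cast; constructor <;> linarith
      · push Not at h1
        rw [if_neg, if_pos]
        · simp
        · push_cast; constructor <;> linarith
        · rintro ⟨_, h⟩; push_cast at h; linarith
    · rw [if_neg h0, if_neg, if_neg]
      · simp
      · rintro ⟨h, h'⟩; push_cast at h h'; exact h0 ⟨by linarith, by linarith⟩
      · rintro ⟨h, h'⟩; push_cast at h h'; exact h0 ⟨by linarith, by linarith⟩
  | succ d ih =>
    intro x
    have hd : (d : ℝ) + 1 ≠ 0 := by positivity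
    set f : ℕ → ℝ := fun j => cardB d (2 * x - j) with hf
    have e1 : (2 : ℝ) ^ d * cardB d x = ∑ j ∈ Finset.range (d + 4), ((d + 1).choose j : ℝ) * f j := by
      rw [ih x, Finset.sum_range_succ _ (d + 3), Finset.sum_range_succ _ (d + 2),
        Nat.choose_eq_zero_of_lt (by omega : d + 1 < d + 3), Nat.choose_eq_zero_of_lt (by omega : d + 1 < d + 2)]
      simp [hf]
    have e2 : (2 : ℝ) ^ d * cardB d (x - 1) = ∑ j ∈ Finset.range (d + 2), ((d + 1).choose j : ℝ) * f (j + 2) := by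
      rw [ih (x - 1)]
      refine Finset.sum_congr rfl fun j _ => ?_
      simp only [hf]; congr 2; push_cast; ring
    have e3 : ∑ j ∈ Finset.range (d + 3), ((d + 2).choose j : ℝ) * cardB (d + 1) (2 * x - j) =
        (∑ j ∈ Finset.range (d + 4), ((d + 2).choose j : ℝ) * ((2 * x - j) / (d + 1)) * f j) +
        ∑ j ∈ Finset.range (d + 3), ((d + 2).choose j : ℝ) * (((d : ℝ) + 2 - (2 * x - j)) / (d + 1)) * f (j + 1) := by
      rw [Finset.sum_range_succ _ (d + 3), Nat.choose_eq_zero_of_lt (by omega : d + 2 < d + 3)]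
      simp only [Nat.cast_zero, zero_mul, add_zero]
      rw [← Finset.sum_add_distrib]
      refine Finset.sum_congr rfl fun j _ => ?_
      rw [cardB_succ]
      simp only [hf]
      rw [show 2 * x - ((j + 1 : ℕ) : ℝ) = 2 * x - j - 1 by push_cast; ring]
      ring
    show (2 : ℝ) ^ (d + 1) * cardB (d + 1) x = ∑ j ∈ Finset.range (d + 3), ((d + 2).choose j : ℝ) * cardB (d + 1) (2 * x - j)
    rw [e3, cardB_succ]
    have e4 : (2 : ℝ) ^ (d + 1) * (x / (d + 1) * cardB d x + ((d : ℝ) + 2 - x) / (d + 1) * cardB d (x - 1)) =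
      2 * x / (d + 1) * ((2 : ℝ) ^ d * cardB d x) + 2 * ((d : ℝ) + 2 - x) / (d + 1) * ((2 : ℝ) ^ d * cardB d (x - 1)) := by
      rw [pow_succ]; ring
    rw [e4, e1, e2]
    rw [Finset.sum_range_succ' _ (d + 3), Finset.sum_range_succ' _ (d + 2),
      Finset.sum_range_succ' (fun j => ((d + 2).choose j : ℝ) * ((2 * x - j) / (d + 1)) * f j) (d + 3),
      Finset.sum_range_succ' _ (d + 2),
      Finset.sum_range_succ' (fun j => ((d + 2).choose j : ℝ) * (((d : ℝ) + 2 - (2 * x - j)) / (d + 1)) * f (j + 1)) (d + 2)]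
    have key : ∀ j ∈ Finset.range (d + 2),
      2 * x / (d + 1) * (((d + 1).choose (j + 1 + 1) : ℝ) * f (j + 1 + 1)) +
        2 * ((d : ℝ) + 2 - x) / (d + 1) * (((d + 1).choose j : ℝ) * f (j + 2)) =
      ((d + 2).choose (j + 1 + 1) : ℝ) * ((2 * x - ((j + 1 + 1 : ℕ) : ℝ)) / (d + 1)) * f (j + 1 + 1) +
        ((d + 2).choose (j + 1) : ℝ) * (((d : ℝ) + 2 - (2 * x - ((j + 1 : ℕ) : ℝ))) / (d + 1)) * f (j + 1 + 1) := by
      intro j _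
      have c1 : ((d + 2).choose (j + 1 + 1) : ℝ) = (d + 1).choose (j + 1) + (d + 1).choose (j + 2) := by
        rw [Nat.choose_succ_succ]; push_cast; rfl
      have c2 : ((d + 2).choose (j + 1) : ℝ) = (d + 1).choose j + (d + 1).choose (j + 1) := by
        rw [Nat.choose_succ_succ]; push_cast; rfl
      have c3 := choose_rec (d + 1) j
      have c4 := choose_rec (d + 1) (j + 1)
      rw [c1, c2]
      push_cast at c3 c4 ⊢
      field_simp
      simp only [Nat.add_assoc, Nat.reduceAdd] at *
      generalize ((d + 1).choose j : ℝ) = a at *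
      generalize ((d + 1).choose (j + 1) : ℝ) = b at *
      generalize ((d + 1).choose (j + 2) : ℝ) = c at *
      linear_combination (f (j + 2)) * (c4 - c3)
    have := Finset.sum_congr (rfl : Finset.range (d + 2) = _) key
    rw [Finset.sum_add_distrib, Finset.sum_add_distrib, ← Finset.mul_sum, ← Finset.mul_sum] at this
    simp only [Nat.choose_zero_right, Nat.choose_one_right, zero_add] at *
    push_cast at *
    have e5 : ∀ a b c d e a' c' : ℝ, a + b = c + d → a' = c' → a + a' + b = c + c' + d := by
      intros; linarith
    simp only [mul_add]
    field_simp at this ⊢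
    linear_combination this

end Spline1

section Marsden

lemma cardB_ne_zero {d : ℕ} {x : ℝ} {m : ℤ} (h : cardB d (x - m) ≠ 0) :
    m ∈ Finset.Icc (⌊x⌋ - d) ⌊x⌋ := by
  have h1 : ¬ (x - m < 0 ∨ (d : ℝ) + 1 ≤ x - m) := fun h' => h (cardB_supp d _ h')
  push Not at h1
  obtain ⟨h1, h2⟩ := h1
  rw [Finset.mem_Icc]
  refine ⟨?_, Int.le_floor.2 (by linarith)⟩
  have := Int.floor_le x
  have h3 : ((⌊x⌋ - d - 1 : ℤ) : ℝ) < m := by push_cast; linarith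
  have := Int.cast_lt.1 h3
  omega

lemma tsum_cardB (d : ℕ) (x : ℝ) (b : ℤ → ℝ) :
    ∑' m, b m * cardB d (x - m) = ∑ m ∈ Finset.Icc (⌊x⌋ - d) ⌊x⌋, b m * cardB d (x - m) := by
  refine tsum_eq_sum fun m hm => ?_
  by_contra h
  exact hm (cardB_ne_zero (right_ne_zero_of_mul h))

lemma summable_cardB (d : ℕ) (x : ℝ) (b : ℤ → ℝ) : Summable fun m : ℤ => b m * cardB d (x - m) := by
  refine summable_of_ne_finset_zero (s := Finset.Icc (⌊x⌋ - d) ⌊x⌋) fun m hm => ?_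
  by_contra h
  exact hm (cardB_ne_zero (right_ne_zero_of_mul h))

def psi (d : ℕ) (m : ℤ) : Polynomial ℝ :=
  ∏ j ∈ Finset.range d, (Polynomial.X - Polynomial.C ((m : ℝ) + j + 1))

lemma psi_eval (d : ℕ) (m : ℤ) (y : ℝ) : (psi d m).eval y = ∏ j ∈ Finset.range d, (y - m - j - 1) := by
  rw [psi, Polynomial.eval_prod]
  refine Finset.prod_congr rfl fun j _ => ?_
  simp; ring

lemma psi_succ (d : ℕ) (m : ℤ) (y : ℝ) : (psi (d + 1) m).eval y = (psi d m).eval y * (y - m - d - 1) := by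
  rw [psi_eval, psi_eval, Finset.prod_range_succ]

lemma psi_succ' (d : ℕ) (m : ℤ) (y : ℝ) : (psi (d + 1) (m - 1)).eval y = (psi d m).eval y * (y - m) := by
  rw [psi_eval, psi_eval, Finset.prod_range_succ']
  push_cast
  congr 1
  · refine Finset.prod_congr rfl fun j _ => ?_
    ring
  · ring

lemma marsden (d : ℕ) (x y : ℝ) : ∑' m : ℤ, (psi d m).eval y * cardB d (x - m) = (y - x) ^ d := by
  induction d with
  | zero =>
    rw [tsum_cardB]
    simp only [Nat.cast_zero, sub_zero, Finset.Icc_self, Finset.sum_singleton, pow_zero]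
    rw [cardB_zero_eq, if_pos ⟨by have := Int.floor_le x; linarith, by have := Int.lt_floor_add_one x; linarith⟩]
    simp [psi]
  | succ d ih =>
    have hd : (d : ℝ) + 1 ≠ 0 := by positivity
    have e : ∀ m : ℤ, (psi (d + 1) m).eval y * cardB (d + 1) (x - m) =
      ((psi (d + 1) m).eval y * ((x - m) / (d + 1))) * cardB d (x - m) +
        ((psi (d + 1) m).eval y * (((d : ℝ) + 2 - (x - m)) / (d + 1))) * cardB d (x - ((m + 1 : ℤ) : ℝ)) := by
      intro m
      rw [cardB_succ, show x - ((m + 1 : ℤ) : ℝ) = x - m - 1 by push_cast; ring]; ring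
    simp_rw [e]
    set F : ℤ → ℝ := fun m => ((psi (d + 1) (m - 1)).eval y * (((d : ℝ) + 2 - (x - ((m - 1 : ℤ) : ℝ))) / (d + 1))) * cardB d (x - m) with hF
    have e2 : ∀ m : ℤ, ((psi (d + 1) m).eval y * (((d : ℝ) + 2 - (x - m)) / (d + 1))) * cardB d (x - ((m + 1 : ℤ) : ℝ)) =
        F (Equiv.addRight 1 m) := by
      intro m; simp [hF]
    simp_rw [e2]
    have s1 := summable_cardB d x (fun m => (psi (d + 1) m).eval y * ((x - m) / (d + 1)))
    have s2 : Summable F := summable_cardB d x (fun m => (psi (d + 1) (m - 1)).eval y * (((d : ℝ) + 2 - (x - ((m - 1 : ℤ) : ℝ))) / (d + 1)))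
    have s3 : Summable (fun m => F (Equiv.addRight (1 : ℤ) m)) := (Equiv.addRight (1 : ℤ)).summable_iff.2 s2
    rw [s1.tsum_add s3, (Equiv.addRight (1 : ℤ)).tsum_eq F,
      ← s1.tsum_add s2]
    have e3 : ∀ m : ℤ, (psi (d + 1) m).eval y * ((x - m) / (d + 1)) * cardB d (x - m) + F m =
        (y - x) * ((psi d m).eval y * cardB d (x - m)) := by
      intro m
      simp only [hF]
      rw [psi_succ, psi_succ']
      push_cast
      field_simp
      ring
    simp_rw [e3]
    rw [tsum_mul_left, ih]; ring

lemma mono_repr {d k : ℕ} (hk : k ≤ d) : ∃ b : ℤ → ℝ, ∀ x, ∑' m, b m * cardB d (x - m) = x ^ k := by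
  have key : ∀ x : ℝ, ∀ i, ∑' m : ℤ, (psi d m).coeff i * cardB d (x - m) = (-x) ^ (d - i) * d.choose i := by
    intro x i
    have h : ∑ m ∈ Finset.Icc (⌊x⌋ - (d : ℤ)) ⌊x⌋, psi d m * Polynomial.C (cardB d (x - m)) =
        (Polynomial.X + Polynomial.C (-x)) ^ d := by
      apply Polynomial.funext
      intro y
      rw [Polynomial.eval_finsetSum]
      simp only [Polynomial.eval_mul, Polynomial.eval_C, Polynomial.eval_pow, Polynomial.eval_add, Polynomial.eval_X, ← sub_eq_add_neg]
      rw [← marsden d x y, tsum_cardB d x (fun m => (psi d m).eval y)]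
    have h2 := congrArg (fun P => Polynomial.coeff P i) h
    simp only [Polynomial.finsetSum_coeff, Polynomial.coeff_mul_C, Polynomial.coeff_X_add_C_pow] at h2
    rw [tsum_cardB d x (fun m => (psi d m).coeff i), h2]
  have hc : (d.choose (d - k) : ℝ) ≠ 0 := by
    have := Nat.choose_pos (Nat.sub_le d k); positivity
  refine ⟨fun m => (psi d m).coeff (d - k) * ((-1) ^ k / d.choose (d - k)), fun x => ?_⟩
  have := key x (d - k)
  rw [show d - (d - k) = k by omega] at this
  simp_rw [show ∀ m : ℤ, (psi d m).coeff (d - k) * ((-1) ^ k / d.choose (d - k)) * cardB d (x - m) =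
    ((-1) ^ k / d.choose (d - k)) * ((psi d m).coeff (d - k) * cardB d (x - m)) by intro m; ring]
  rw [tsum_mul_left, this, neg_pow x k]
  field_simp
  rw [← pow_mul, mul_comm k 2, pow_mul]; simp

lemma poly_repr {d : ℕ} (P : Polynomial ℝ) (hP : P.natDegree ≤ d) :
    ∃ b : ℤ → ℝ, ∀ x, ∑' m, b m * cardB d (x - m) = P.eval x := by
  choose! b hb using fun k (hk : k ≤ d) => mono_repr hk
  refine ⟨fun m => ∑ k ∈ Finset.range (d + 1), P.coeff k * b k m, fun x => ?_⟩
  rw [Polynomial.eval_eq_sum_range' (Nat.lt_succ_of_le hP)]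
  simp_rw [Finset.sum_mul, mul_assoc]
  rw [Summable.tsum_finsetSum (fun k _ => (summable_cardB d x (b k)).mul_left _)]
  refine Finset.sum_congr rfl fun k hk => ?_
  rw [tsum_mul_left, hb k (by simpa [Nat.lt_succ_iff] using hk)]

lemma tsum_unit (d : ℕ) {x : ℝ} (hx : x ∈ Set.Ico (0 : ℝ) 1) (b : ℤ → ℝ) :
    ∑' m, b m * cardB d (x - m) = ∑ i : Fin (d + 1), b (-(i : ℤ)) * cardB d (x + (i : ℕ)) := by
  have hf : ⌊x⌋ = 0 := Int.floor_eq_zero_iff.2 hx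
  let e : Fin (d + 1) ↪ ℤ := ⟨fun i => -(i : ℤ), fun a b h => by
    have : (a : ℤ) = b := by simpa using h
    exact Fin.ext (by exact_mod_cast this)⟩
  rw [tsum_eq_sum (s := Finset.univ.map e), Finset.sum_map]
  · refine Finset.sum_congr rfl fun i _ => ?_
    show b (-(i : ℤ)) * cardB d (x - ((-(i : ℤ) : ℤ) : ℝ)) = _
    congr 2; push_cast; ring
  · intro m hm
    by_contra h
    have := cardB_ne_zero (right_ne_zero_of_mul h)
    rw [hf, Finset.mem_Icc] at this
    apply hm
    rw [Finset.mem_map]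
    refine ⟨⟨(-m).toNat, by omega⟩, Finset.mem_univ _, ?_⟩
    show -(((-m).toNat : ℕ) : ℤ) = m
    omega

/-- dual functionals on the unit interval built from point evaluations -/
lemma dual_repr (d : ℕ) : ∃ (pt : Fin (d + 1) → ℝ) (lam : Fin (d + 1) → Fin (d + 1) → ℝ),
    (∀ b, pt b ∈ Set.Ico (0 : ℝ) 1) ∧ ∀ a i : Fin (d + 1),
      ∑ b, lam a b * cardB d (pt b + (i : ℕ)) = if a = i then 1 else 0 := by
  let pt : Fin (d + 1) → ℝ := fun b => (b : ℕ) / ((d : ℝ) + 1)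
  have hd : (0 : ℝ) < (d : ℝ) + 1 := by positivity
  have hpt : ∀ b, pt b ∈ Set.Ico (0 : ℝ) 1 := by
    intro b
    refine ⟨by positivity, ?_⟩
    show ((b : ℕ) : ℝ) / ((d : ℝ) + 1) < 1
    rw [div_lt_one hd]
    exact_mod_cast b.2
  let E : Matrix (Fin (d + 1)) (Fin (d + 1)) ℝ := Matrix.of fun b i => cardB d (pt b + (i : ℕ))
  choose! B hB using fun k (hk : k ≤ d) => mono_repr hk
  let M : Matrix (Fin (d + 1)) (Fin (d + 1)) ℝ := Matrix.of fun i k => B k (-(i : ℤ))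
  have hV : Matrix.vandermonde pt = E * M := by
    ext b k
    rw [Matrix.vandermonde_apply, Matrix.mul_apply, ← hB k (by omega) (pt b), tsum_unit d (hpt b)]
    refine Finset.sum_congr rfl fun i _ => ?_
    simp [E, M, mul_comm]
  have hdet : E.det ≠ 0 := by
    intro h0
    have h1 : (Matrix.vandermonde pt).det ≠ 0 := by
      rw [Matrix.det_vandermonde_ne_zero_iff]
      intro a b hab
      have : ((a : ℕ) : ℝ) = (b : ℕ) := by
        have h2 : ((a : ℕ) : ℝ) / ((d : ℝ) + 1) = (b : ℕ) / ((d : ℝ) + 1) := hab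
        field_simp at h2; exact h2
      exact Fin.ext (by exact_mod_cast this)
    rw [hV, Matrix.det_mul, h0, zero_mul] at h1
    exact h1 rfl
  refine ⟨pt, fun a b => E⁻¹ a b, hpt, fun a i => ?_⟩
  have := Matrix.nonsing_inv_mul E (isUnit_iff_ne_zero.2 hdet)
  have h2 := congrFun (congrFun this a) i
  rw [Matrix.mul_apply, Matrix.one_apply] at h2
  exact h2

end Marsden

section Tensor
variable {n : ℕ}

lemma diffl_eq (l : ℕ) (h : Rn n) (g : Rn n → ℝ) (x : Rn n) :
    diffl l h g x = ((fwdDiff h)^[l] g) x := by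
  rw [fwdDiff_iter_eq_sum_shift, diffl]
  refine Finset.sum_congr rfl fun j hj => ?_
  have hj' : j ≤ l := by simpa [Nat.lt_succ_iff] using hj
  rw [zsmul_eq_mul]
  push_cast
  rw [show l + j = (l - j) + 2 * j by omega, pow_add, pow_mul]
  simp only [even_two, Even.neg_pow, one_pow, mul_one]
  rw [mul_comm ((l.choose j : ℝ))]
  congr 2
  rw [Nat.cast_smul_eq_nsmul]

/-- product rule for the difference classes -/
lemma fwd_prod_bound {G : Type*} [AddCommGroup G] (h : G) (i : ℕ) : ∀ (f g : G → ℝ) (c₁ c₂ e₁ e₂ : ℝ),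
    (∀ j ≤ i, ∀ x, |((fwdDiff h)^[j] f) x| ≤ c₁ * e₁ ^ j) →
    (∀ j ≤ i, ∀ x, |((fwdDiff h)^[j] g) x| ≤ c₂ * e₂ ^ j) →
    ∀ x, |((fwdDiff h)^[i] (fun y => f y * g y)) x| ≤ c₁ * c₂ * (e₁ + e₂) ^ i := by
  induction i with
  | zero =>
    intro f g c₁ c₂ e₁ e₂ hf hg x
    have h1 := hf 0 le_rfl x
    have h2 := hg 0 le_rfl x
    simp only [Function.iterate_zero, id, pow_zero, mul_one] at *
    rw [abs_mul]
    exact mul_le_mul h1 h2 (abs_nonneg _) ((abs_nonneg _).trans h1)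
  | succ i ih =>
    intro f g c₁ c₂ e₁ e₂ hf hg x
    have key : fwdDiff h (fun y => f y * g y) =
        fun y => (fun z => fwdDiff h f z * g (z - (-h))) y - (fun z => f z * (- fwdDiff h g z)) y := by
      funext y
      simp only [fwdDiff, sub_neg_eq_add]; ring
    rw [Function.iterate_succ_apply, key, fwd_iter_sub]
    have h1 := ih (fwdDiff h f) (fun z => g (z - (-h))) (c₁ * e₁) c₂ e₁ e₂ (by
      intro j hj y
      have := hf (j + 1) (by omega) y
      rw [Function.iterate_succ_apply] at this
      rw [mul_assoc, ← pow_succ']; exact this) (by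
      intro j hj y
      rw [fwd_iter_shift]; exact hg j (by omega) _) x
    have h2 := ih f (fun z => - fwdDiff h g z) c₁ (c₂ * e₂) e₁ e₂ (fun j hj => hf j (by omega)) (by
      intro j hj y
      have := hg (j + 1) (by omega) y
      rw [Function.iterate_succ_apply] at this
      have e : ((fwdDiff h)^[j] (fun z => - fwdDiff h g z)) y = - ((fwdDiff h)^[j] (fwdDiff h g)) y := by
        simp only [fwdDiff_iter_eq_sum_shift, smul_neg, Finset.sum_neg_distrib]
      rw [e, abs_neg, mul_assoc, ← pow_succ']; exact this) x
    refine (abs_sub _ _).trans ((add_le_add h1 h2).trans (le_of_eq ?_))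
    ring

lemma fwd_finprod_bound {G ι : Type*} [AddCommGroup G] (h : G) (i : ℕ) (s : Finset ι) (f : ι → G → ℝ)
    (c e : ι → ℝ) (hf : ∀ a ∈ s, ∀ j ≤ i, ∀ x, |((fwdDiff h)^[j] (f a)) x| ≤ c a * e a ^ j) :
    ∀ j ≤ i, ∀ x, |((fwdDiff h)^[j] (fun y => ∏ a ∈ s, f a y)) x| ≤ (∏ a ∈ s, c a) * (∑ a ∈ s, e a) ^ j := by
  induction s using Finset.induction_on with
  | empty =>
    intro j hj x
    simp only [Finset.prod_empty, Finset.sum_empty, one_mul]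
    rcases j with _ | j
    · simp
    · rw [Function.iterate_succ_apply]
      have : fwdDiff h (fun _ : G => (1 : ℝ)) = fun _ => 0 := by funext y; simp [fwdDiff]
      rw [this, fwdDiff_iter_eq_sum_shift]; simp
  | insert a s ha ih =>
    intro j hj x
    simp only [Finset.prod_insert ha, Finset.sum_insert ha]
    refine fwd_prod_bound h j (f a) (fun y => ∏ b ∈ s, f b y) _ _ _ _ ?_ ?_ x
    · intro j' hj'; exact hf a (Finset.mem_insert_self _ _) j' (hj'.trans hj)
    · intro j' hj'
      exact ih (fun b hb => hf b (Finset.mem_insert_of_mem hb)) j' (hj'.trans hj)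

lemma Bspl_diff (l k : ℕ) (m : Zn n) (h x : Rn n) :
    |diffl l h (Bspl n l k m) x| ≤ (4 ^ l) ^ n * (2 * n * (2 ^ k * ‖h‖)) ^ l := by
  rw [diffl_eq]
  have := fwd_finprod_bound h l Finset.univ (fun (i : Fin n) (y : Rn n) => cardB l (2 ^ k * y i - (m i : ℝ)))
    (fun _ => 4 ^ l) (fun i => 2 * |2 ^ k * h i|) (by
      intro i _ j hj y
      have := cardB_diff l j hj (2 ^ k * h i) (2 ^ k * y i - (m i : ℝ))
      have e : ((fwdDiff h)^[j] (fun y : Rn n => cardB l (2 ^ k * y i - (m i : ℝ)))) y =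
          ((fwdDiff (2 ^ k * h i))^[j] (cardB l)) (2 ^ k * y i - (m i : ℝ)) := by
        rw [fwdDiff_iter_eq_sum_shift, fwdDiff_iter_eq_sum_shift]
        refine Finset.sum_congr rfl fun q _ => ?_
        congr 2
        simp; ring
      rw [e]; exact this) l le_rfl x
  refine this.trans ?_
  simp only [Finset.prod_const, Finset.card_univ, Fintype.card_fin]
  refine mul_le_mul_of_nonneg_left ?_ (by positivity)
  refine pow_le_pow_left₀ (Finset.sum_nonneg fun i _ => by positivity) ?_ l
  calc ∑ i, 2 * |2 ^ k * h i| ≤ ∑ _i : Fin n, 2 * (2 ^ k * ‖h‖) := by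
        refine Finset.sum_le_sum fun i _ => ?_
        rw [abs_mul, abs_of_pos (by positivity : (0 : ℝ) < 2 ^ k)]
        have := norm_le_pi_norm h i
        rw [Real.norm_eq_abs] at this
        gcongr
    _ = _ := by simp; ring

def nbox (n l : ℕ) : Finset (Zn n) := Fintype.piFinset fun _ => Finset.Icc (-(l : ℤ)) 0
def box (n R : ℕ) : Finset (Zn n) := Fintype.piFinset fun _ => Finset.Icc (-(R : ℤ)) R

lemma mem_nbox {l : ℕ} {o : Zn n} : o ∈ nbox n l ↔ ∀ i, -(l : ℤ) ≤ o i ∧ o i ≤ 0 := by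
  simp [nbox, Fintype.mem_piFinset]
lemma mem_box {l : ℕ} {o : Zn n} : o ∈ box n l ↔ ∀ i, |o i| ≤ l := by
  simp [box, Fintype.mem_piFinset, abs_le]
lemma nbox_sub (l : ℕ) : nbox n l ⊆ box n l := by
  intro o; rw [mem_nbox, mem_box]
  intro h i; rw [abs_le]; have := h i; omega

lemma Bspl_ne_zero {l k : ℕ} {m : Zn n} {x : Rn n} (h : Bspl n l k m x ≠ 0) :
    m - fl k x ∈ nbox n l := by
  rw [mem_nbox]
  intro i
  have := cardB_ne_zero (Finset.prod_ne_zero_iff.1 h i (Finset.mem_univ _))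
  rw [Finset.mem_Icc] at this
  simp only [Pi.sub_apply, fl]
  omega

lemma Bspl_bound (l k : ℕ) (m : Zn n) (x : Rn n) : |Bspl n l k m x| ≤ (4 ^ l) ^ n := by
  rw [Bspl, Finset.abs_prod]
  calc _ ≤ ∏ _i : Fin n, (4 : ℝ) ^ l := Finset.prod_le_prod (fun _ _ => abs_nonneg _) (fun i _ => cardB_bound l _)
    _ = _ := by simp

/-- the spline sum over any finite set which contains the active indices -/
lemma splineSum_finset {l k : ℕ} {b : Zn n → ℝ} {x : Rn n} {s : Finset (Zn n)}
    (hs : ∀ m, m - fl k x ∈ nbox n l → m ∈ s) : splineSum n l k b x = ∑ m ∈ s, b m * Bspl n l k m x := by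
  refine tsum_eq_sum fun m hm => ?_
  by_contra h
  exact hm (hs m (Bspl_ne_zero (right_ne_zero_of_mul h)))

lemma splineSum_summable (l k : ℕ) (b : Zn n → ℝ) (x : Rn n) :
    Summable fun m => b m * Bspl n l k m x := by
  refine summable_of_ne_finset_zero (s := (nbox n l).image (fun o => fl k x + o)) fun m hm => ?_
  by_contra h
  refine hm (Finset.mem_image.2 ⟨m - fl k x, Bspl_ne_zero (right_ne_zero_of_mul h), by abel⟩)

lemma splineSum_eq (l k : ℕ) (b : Zn n → ℝ) (x : Rn n) :
    splineSum n l k b x = ∑ o ∈ nbox n l, b (fl k x + o) * Bspl n l k (fl k x + o) x := by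
  rw [splineSum_finset (s := (nbox n l).image (fun o => fl k x + o)), Finset.sum_image]
  · intro a _ b _ h; exact add_left_cancel h
  · intro m hm; exact Finset.mem_image.2 ⟨_, hm, by abel⟩

lemma splineSum_abs (l k : ℕ) (b : Zn n → ℝ) (x : Rn n) :
    |splineSum n l k b x| ≤ (4 ^ l) ^ n * ∑ o ∈ nbox n l, |b (fl k x + o)| := by
  rw [splineSum_eq, Finset.mul_sum]
  refine (Finset.abs_sum_le_sum_abs _ _).trans (Finset.sum_le_sum fun o _ => ?_)
  rw [abs_mul, mul_comm]
  exact mul_le_mul_of_nonneg_right (Bspl_bound _ _ _ _) (abs_nonneg _)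

lemma splineSum_measurable (l k : ℕ) (b : Zn n → ℝ) : Measurable (splineSum n l k b) := by
  have : splineSum n l k b = fun x => ∑ o ∈ nbox n l, b (fl k x + o) * Bspl n l k (fl k x + o) x :=
    funext fun x => splineSum_eq l k b x
  rw [this]
  refine Finset.measurable_sum _ fun o _ => Measurable.mul ?_ ?_
  · exact (measurable_of_countable (fun m : Zn n => b (m + o))).comp (measurable_fl k)
  · unfold Bspl
    refine Finset.measurable_prod _ fun i _ => (cardB_measurable l).comp ?_
    have h1 : Measurable fun x : Rn n => (((fl k x + o) i : ℤ) : ℝ) :=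
      (measurable_of_countable (fun m : Zn n => (((m + o) i : ℤ) : ℝ))).comp (measurable_fl k)
    exact Measurable.sub (by fun_prop) h1

lemma splineSum_scale (l k : ℕ) (b : Zn n → ℝ) (x : Rn n) :
    splineSum n l k b x = splineSum n l 0 b ((2 : ℝ) ^ k • x) := by
  unfold splineSum Bspl; simp

lemma splineSum_shift (l : ℕ) (b : Zn n → ℝ) (z : Zn n) (x : Rn n) :
    splineSum n l 0 b (x + fun i => (z i : ℝ)) = splineSum n l 0 (fun m => b (m + z)) x := by
  unfold splineSum
  rw [← (Equiv.addRight z).tsum_eq]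
  refine tsum_congr fun m => ?_
  simp only [Equiv.coe_addRight, Bspl, pow_zero, one_mul]
  congr 1
  refine Finset.prod_congr rfl fun i _ => ?_
  congr 1; simp

lemma splineSum_sub (l k : ℕ) (a b : Zn n → ℝ) (x : Rn n) :
    splineSum n l k (fun m => a m - b m) x = splineSum n l k a x - splineSum n l k b x := by
  simp only [splineSum_eq, sub_mul, Finset.sum_sub_distrib]

lemma splineSum_zero (l k : ℕ) (x : Rn n) : splineSum n l k (fun _ => 0) x = 0 := by
  simp [splineSum_eq]

lemma splineSum_refine (l k : ℕ) (b : Zn n → ℝ) :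
    ∃ b' : Zn n → ℝ, splineSum n l k b = splineSum n l (k + 1) b' := by
  let a : ℕ → ℝ := fun j => ((l + 1).choose j : ℝ) / 2 ^ l
  let V : Finset (Fin n → ℕ) := Fintype.piFinset fun _ => Finset.range (l + 2)
  let sh : (Fin n → ℕ) → Zn n → Zn n := fun ν m i => 2 * m i + ν i
  have hinj : ∀ ν, Function.Injective (sh ν) := by
    intro ν x y h
    funext i
    have := congrFun h i
    simp only [sh] at this; omega
  have hB : ∀ m x, Bspl n l k m x = ∑ ν ∈ V, (∏ i, a (ν i)) * Bspl n l (k + 1) (sh ν m) x := by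
    intro m x
    have h1 : ∀ i : Fin n, cardB l (2 ^ k * x i - (m i : ℝ)) =
        ∑ j ∈ Finset.range (l + 2), a j * cardB l (2 ^ (k + 1) * x i - (2 * m i + j)) := by
      intro i
      have := two_scale l (2 ^ k * x i - (m i : ℝ))
      have h2 : (2 : ℝ) ^ l ≠ 0 := by positivity
      rw [mul_comm, ← eq_div_iff h2] at this
      rw [this, Finset.sum_div]
      refine Finset.sum_congr rfl fun j _ => ?_
      rw [show 2 * (2 ^ k * x i - (m i : ℝ)) - j = 2 ^ (k + 1) * x i - (2 * m i + j) by ring]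
      simp only [a]; ring
    unfold Bspl
    simp_rw [h1]
    rw [Finset.prod_univ_sum]
    refine Finset.sum_congr rfl fun ν _ => ?_
    rw [Finset.prod_mul_distrib]
    congr 1
    refine Finset.prod_congr rfl fun i _ => ?_
    simp [sh]
  refine ⟨fun m' => ∑ ν ∈ V, (∏ i, a (ν i)) * Function.extend (sh ν) b 0 m', funext fun x => ?_⟩
  have hext : ∀ ν, HasSum (fun m' => Function.extend (sh ν) b 0 m' * Bspl n l (k + 1) m' x)
      (∑' m, b m * Bspl n l (k + 1) (sh ν m) x) := by
    intro ν
    have hs := splineSum_summable l (k + 1) (Function.extend (sh ν) b 0) x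
    have : (∑' m, b m * Bspl n l (k + 1) (sh ν m) x) =
        ∑' m', Function.extend (sh ν) b 0 m' * Bspl n l (k + 1) m' x := by
      rw [← (hinj ν).tsum_eq (f := fun m' => Function.extend (sh ν) b 0 m' * Bspl n l (k + 1) m' x)]
      · refine tsum_congr fun m => ?_
        rw [(hinj ν).extend_apply]
      · intro m' hm'
        by_contra h
        apply hm'
        have : Function.extend (sh ν) b 0 m' = 0 := by
          rw [Function.extend_apply' _ _ _ (by simpa using h)]; rfl
        simp only [this, zero_mul]
    rw [this]; exact hs.hasSum
  have hsum2 : ∀ ν, Summable fun m => b m * Bspl n l (k + 1) (sh ν m) x := by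
    intro ν
    have := (splineSum_summable l (k + 1) (Function.extend (sh ν) b 0) x).comp_injective (hinj ν)
    refine this.congr fun m => ?_
    simp only [Function.comp, (hinj ν).extend_apply]
  have hR : HasSum (fun m' => (∑ ν ∈ V, (∏ i, a (ν i)) * Function.extend (sh ν) b 0 m') * Bspl n l (k + 1) m' x)
      (∑ ν ∈ V, (∏ i, a (ν i)) * (∑' m, b m * Bspl n l (k + 1) (sh ν m) x)) := by
    have := hasSum_sum (s := V) (fun ν _ => (hext ν).mul_left (∏ i, a (ν i)))
    refine this.congr_fun ?_ |> fun h => h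
    intro m'
    simp only [Finset.sum_mul, mul_assoc]
  rw [splineSum, splineSum, hR.tsum_eq]
  simp_rw [hB, Finset.mul_sum]
  rw [Summable.tsum_finsetSum]
  · refine Finset.sum_congr rfl fun ν _ => ?_
    rw [← tsum_mul_left]
    refine tsum_congr fun m => ?_
    ring
  · intro ν _
    refine ((hsum2 ν).mul_left (∏ i, a (ν i))).congr fun m => ?_
    ring

lemma splineSum_refines (l : ℕ) {k K : ℕ} (hk : k ≤ K) (b : Zn n → ℝ) :
    ∃ b' : Zn n → ℝ, splineSum n l k b = splineSum n l K b' := by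
  induction K, hk using Nat.le_induction with
  | base => exact ⟨b, rfl⟩
  | succ K _ ih =>
    obtain ⟨b', hb'⟩ := ih
    obtain ⟨b'', hb''⟩ := splineSum_refine l K b'
    exact ⟨b'', hb'.trans hb''⟩

/-- difference of a spline -/
lemma splineSum_diff (l k : ℕ) (b : Zn n → ℝ) (h x : Rn n) (s : Finset (Zn n))
    (hs : ∀ j ∈ Finset.range (l + 1), ∀ m, m - fl k (x + (j : ℝ) • h) ∈ nbox n l → m ∈ s) :
    |diffl l h (splineSum n l k b) x| ≤ (4 ^ l) ^ n * (2 * n * (2 ^ k * ‖h‖)) ^ l * ∑ m ∈ s, |b m| := by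
  have : diffl l h (splineSum n l k b) x = ∑ m ∈ s, b m * diffl l h (Bspl n l k m) x := by
    unfold diffl
    rw [Finset.sum_congr rfl fun j hj => by rw [splineSum_finset (hs j hj)]]
    simp_rw [Finset.mul_sum]
    rw [Finset.sum_comm]
    refine Finset.sum_congr rfl fun m _ => Finset.sum_congr rfl fun j _ => ?_
    ring
  rw [this, Finset.mul_sum]
  refine (Finset.abs_sum_le_sum_abs _ _).trans (Finset.sum_le_sum fun m _ => ?_)
  rw [abs_mul, mul_comm]
  exact mul_le_mul_of_nonneg_right (Bspl_diff _ _ _ _ _) (abs_nonneg _)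

end Tensor

section Aff
variable {n : ℕ}

lemma aff_measurable (a : Rn n) (s : ℝ) : Measurable (fun x : Rn n => a + s • x) := by fun_prop

lemma aff_emb (a : Rn n) {s : ℝ} (hs : s ≠ 0) : MeasurableEmbedding (fun x : Rn n => a + s • x) :=
  ((Homeomorph.smulOfNeZero s hs).trans (Homeomorph.addLeft a)).measurableEmbedding

lemma map_aff_vol (a : Rn n) {s : ℝ} (hs : s ≠ 0) :
    Measure.map (fun x : Rn n => a + s • x) volume = ENNReal.ofReal ((|s| ^ n)⁻¹) • (volume : Measure (Rn n)) := by
  have h1 : Measure.map (fun x : Rn n => s • x) volume = ENNReal.ofReal ((|s| ^ n)⁻¹) • (volume : Measure (Rn n)) := by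
    rw [Measure.map_addHaar_smul volume hs]
    simp [abs_inv, abs_pow]
  have h2 : (fun x : Rn n => a + s • x) = (fun x => a + x) ∘ (fun x => s • x) := rfl
  rw [h2, ← Measure.map_map (by fun_prop) (by fun_prop), h1, Measure.map_smul, map_add_left_eq_self]

lemma map_aff (a : Rn n) {s : ℝ} (hs : s ≠ 0) {B : Set (Rn n)} :
    Measure.map (fun x : Rn n => a + s • x) (volume.restrict ((fun x : Rn n => a + s • x) ⁻¹' B)) =
      ENNReal.ofReal ((|s| ^ n)⁻¹) • (volume : Measure (Rn n)).restrict B := by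
  rw [← (aff_emb a hs).restrict_map, map_aff_vol a hs, Measure.restrict_smul]

/-- change of variables inequality -/
lemma lintegral_aff_le (a : Rn n) {s : ℝ} (hs : s ≠ 0) {A B : Set (Rn n)}
    (h : ∀ x ∈ A, a + s • x ∈ B) (F : Rn n → ℝ≥0∞) :
    ∫⁻ x in A, F (a + s • x) ≤ ENNReal.ofReal ((|s| ^ n)⁻¹) * ∫⁻ x in B, F x := by
  calc ∫⁻ x in A, F (a + s • x) ≤ ∫⁻ x in (fun x : Rn n => a + s • x) ⁻¹' B, F (a + s • x) :=
        lintegral_mono_set h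
    _ = ∫⁻ y, F y ∂(Measure.map (fun x : Rn n => a + s • x) (volume.restrict ((fun x : Rn n => a + s • x) ⁻¹' B))) :=
        ((aff_emb a hs).lintegral_map F).symm
    _ = _ := by rw [map_aff a hs, lintegral_smul_measure]; rfl

lemma eLpNorm_aff {r : ℝ≥0∞} (a : Rn n) {s : ℝ} (hs : s ≠ 0) (B : Set (Rn n)) (g : Rn n → ℝ) :
    eLpNorm (fun x => g (a + s • x)) r (volume.restrict ((fun x : Rn n => a + s • x) ⁻¹' B)) =
      ENNReal.ofReal ((|s| ^ n)⁻¹) ^ (1 / r.toReal) * eLpNorm g r (volume.restrict B) := by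
  have h0 : ENNReal.ofReal ((|s| ^ n)⁻¹) ≠ 0 := by
    have : 0 < |s| := abs_pos.2 hs
    simp; positivity
  have := (aff_emb a hs).eLpNorm_map_measure (g := g) (p := r)
    (μ := volume.restrict ((fun x : Rn n => a + s • x) ⁻¹' B))
  rw [map_aff a hs, eLpNorm_smul_measure_of_ne_zero h0] at this
  rw [show (fun x => g (a + s • x)) = g ∘ (fun x : Rn n => a + s • x) from rfl, ← this]
  simp

lemma preimage_half (k : ℕ) (m z : Zn n) :
    (fun x : Rn n => (fun i => (z i : ℝ)) + ((2 : ℝ) ^ k) • x) ⁻¹' (dyadicCubeHalf n 0 (m + z)) =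
      dyadicCubeHalf n k m := by
  ext x
  rw [Set.mem_preimage, mem_half_iff, mem_half_iff, funext_iff, funext_iff]
  refine forall_congr' fun i => ?_
  simp only [fl, pow_zero, one_mul, Pi.add_apply, Pi.smul_apply, smul_eq_mul]
  rw [Int.floor_intCast_add, add_comm]
  exact add_left_inj _

lemma two_scale_const (k : ℕ) (e : ℝ) : ENNReal.ofReal ((|(2 : ℝ) ^ k| ^ n)⁻¹) ^ (1 / e) =
    2 ^ (-((k * n : ℕ) : ℝ) / e) := by
  have : ENNReal.ofReal ((|(2 : ℝ) ^ k| ^ n)⁻¹) = (2 : ℝ≥0∞) ^ (-((k * n : ℕ) : ℝ)) := by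
    rw [abs_of_pos (by positivity), ← pow_mul, ENNReal.rpow_neg, ENNReal.rpow_natCast, ENNReal.ofReal_inv_of_pos (by positivity),
      ENNReal.ofReal_pow (by norm_num)]
    simp
  rw [this, ← ENNReal.rpow_mul]; congr 1; ring

/-- scaling of a dyadic cube to unit scale -/
lemma eLpNorm_scale {r : ℝ≥0∞} (k : ℕ) (m z : Zn n) (g : Rn n → ℝ) :
    eLpNorm (fun x => g ((fun i => (z i : ℝ)) + (2 : ℝ) ^ k • x)) r (volume.restrict (dyadicCubeHalf n k m)) =
      2 ^ (-((k * n : ℕ) : ℝ) / r.toReal) * eLpNorm g r (volume.restrict (dyadicCubeHalf n 0 (m + z))) := by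
  have h2 : (2 : ℝ) ^ k ≠ 0 := by positivity
  rw [← preimage_half k m z, eLpNorm_aff _ h2, two_scale_const]

def UQ (n : ℕ) : Set (Rn n) := Set.Icc 0 1

lemma UQ_compact : IsCompact (UQ n) := isCompact_Icc
lemma UQ_meas : MeasurableSet (UQ n) := measurableSet_Icc
lemma mem_UQ {x : Rn n} : x ∈ UQ n ↔ ∀ i, 0 ≤ x i ∧ x i ≤ 1 := by
  simp [UQ, Set.mem_Icc, Pi.le_def, forall_and]
lemma UQ_vol : volume (UQ n) = 1 := by
  rw [UQ, Real.volume_Icc_pi]; simp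
lemma half_zero_ae : (volume : Measure (Rn n)).restrict (dyadicCubeHalf n 0 0) = volume.restrict (UQ n) := by
  apply Measure.restrict_congr_set
  rw [half_eq_pi]
  have := Measure.univ_pi_Ico_ae_eq_Icc (μ := fun _ : Fin n => (volume : Measure ℝ)) (f := fun _ => 0) (g := fun _ => 1)
  refine Filter.EventuallyEq.trans ?_ this
  simp only [Pi.zero_apply, Int.cast_zero, pow_zero, zero_div, zero_add, div_one]
  exact Filter.EventuallyEq.rfl
instance UQ_prob : IsProbabilityMeasure ((volume : Measure (Rn n)).restrict (UQ n)) :=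
  ⟨by rw [Measure.restrict_apply_univ, UQ_vol]⟩
lemma UQ_regular : UQ n ⊆ closure (interior (UQ n)) := by
  have h1 : UQ n = Set.pi Set.univ (fun _ : Fin n => Set.Icc (0 : ℝ) 1) := by
    ext x; rw [mem_UQ]; simp only [Set.mem_pi, Set.mem_univ, true_implies, Set.mem_Icc]
  rw [h1, interior_pi_set Set.finite_univ, closure_pi_set]
  intro x hx i hi
  simp only [interior_Icc]
  rw [closure_Ioo (by norm_num)]
  exact hx i hi

/-- equivalence of quasinorms on a finite dimensional space of continuous functions -/
lemma norm_equiv {ι : Type*} [Fintype ι] (e : ι → Rn n → ℝ) (he : ∀ i, Continuous (e i))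
    (hind : ∀ c : ι → ℝ, (∀ x ∈ UQ n, ∑ i, c i * e i x = 0) → c = 0) {r : ℝ} (hr : 0 < r) :
    ∃ κ : ℝ, 0 < κ ∧ ∀ c : ι → ℝ, κ * ‖c‖ ^ r ≤ ∫ x in UQ n, |∑ i, c i * e i x| ^ r := by
  let G : (ι → ℝ) → ℝ := fun c => ∫ x in UQ n, |∑ i, c i * e i x| ^ r
  have hcont : Continuous (fun q : (ι → ℝ) × Rn n => |∑ i, q.1 i * e i q.2| ^ r) := by
    refine Continuous.rpow_const ?_ (fun _ => Or.inr hr.le)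
    refine continuous_abs.comp (continuous_finsetSum _ fun i _ => ?_)
    exact Continuous.mul (by fun_prop) ((he i).comp continuous_snd)
  have hG : Continuous G := continuous_parametric_integral_of_continuous (by exact hcont) UQ_compact
  have hnn : ∀ (c : ι → ℝ) (x : Rn n), 0 ≤ |∑ i, c i * e i x| ^ r := fun c x => Real.rpow_nonneg (abs_nonneg _) _
  have hpos : ∀ c ≠ 0, 0 < G c := by
    intro c hc
    refine lt_of_le_of_ne (integral_nonneg fun x => hnn c x) fun h0 => hc (hind c ?_)
    have hcc : Continuous fun x => |∑ i, c i * e i x| ^ r := hcont.comp (Continuous.prodMk_right c)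
    have hintg : Integrable (fun x => |∑ i, c i * e i x| ^ r) (volume.restrict (UQ n)) :=
      hcc.continuousOn.integrableOn_compact UQ_compact
    have hae := (integral_eq_zero_iff_of_nonneg (hnn c) hintg).1 h0.symm
    have := Measure.eqOn_of_ae_eq hae hcc.continuousOn continuousOn_const UQ_regular
    intro x hx
    have h1 := this hx
    simp only [Pi.zero_apply] at h1
    rw [Real.rpow_eq_zero (abs_nonneg _) hr.ne'] at h1
    exact abs_eq_zero.1 h1
  have hhom : ∀ (s : ℝ) c, G (s • c) = |s| ^ r * G c := by
    intro s c
    simp only [G]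
    rw [← integral_const_mul]
    refine integral_congr_ae (Eventually.of_forall fun x => ?_)
    simp only [Pi.smul_apply, smul_eq_mul, mul_assoc]
    rw [← Finset.mul_sum, abs_mul, Real.mul_rpow (abs_nonneg _) (abs_nonneg _)]
  by_cases hne : (Metric.sphere (0 : ι → ℝ) 1).Nonempty
  · obtain ⟨c0, hc0, hmin⟩ := (isCompact_sphere (0 : ι → ℝ) 1).exists_isMinOn hne hG.continuousOn
    have hc0' : c0 ≠ 0 := by
      rintro rfl; simp at hc0
    refine ⟨G c0, hpos c0 hc0', fun c => ?_⟩
    by_cases hc : c = 0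
    · subst hc
      rw [norm_zero, Real.zero_rpow hr.ne', mul_zero]
      exact integral_nonneg fun x => hnn 0 x
    have hn : 0 < ‖c‖ := norm_pos_iff.2 hc
    have h1 : (‖c‖⁻¹ • c) ∈ Metric.sphere (0 : ι → ℝ) 1 := by
      rw [mem_sphere_zero_iff_norm, norm_smul, norm_inv, norm_norm, inv_mul_cancel₀ hn.ne']
    have h2 : G c0 ≤ G (‖c‖⁻¹ • c) := hmin h1
    rw [hhom, abs_of_pos (inv_pos.2 hn), Real.inv_rpow hn.le] at h2
    have h3 : 0 < ‖c‖ ^ r := Real.rpow_pos_of_pos hn r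
    calc G c0 * ‖c‖ ^ r ≤ ((‖c‖ ^ r)⁻¹ * G c) * ‖c‖ ^ r := mul_le_mul_of_nonneg_right h2 h3.le
      _ = G c := by field_simp
  · refine ⟨1, one_pos, fun c => ?_⟩
    have hc : c = 0 := by
      by_contra hc
      apply hne
      have hn : 0 < ‖c‖ := norm_pos_iff.2 hc
      exact ⟨‖c‖⁻¹ • c, by rw [mem_sphere_zero_iff_norm, norm_smul, norm_inv, norm_norm, inv_mul_cancel₀ hn.ne']⟩
    subst hc
    rw [norm_zero, Real.zero_rpow hr.ne', mul_zero]
    exact integral_nonneg fun x => hnn 0 x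

/-- the same in terms of `eLpNorm` for all exponents -/
lemma norm_equiv_eLp {ι : Type*} [Fintype ι] (e : ι → Rn n → ℝ) (he : ∀ i, Continuous (e i))
    (hind : ∀ c : ι → ℝ, (∀ x ∈ UQ n, ∑ i, c i * e i x = 0) → c = 0) {r : ℝ≥0∞} (hr : 0 < r) :
    ∃ C : ℝ≥0∞, C < ∞ ∧ ∀ c : ι → ℝ, ∀ i, ENNReal.ofReal |c i| ≤
      C * eLpNorm (fun x => ∑ i, c i * e i x) r (volume.restrict (UQ n)) := by
  let r0 : ℝ := uu r
  have hr0 : 0 < r0 := uu_pos hr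
  obtain ⟨κ, hκ, h⟩ := norm_equiv e he hind hr0
  refine ⟨ENNReal.ofReal ((κ⁻¹) ^ (1 / r0)), ENNReal.ofReal_lt_top, fun c i => ?_⟩
  have hcc : Continuous fun x => ∑ i, c i * e i x :=
    continuous_finsetSum _ fun i _ => continuous_const.mul (he i)
  have h1 : eLpNorm (fun x => ∑ i, c i * e i x) (ENNReal.ofReal r0) (volume.restrict (UQ n)) ≤
      eLpNorm (fun x => ∑ i, c i * e i x) r (volume.restrict (UQ n)) :=
    eLpNorm_le_eLpNorm_of_exponent_le uu_le hcc.aestronglyMeasurable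
  refine le_trans ?_ (mul_le_mul_right h1 _)
  have hr00 : ENNReal.ofReal r0 ≠ 0 := by simp [hr0]
  rw [eLpNorm_eq_lintegral_rpow_enorm_toReal hr00 (by simp), ENNReal.toReal_ofReal hr0.le]
  have hcont : Continuous fun x => |∑ i, c i * e i x| ^ r0 := by
    refine Continuous.rpow_const (continuous_abs.comp hcc) (fun _ => Or.inr hr0.le)
  have hintg : Integrable (fun x => |∑ i, c i * e i x| ^ r0) (volume.restrict (UQ n)) :=
    hcont.continuousOn.integrableOn_compact UQ_compact
  have h2 : ∫⁻ x in UQ n, ‖∑ i, c i * e i x‖ₑ ^ r0 = ENNReal.ofReal (∫ x in UQ n, |∑ i, c i * e i x| ^ r0) := by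
    rw [ofReal_integral_eq_lintegral_ofReal hintg (Eventually.of_forall fun x => Real.rpow_nonneg (abs_nonneg _) _)]
    refine lintegral_congr fun x => ?_
    rw [Real.enorm_eq_ofReal_abs, ENNReal.ofReal_rpow_of_nonneg (abs_nonneg _) hr0.le]
  rw [h2, ENNReal.ofReal_rpow_of_nonneg (integral_nonneg fun x => Real.rpow_nonneg (abs_nonneg _) _) (by positivity),
    ← ENNReal.ofReal_mul (by positivity)]
  apply ENNReal.ofReal_le_ofReal
  rw [← Real.mul_rpow (by positivity) (integral_nonneg fun x => Real.rpow_nonneg (abs_nonneg _) _)]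
  have h3 : ‖c‖ ^ r0 ≤ κ⁻¹ * ∫ x in UQ n, |∑ i, c i * e i x| ^ r0 := by
    rw [inv_mul_eq_div, le_div_iff₀ hκ, mul_comm]; exact h c
  calc |c i| ≤ ‖c‖ := norm_le_pi_norm c i
    _ = (‖c‖ ^ r0) ^ (1 / r0) := by rw [← Real.rpow_mul (norm_nonneg _)]; field_simp; simp
    _ ≤ _ := Real.rpow_le_rpow (by positivity) h3 (by positivity)

/-- unit cube expansion -/
lemma splineSum_unit (l : ℕ) {x : Rn n} (hx : x ∈ dyadicCubeHalf n 0 0) (b : Zn n → ℝ) :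
    splineSum n l 0 b x = ∑ ν : Fin n → Fin (l + 1), b (fun i => -((ν i : ℕ) : ℤ)) * ∏ i, cardB l (x i + ((ν i : ℕ) : ℝ)) := by
  let f : (Fin n → Fin (l + 1)) ↪ Zn n := ⟨fun ν i => -((ν i : ℕ) : ℤ), fun a b h => by
    funext i
    have := congrFun h i
    simp only [neg_inj] at this
    exact Fin.ext (by exact_mod_cast this)⟩
  rw [mem_half_iff] at hx
  rw [splineSum_finset (s := Finset.univ.map f), Finset.sum_map]
  · refine Finset.sum_congr rfl fun ν _ => ?_
    show b (fun i => -((ν i : ℕ) : ℤ)) * ∏ i, cardB l (2 ^ 0 * x i - ((-((ν i : ℕ) : ℤ) : ℤ) : ℝ)) = _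
    congr 1
    refine Finset.prod_congr rfl fun i _ => ?_
    congr 1; push_cast; ring
  · intro m hm
    rw [hx, sub_zero, mem_nbox] at hm
    rw [Finset.mem_map]
    refine ⟨fun i => ⟨(-m i).toNat, by have := hm i; omega⟩, Finset.mem_univ _, ?_⟩
    funext i
    have := hm i
    show -(((-m i).toNat : ℕ) : ℤ) = m i
    omega

lemma unit_indep (l : ℕ) (c : (Fin n → Fin (l + 1)) → ℝ)
    (h : ∀ x ∈ UQ n, ∑ ν, c ν * ∏ i, cardB l (x i + ((ν i : ℕ) : ℝ)) = 0) : c = 0 := by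
  obtain ⟨pt, lam, hpt, hd⟩ := dual_repr l
  funext μ
  have h1 : ∀ β : Fin n → Fin (l + 1), ∑ ν : Fin n → Fin (l + 1), c ν * ∏ i, cardB l (pt (β i) + ((ν i : ℕ) : ℝ)) = 0 := by
    intro β
    exact h (fun i => pt (β i)) (mem_UQ.2 fun i => ⟨(hpt _).1, (hpt _).2.le⟩)
  have h2 : ∑ β : Fin n → Fin (l + 1), (∏ i, lam (μ i) (β i)) *
      (∑ ν : Fin n → Fin (l + 1), c ν * ∏ i, cardB l (pt (β i) + ((ν i : ℕ) : ℝ))) = 0 := by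
    simp [h1]
  simp_rw [Finset.mul_sum] at h2
  rw [Finset.sum_comm] at h2
  have h3 : ∀ ν : Fin n → Fin (l + 1), ∑ β : Fin n → Fin (l + 1), (∏ i, lam (μ i) (β i)) * (c ν * ∏ i, cardB l (pt (β i) + ((ν i : ℕ) : ℝ))) =
      c ν * if μ = ν then 1 else 0 := by
    intro ν
    have : ∏ i, ∑ b, lam (μ i) b * cardB l (pt b + ((ν i : ℕ) : ℝ)) = if μ = ν then 1 else 0 := by
      simp_rw [hd]
      by_cases hμ : μ = ν
      · subst hμ; simp
      · rw [if_neg hμ]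
        obtain ⟨i, hi⟩ := Function.ne_iff.1 hμ
        exact Finset.prod_eq_zero (Finset.mem_univ i) (by rw [if_neg hi])
    rw [← this, Finset.prod_univ_sum, Finset.mul_sum]
    rw [Fintype.piFinset_univ]
    refine Finset.sum_congr rfl fun β _ => ?_
    rw [Finset.prod_mul_distrib]; ring
  simp_rw [h3] at h2
  simpa using h2

/-- stability of the B-spline basis -/
lemma spline_stable {l : ℕ} (hl : 0 < l) {r : ℝ≥0∞} (hr : 0 < r) :
    ∃ C : ℝ≥0∞, C < ∞ ∧ ∀ (k : ℕ) (b : Zn n → ℝ) (m0 o : Zn n), o ∈ nbox n l →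
      ENNReal.ofReal |b (m0 + o)| ≤ C * (2 ^ (((k * n : ℕ) : ℝ) / r.toReal) *
        eLpNorm (splineSum n l k b) r (volume.restrict (dyadicCubeHalf n k m0))) := by
  obtain ⟨C, hC, h⟩ := norm_equiv_eLp (n := n) (fun (ν : Fin n → Fin (l + 1)) x => ∏ i, cardB l (x i + ((ν i : ℕ) : ℝ)))
    (fun ν => continuous_finsetProd _ fun i _ => (cardB_cont hl).comp (by fun_prop)) (unit_indep l) hr
  refine ⟨C, hC, fun k b m0 o ho => ?_⟩
  rw [mem_nbox] at ho
  have h1 := h (fun ν => b (m0 + fun i => -((ν i : ℕ) : ℤ))) (fun i => ⟨(-o i).toNat, by have := ho i; omega⟩)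
  have e1 : (fun i => -(((⟨(-o i).toNat, by have := ho i; omega⟩ : Fin (l + 1)) : ℕ) : ℤ)) = o := by
    funext i; have := ho i; show -(((-o i).toNat : ℕ) : ℤ) = o i; omega
  simp only [e1] at h1
  refine h1.trans (mul_le_mul_right (le_of_eq ?_) _)
  have e2 : splineSum n l k b = fun x => (fun y => splineSum n l 0 (fun m => b (m + m0)) y) ((fun i => (((-m0) i : ℤ) : ℝ)) + (2 : ℝ) ^ k • x) := by
    funext x
    simp only
    rw [splineSum_scale, ← splineSum_shift]
    congr 1
    funext i; simp
  rw [e2, eLpNorm_scale k m0 (-m0), ← mul_assoc, neg_div, two_rpow_mul_neg, one_mul, add_neg_cancel, ← half_zero_ae]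
  refine eLpNorm_congr_ae ?_
  refine (ae_restrict_iff' (measurableSet_half 0 0)).2 (Eventually.of_forall fun x hx => ?_)
  simp only
  rw [splineSum_unit l hx]
  refine Finset.sum_congr rfl fun ν _ => ?_
  rw [add_comm m0]

end Aff

section Whit
variable {n : ℕ}

def Dl (l : ℕ) (g : Rn n → ℝ) (x y : Rn n) : ℝ := diffl l ((l : ℝ)⁻¹ • (y - x)) g x
def mid (l i : ℕ) (x y : Rn n) : Rn n := x + ((i : ℝ) / l) • (y - x)
def ac (l i : ℕ) : ℝ := (l.choose i : ℝ) * (-1 : ℝ) ^ (l + i)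
/-- the power integral -/
def En (s : ℝ) (g : Rn n → ℝ) : ℝ≥0∞ := ∫⁻ x in UQ n, ‖g x‖ₑ ^ s
/-- the difference integral -/
def Dn (l : ℕ) (s : ℝ) (g : Rn n → ℝ) : ℝ≥0∞ := ∫⁻ x in UQ n, ∫⁻ y in UQ n, ‖Dl l g x y‖ₑ ^ s

lemma Dl_eq (l : ℕ) (g : Rn n → ℝ) (x y : Rn n) :
    Dl l g x y = ∑ i ∈ Finset.range (l + 1), ac l i * g (mid l i x y) := by
  unfold Dl diffl ac mid
  refine Finset.sum_congr rfl fun i _ => ?_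
  rw [smul_smul, div_eq_mul_inv]

lemma mid_zero (l : ℕ) (x y : Rn n) : mid l 0 x y = x := by simp [mid]

lemma mid_apply (l i : ℕ) (x y : Rn n) (a : Fin n) : mid l i x y a = (1 - (i : ℝ) / l) * x a + (i : ℝ) / l * y a := by
  simp [mid]; ring

lemma mid_mem {l i : ℕ} (hl : 0 < l) (hi : i ≤ l) {x y : Rn n} (hx : x ∈ UQ n) (hy : y ∈ UQ n) :
    mid l i x y ∈ UQ n := by
  rw [mem_UQ] at *
  intro a
  rw [mid_apply]
  have hl' : (0 : ℝ) < l := by exact_mod_cast hl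
  have h0 : 0 ≤ (i : ℝ) / l := by positivity
  have h1 : (i : ℝ) / l ≤ 1 := by rw [div_le_one hl']; exact_mod_cast hi
  have := hx a; have := hy a
  constructor <;> nlinarith

lemma Dl_add (l : ℕ) (f g : Rn n → ℝ) (x y : Rn n) :
    Dl l (fun z => f z + g z) x y = Dl l f x y + Dl l g x y := by
  simp only [Dl_eq, mul_add, Finset.sum_add_distrib]

lemma Dl_sub (l : ℕ) (f g : Rn n → ℝ) (x y : Rn n) :
    Dl l (fun z => f z - g z) x y = Dl l f x y - Dl l g x y := by
  simp only [Dl_eq, mul_sub, Finset.sum_sub_distrib]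

lemma Dl_smul (l : ℕ) (c : ℝ) (g : Rn n → ℝ) (x y : Rn n) :
    Dl l (fun z => c * g z) x y = c * Dl l g x y := by
  simp only [Dl_eq, Finset.mul_sum]
  refine Finset.sum_congr rfl fun i _ => ?_
  ring

lemma mid_measurable (l i : ℕ) : Measurable (fun q : Rn n × Rn n => mid l i q.1 q.2) := by
  unfold mid; fun_prop

lemma Dl_measurable (l : ℕ) {g : Rn n → ℝ} (hg : Measurable g) :
    Measurable (fun q : Rn n × Rn n => Dl l g q.1 q.2) := by
  simp only [Dl_eq]
  exact Finset.measurable_sum _ fun i _ => (hg.comp (mid_measurable l i)).const_mul _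

lemma Dl_inner_measurable (l : ℕ) {g : Rn n → ℝ} (hg : Measurable g) (s : ℝ) :
    Measurable (fun x : Rn n => ∫⁻ y in UQ n, ‖Dl l g x y‖ₑ ^ s) :=
  Measurable.lintegral_prod_right' (f := fun q : Rn n × Rn n => ‖Dl l g q.1 q.2‖ₑ ^ s)
    ((Dl_measurable l hg).enorm.pow_const s)

lemma enorm_add_rpow {s : ℝ} (h0 : 0 ≤ s) (h1 : s ≤ 1) (a b : ℝ) : ‖a + b‖ₑ ^ s ≤ ‖a‖ₑ ^ s + ‖b‖ₑ ^ s :=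
  (ENNReal.rpow_le_rpow (enorm_add_le a b) h0).trans (ENNReal.rpow_add_le_add_rpow _ _ h0 h1)

lemma En_add {s : ℝ} (h0 : 0 ≤ s) (h1 : s ≤ 1) {f g : Rn n → ℝ} (hf : Measurable f) :
    En s (fun x => f x + g x) ≤ En s f + En s g := by
  unfold En
  rw [← lintegral_add_left (hf.enorm.pow_const s)]
  exact lintegral_mono fun x => enorm_add_rpow h0 h1 _ _

lemma En_comm (s : ℝ) (f g : Rn n → ℝ) : En s (fun x => f x - g x) = En s (fun x => g x - f x) := by
  unfold En
  refine lintegral_congr fun x => ?_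
  rw [← enorm_neg]; simp

lemma En_tri {s : ℝ} (h0 : 0 ≤ s) (h1 : s ≤ 1) {f g h : Rn n → ℝ} (hf : Measurable f) (hg : Measurable g) :
    En s (fun x => f x - h x) ≤ En s (fun x => f x - g x) + En s (fun x => g x - h x) := by
  have := En_add h0 h1 (f := fun x => f x - g x) (g := fun x => g x - h x) (hf.sub hg)
  simpa using this

lemma En_smul {s : ℝ} (h0 : 0 ≤ s) (c : ℝ) (g : Rn n → ℝ) : En s (fun x => c * g x) = ‖c‖ₑ ^ s * En s g := by
  unfold En
  simp only [enorm_mul, ENNReal.mul_rpow_of_nonneg _ _ h0]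
  rw [lintegral_const_mul' _ _ (ENNReal.rpow_ne_top_of_nonneg h0 (by simp))]

lemma Dn_smul {s : ℝ} (h0 : 0 ≤ s) (l : ℕ) (c : ℝ) (g : Rn n → ℝ) : Dn l s (fun x => c * g x) = ‖c‖ₑ ^ s * Dn l s g := by
  unfold Dn
  simp only [Dl_smul, enorm_mul, ENNReal.mul_rpow_of_nonneg _ _ h0]
  have : ‖c‖ₑ ^ s ≠ ∞ := ENNReal.rpow_ne_top_of_nonneg h0 (by simp)
  simp only [lintegral_const_mul' _ _ this]

lemma En_le_const {s : ℝ} (h0 : 0 ≤ s) {f : Rn n → ℝ} {e : ℝ≥0∞} (h : ∀ x ∈ UQ n, ‖f x‖ₑ ≤ e) : En s f ≤ e ^ s := by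
  unfold En
  calc ∫⁻ x in UQ n, ‖f x‖ₑ ^ s ≤ ∫⁻ x in UQ n, e ^ s :=
        setLIntegral_mono' UQ_meas fun x hx => ENNReal.rpow_le_rpow (h x hx) h0
    _ = _ := by simp [UQ_vol]

lemma Dn_add {s : ℝ} (h0 : 0 ≤ s) (h1 : s ≤ 1) (l : ℕ) {f g : Rn n → ℝ} (hf : Measurable f) :
    Dn l s (fun x => f x + g x) ≤ Dn l s f + Dn l s g := by
  unfold Dn
  rw [← lintegral_add_left (Dl_inner_measurable l hf s)]
  refine lintegral_mono fun x => ?_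
  have hm : Measurable fun y => ‖Dl l f x y‖ₑ ^ s :=
    ((Dl_measurable l hf).comp (measurable_prodMk_left (x := x))).enorm.pow_const s
  simp only
  rw [← lintegral_add_left hm]
  refine lintegral_mono fun y => ?_
  simp only [Dl_add]
  exact enorm_add_rpow h0 h1 _ _

lemma mid_lint {l i : ℕ} (hi : 0 < i) (hil : i ≤ l) {x : Rn n} (hx : x ∈ UQ n) (F : Rn n → ℝ≥0∞) :
    ∫⁻ y in UQ n, F (mid l i x y) ≤ (l : ℝ≥0∞) ^ n * ∫⁻ y in UQ n, F y := by
  have hl : (0 : ℝ) < l := by exact_mod_cast (lt_of_lt_of_le hi hil)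
  have hi' : (1 : ℝ) ≤ i := by exact_mod_cast hi
  have hs : (i : ℝ) / l ≠ 0 := by positivity
  have e : ∀ y : Rn n, mid l i x y = (x - ((i : ℝ) / l) • x) + ((i : ℝ) / l) • y := by
    intro y; unfold mid; rw [smul_sub]; abel
  simp_rw [e]
  refine (lintegral_aff_le _ hs (B := UQ n) ?_ F).trans (mul_le_mul_left ?_ _)
  · intro y hy; rw [← e]; exact mid_mem (by omega) hil hx hy
  · rw [abs_of_nonneg (by positivity), ← inv_pow, inv_div]
    rw [ENNReal.ofReal_pow (by positivity)]
    refine pow_le_pow_left' ?_ n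
    rw [← ENNReal.ofReal_natCast]
    exact ENNReal.ofReal_le_ofReal (div_le_self hl.le hi')

lemma ac_enorm {l i : ℕ} {s : ℝ} (hi : i ≤ l) (h1 : s ≤ 1) : ‖ac l i‖ₑ ^ s ≤ (2 : ℝ≥0∞) ^ l := by
  have e : ‖ac l i‖ₑ = (l.choose i : ℝ≥0∞) := by
    rw [Real.enorm_eq_ofReal_abs, ac, abs_mul]; simp
  rw [e]
  have h : (1 : ℝ≥0∞) ≤ (l.choose i : ℝ≥0∞) := by exact_mod_cast Nat.choose_pos hi
  calc (l.choose i : ℝ≥0∞) ^ s ≤ (l.choose i : ℝ≥0∞) ^ (1 : ℝ) := ENNReal.rpow_le_rpow_of_exponent_le h h1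
    _ ≤ _ := by rw [ENNReal.rpow_one]; exact_mod_cast Nat.choose_le_two_pow l i

def C0 (n l : ℕ) : ℝ≥0∞ := (2 : ℝ≥0∞) ^ l * l * (l : ℝ≥0∞) ^ n

lemma rest_lint {l : ℕ} {s : ℝ} (h0 : 0 < s) (h1 : s ≤ 1) {g : Rn n → ℝ} (hg : Measurable g) {x : Rn n} (hx : x ∈ UQ n) :
    ∫⁻ y in UQ n, ‖∑ i ∈ Finset.range l, ac l (i + 1) * g (mid l (i + 1) x y)‖ₑ ^ s ≤ C0 n l * En s g := by
  calc _ ≤ ∫⁻ y in UQ n, ∑ i ∈ Finset.range l, (2 : ℝ≥0∞) ^ l * ‖g (mid l (i + 1) x y)‖ₑ ^ s := by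
        refine lintegral_mono fun y => ?_
        refine (ENNReal.rpow_le_rpow (enorm_sum_le _ _) h0.le).trans ?_
        refine (rpow_finset_sum_le h0.le h1 _ _ h0).trans (Finset.sum_le_sum fun i hi => ?_)
        rw [enorm_mul, ENNReal.mul_rpow_of_nonneg _ _ h0.le]
        exact mul_le_mul_left (ac_enorm (by have := Finset.mem_range.1 hi; omega) h1) _
    _ = ∑ i ∈ Finset.range l, (2 : ℝ≥0∞) ^ l * ∫⁻ y in UQ n, ‖g (mid l (i + 1) x y)‖ₑ ^ s := by
        rw [lintegral_finsetSum]
        · refine Finset.sum_congr rfl fun i _ => ?_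
          rw [lintegral_const_mul' _ _ (by simp)]
        · intro i _
          refine Measurable.const_mul ?_ _
          exact (hg.comp ((mid_measurable l (i + 1)).comp (measurable_prodMk_left (x := x)))).enorm.pow_const s
    _ ≤ ∑ i ∈ Finset.range l, (2 : ℝ≥0∞) ^ l * ((l : ℝ≥0∞) ^ n * En s g) := by
        refine Finset.sum_le_sum fun i hi => mul_le_mul_right ?_ _
        exact mid_lint (Nat.succ_pos i) (by have := Finset.mem_range.1 hi; omega) hx (fun z => ‖g z‖ₑ ^ s)
    _ = _ := by
        rw [Finset.sum_const, Finset.card_range, nsmul_eq_mul, C0]; ring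

lemma Dl_split (l : ℕ) (g : Rn n → ℝ) (x y : Rn n) :
    Dl l g x y = ∑ i ∈ Finset.range l, ac l (i + 1) * g (mid l (i + 1) x y) + (-1) ^ l * g x := by
  rw [Dl_eq, Finset.sum_range_succ', mid_zero]
  simp [ac]

lemma rest_meas (l : ℕ) {g : Rn n → ℝ} (hg : Measurable g) (x : Rn n) :
    Measurable fun y => ∑ i ∈ Finset.range l, ac l (i + 1) * g (mid l (i + 1) x y) :=
  Finset.measurable_sum _ fun i _ => Measurable.const_mul
    (hg.comp ((mid_measurable l (i + 1)).comp (measurable_prodMk_left (x := x)))) _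

lemma enorm_sgn (l : ℕ) (a : ℝ) : ‖(-1) ^ l * a‖ₑ = ‖a‖ₑ := by
  rw [enorm_mul, Real.enorm_eq_ofReal_abs ((-1) ^ l)]; simp

lemma Dn_le {l : ℕ} {s : ℝ} (h0 : 0 < s) (h1 : s ≤ 1) {g : Rn n → ℝ} (hg : Measurable g) :
    Dn l s g ≤ (C0 n l + 1) * En s g := by
  unfold Dn
  calc _ ≤ ∫⁻ x in UQ n, (C0 n l * En s g + ‖g x‖ₑ ^ s) := by
        refine setLIntegral_mono' UQ_meas fun x hx => ?_
        calc ∫⁻ y in UQ n, ‖Dl l g x y‖ₑ ^ s ≤ ∫⁻ y in UQ n, (‖∑ i ∈ Finset.range l, ac l (i + 1) * g (mid l (i + 1) x y)‖ₑ ^ s + ‖g x‖ₑ ^ s) := by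
              refine lintegral_mono fun y => ?_
              simp only [Dl_split]
              refine (enorm_add_rpow h0.le h1 _ _).trans ?_
              rw [enorm_sgn]
          _ = (∫⁻ y in UQ n, ‖∑ i ∈ Finset.range l, ac l (i + 1) * g (mid l (i + 1) x y)‖ₑ ^ s) + ‖g x‖ₑ ^ s := by
              rw [lintegral_add_right _ measurable_const]; simp [UQ_vol]
          _ ≤ _ := add_le_add_left (rest_lint h0 h1 hg hx) _
    _ = _ := by
        rw [lintegral_add_left measurable_const, add_mul, one_mul]
        simp [UQ_vol, En]

lemma PW {l : ℕ} {s : ℝ} (h0 : 0 < s) (h1 : s ≤ 1) {g : Rn n → ℝ} (hg : Measurable g) {x : Rn n} (hx : x ∈ UQ n) :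
    ‖g x‖ₑ ^ s ≤ (∫⁻ y in UQ n, ‖Dl l g x y‖ₑ ^ s) + C0 n l * En s g := by
  calc ‖g x‖ₑ ^ s = ∫⁻ y in UQ n, ‖g x‖ₑ ^ s := by simp [UQ_vol]
    _ ≤ ∫⁻ y in UQ n, (‖Dl l g x y‖ₑ ^ s + ‖∑ i ∈ Finset.range l, ac l (i + 1) * g (mid l (i + 1) x y)‖ₑ ^ s) := by
        refine lintegral_mono fun y => ?_
        rw [← enorm_sgn l (g x), show (-1) ^ l * g x = Dl l g x y + -(∑ i ∈ Finset.range l, ac l (i + 1) * g (mid l (i + 1) x y)) by rw [Dl_split]; ring]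
        refine (enorm_add_rpow h0.le h1 _ _).trans ?_
        rw [enorm_neg]
    _ = (∫⁻ y in UQ n, ‖Dl l g x y‖ₑ ^ s) + _ := by
        rw [lintegral_add_right _ ((rest_meas l hg x).enorm.pow_const s)]
    _ ≤ _ := add_le_add_right (rest_lint h0 h1 hg hx) _

lemma C0_lt (n l : ℕ) : C0 n l < ∞ := by
  unfold C0
  exact ENNReal.mul_lt_top (ENNReal.mul_lt_top (by simp) (by simp)) (by simp)

/-- truncation -/
lemma trunc (n l : ℕ) {s : ℝ} (h0 : 0 < s) (h1 : s ≤ 1) : ∃ M : ℝ, 0 ≤ M ∧ ∀ g : Rn n → ℝ, Measurable g → En s g ≤ 1 →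
    ∃ h : Rn n → ℝ, Measurable h ∧ (∀ x, |h x| ≤ M) ∧ En s (fun x => g x - h x) ≤ 2 * Dn l s g := by
  let M : ℝ := ((2 * C0 n l) ^ (1 / s)).toReal
  have hMt : (2 * C0 n l) ^ (1 / s) ≠ ∞ := ENNReal.rpow_ne_top_of_nonneg (by positivity)
    (ENNReal.mul_ne_top (by simp) (C0_lt n l).ne)
  refine ⟨M, ENNReal.toReal_nonneg, fun g hg hE => ?_⟩
  let h : Rn n → ℝ := {x | |g x| ≤ M}.indicator g
  refine ⟨h, hg.indicator (measurableSet_le (by fun_prop) measurable_const), ?_, ?_⟩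
  · intro x
    by_cases hx : |g x| ≤ M
    · have : h x = g x := Set.indicator_of_mem (show x ∈ {x | |g x| ≤ M} from hx) _
      rw [this]; exact hx
    · have : h x = 0 := Set.indicator_of_notMem (show x ∉ {x | |g x| ≤ M} from hx) _
      rw [this, abs_zero]; exact ENNReal.toReal_nonneg
  · unfold En Dn
    rw [← lintegral_const_mul' _ _ (by simp)]
    refine setLIntegral_mono' UQ_meas fun x hx => ?_
    by_cases hxM : |g x| ≤ M
    · have : h x = g x := Set.indicator_of_mem (show x ∈ {x | |g x| ≤ M} from hxM) _
      show ‖g x - h x‖ₑ ^ s ≤ _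
      rw [this, sub_self, enorm_zero, ENNReal.zero_rpow_of_pos h0]; exact zero_le
    · have : h x = 0 := Set.indicator_of_notMem (show x ∉ {x | |g x| ≤ M} from hxM) _
      show ‖g x - h x‖ₑ ^ s ≤ _
      rw [this, sub_zero]
      push Not at hxM
      have h2 := PW (l := l) h0 h1 hg hx
      have h3 : 2 * C0 n l ≤ ‖g x‖ₑ ^ s := by
        have : (2 * C0 n l) ^ (1 / s) ≤ ‖g x‖ₑ := by
          rw [Real.enorm_eq_ofReal_abs, ← ENNReal.ofReal_toReal hMt]
          exact ENNReal.ofReal_le_ofReal hxM.le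
        calc 2 * C0 n l = ((2 * C0 n l) ^ (1 / s)) ^ s := by
              rw [← ENNReal.rpow_mul, one_div_mul_cancel h0.ne', ENNReal.rpow_one]
          _ ≤ _ := ENNReal.rpow_le_rpow this h0.le
      have h4 : C0 n l * En s g ≤ C0 n l := by
        calc _ ≤ C0 n l * 1 := mul_le_mul_right hE _
          _ = _ := mul_one _
      have h5 : ‖g x‖ₑ ^ s ≤ (∫⁻ y in UQ n, ‖Dl l g x y‖ₑ ^ s) + C0 n l := h2.trans (add_le_add_right h4 _)
      have hfin : ‖g x‖ₑ ^ s ≠ ∞ := ENNReal.rpow_ne_top_of_nonneg h0.le (by simp)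
      by_cases hI : (∫⁻ y in UQ n, ‖Dl l g x y‖ₑ ^ s) = ∞
      · rw [hI]; simp
      · rw [← ENNReal.toReal_le_toReal hfin (ENNReal.add_ne_top.2 ⟨hI, (C0_lt n l).ne⟩), ENNReal.toReal_add hI (C0_lt n l).ne] at h5
        rw [← ENNReal.toReal_le_toReal (ENNReal.mul_ne_top (by simp) (C0_lt n l).ne) hfin, ENNReal.toReal_mul] at h3
        rw [← ENNReal.toReal_le_toReal hfin (ENNReal.mul_ne_top (by simp) hI), ENNReal.toReal_mul]
        simp only [ENNReal.toReal_ofNat] at *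
        linarith

end Whit

section Smooth
variable {n : ℕ}

def wt (n : ℕ) (y : Rn n) : ℝ := max 0 (1 / 2 - ‖y - fun _ => (1 / 2 : ℝ)‖)

lemma wt_cont : Continuous (wt n) := by unfold wt; fun_prop

lemma wt_nonneg (y : Rn n) : 0 ≤ wt n y := le_max_left _ _

lemma wt_le (y : Rn n) : wt n y ≤ 1 := by
  unfold wt
  have := norm_nonneg (y - fun _ => (1 / 2 : ℝ))
  exact max_le (by norm_num) (by linarith)

lemma wt_zero {y : Rn n} (h : y ∉ UQ n) : wt n y = 0 := by
  unfold wt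
  refine max_eq_left ?_
  by_contra hc
  push Not at hc
  apply h
  rw [mem_UQ]
  intro i
  have := norm_le_pi_norm (y - fun _ => (1 / 2 : ℝ)) i
  simp only [Pi.sub_apply, Real.norm_eq_abs] at this
  have := abs_le.1 (this.trans (show _ ≤ (1 / 2 : ℝ) by linarith))
  constructor <;> linarith

lemma wt_lip (y z : Rn n) : |wt n y - wt n z| ≤ ‖y - z‖ := by
  unfold wt
  rw [max_comm, max_comm (0 : ℝ) (1 / 2 - ‖z - fun _ => (1 / 2 : ℝ)‖)]
  refine (abs_max_sub_max_le_abs (1 / 2 - ‖y - fun _ => (1 / 2 : ℝ)‖) (1 / 2 - ‖z - fun _ => (1 / 2 : ℝ)‖) 0).trans ?_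
  have := abs_norm_sub_norm_le (z - fun _ => (1 / 2 : ℝ)) (y - fun _ => (1 / 2 : ℝ))
  rw [sub_sub_sub_cancel_right (G := Rn n), norm_sub_rev z y] at this
  refine le_trans (le_of_eq ?_) this
  congr 1; ring

lemma wt_le_ind (y : Rn n) : wt n y ≤ (UQ n).indicator 1 y := by
  by_cases h : y ∈ UQ n
  · rw [Set.indicator_of_mem h]; exact wt_le y
  · rw [Set.indicator_of_notMem h, wt_zero h]

lemma ind_integrable : Integrable ((UQ n).indicator (1 : Rn n → ℝ)) volume := by
  rw [integrable_indicator_iff UQ_meas]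
  exact integrableOn_const (by rw [UQ_vol]; simp)

lemma ind_integral : ∫ y, (UQ n).indicator (1 : Rn n → ℝ) y = 1 := by
  rw [integral_indicator UQ_meas]; simp [UQ_vol, Measure.real]

lemma mul_wt_integrable {H : Rn n → ℝ} (hH : Measurable H) {M : ℝ} (hM : ∀ y, |H y| ≤ M) (v : Rn n) :
    Integrable (fun y => H y * wt n (y - v)) volume := by
  have hb : Integrable (fun y => M * (UQ n).indicator (1 : Rn n → ℝ) (y - v)) volume :=
    (ind_integrable.comp_sub_right v).const_mul M
  refine hb.mono' (hH.mul ((wt_cont.measurable).comp (by fun_prop))).aestronglyMeasurable (Eventually.of_forall fun y => ?_)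
  rw [Real.norm_eq_abs, abs_mul, abs_of_nonneg (wt_nonneg _)]
  exact mul_le_mul (hM y) (wt_le_ind _) (wt_nonneg _) ((abs_nonneg _).trans (hM y))

def Wc (n : ℕ) : ℝ := ∫ y, wt n y

lemma wt_integrable : Integrable (wt n) volume := by
  have := mul_wt_integrable (n := n) (H := fun _ => 1) measurable_const (M := 1) (by simp) 0
  simpa using this

lemma Wc_pos (n : ℕ) : 0 < Wc n := by
  unfold Wc
  refine Continuous.integral_pos_of_hasCompactSupport_nonneg_nonzero wt_cont ?_ wt_nonneg (x := fun _ => 1 / 2) ?_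
  · exact HasCompactSupport.intro UQ_compact fun y hy => wt_zero hy
  · unfold wt; simp

def Fi (l i : ℕ) (h : Rn n → ℝ) (x : Rn n) : ℝ := ∫ y, h (mid l i x y) * wt n y

lemma mid_meas_right (l i : ℕ) (x : Rn n) : Measurable (fun y => mid l i x y) :=
  (mid_measurable l i).comp (measurable_prodMk_left (x := x))

lemma Fi_integrable (l i : ℕ) {h : Rn n → ℝ} (hh : Measurable h) {M : ℝ} (hM : ∀ y, |h y| ≤ M) (x : Rn n) :
    Integrable (fun y => h (mid l i x y) * wt n y) volume := by
  have := mul_wt_integrable (hh.comp (mid_meas_right l i x)) (fun y => hM _) 0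
  simpa using this

lemma Fi_lip {l i : ℕ} (hi : 0 < i) (hil : i ≤ l) {h : Rn n → ℝ} (hh : Measurable h) {M : ℝ} (hM : ∀ y, |h y| ≤ M) (x x' : Rn n) :
    |Fi l i h x' - Fi l i h x| ≤ 2 * M * l * ‖x' - x‖ := by
  have hi' : (1 : ℝ) ≤ i := by exact_mod_cast hi
  have hl : (0 : ℝ) < l := by exact_mod_cast (lt_of_lt_of_le hi hil)
  have hil' : (i : ℝ) ≤ l := by exact_mod_cast hil
  set v : Rn n := (((l : ℝ) - i) / i) • (x' - x) with hv
  have hM0 : 0 ≤ M := (abs_nonneg _).trans (hM 0)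
  have hvn : ‖v‖ ≤ l * ‖x' - x‖ := by
    rw [hv, norm_smul, Real.norm_eq_abs, abs_of_nonneg (div_nonneg (by linarith) (by linarith))]
    refine mul_le_mul_of_nonneg_right ?_ (norm_nonneg _)
    rw [div_le_iff₀ (by linarith)]; nlinarith
  have e1 : Fi l i h x' = ∫ y, h (mid l i x y) * wt n (y - v) := by
    rw [← integral_add_right_eq_self (μ := volume) (fun y => h (mid l i x y) * wt n (y - v)) v]
    unfold Fi
    refine integral_congr_ae (Eventually.of_forall fun y => ?_)
    simp only [add_sub_cancel_right]
    congr 2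
    ext a
    rw [mid_apply, mid_apply, hv]
    simp only [Pi.add_apply, Pi.smul_apply, Pi.sub_apply, smul_eq_mul]
    field_simp; ring
  have e2 : Fi l i h x' - Fi l i h x = ∫ y, h (mid l i x y) * (wt n (y - v) - wt n y) := by
    have hI : Integrable (fun y => h (mid l i x y) * wt n (y - v)) volume :=
      mul_wt_integrable (hh.comp (mid_meas_right l i x)) (fun y => hM _) v
    rw [e1]; unfold Fi
    rw [← integral_sub hI (Fi_integrable l i hh hM x)]
    refine integral_congr_ae (Eventually.of_forall fun y => ?_)
    ring
  have hb : Integrable (fun y => M * ‖v‖ * ((UQ n).indicator (1 : Rn n → ℝ) (y - v) + (UQ n).indicator (1 : Rn n → ℝ) y)) volume :=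
    ((ind_integrable.comp_sub_right v).add ind_integrable).const_mul _
  have hi2 : ∫ y, M * ‖v‖ * ((UQ n).indicator (1 : Rn n → ℝ) (y - v) + (UQ n).indicator (1 : Rn n → ℝ) y) = M * ‖v‖ * 2 := by
    rw [integral_const_mul, integral_add (ind_integrable.comp_sub_right v) ind_integrable,
      integral_sub_right_eq_self (fun y => (UQ n).indicator (1 : Rn n → ℝ) y) v, ind_integral]
    norm_num
  rw [e2, ← Real.norm_eq_abs]
  calc _ ≤ M * ‖v‖ * 2 := by
        rw [← hi2]
        refine norm_integral_le_of_norm_le hb (Eventually.of_forall fun y => ?_)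
        rw [Real.norm_eq_abs, abs_mul, mul_assoc M]
        refine mul_le_mul (hM _) ?_ (abs_nonneg _) hM0
        have hl1 : |wt n (y - v) - wt n y| ≤ ‖v‖ := by
          refine (wt_lip _ _).trans ?_
          rw [sub_sub_cancel_left, norm_neg]
        by_cases h1 : y - v ∈ UQ n
        · rw [Set.indicator_of_mem h1]
          have : (0 : ℝ) ≤ (UQ n).indicator (1 : Rn n → ℝ) y := Set.indicator_nonneg (by simp) _
          simp only [Pi.one_apply]
          nlinarith [norm_nonneg v]
        · by_cases h2 : y ∈ UQ n
          · rw [Set.indicator_of_mem h2, Set.indicator_of_notMem h1]; simpa using hl1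
          · rw [wt_zero h1, wt_zero h2]; simp [Set.indicator_of_notMem h1, Set.indicator_of_notMem h2]
    _ ≤ M * (l * ‖x' - x‖) * 2 := by gcongr
    _ = _ := by ring

/-- smoothing -/
def sm (l : ℕ) (h : Rn n → ℝ) (x : Rn n) : ℝ :=
  -(-1) ^ l * (Wc n)⁻¹ * ∑ i ∈ Finset.range l, ac l (i + 1) * Fi l (i + 1) h x

lemma ac_abs (l i : ℕ) : |ac l i| ≤ 2 ^ l := by
  rw [ac, abs_mul, abs_pow]; simp
  exact_mod_cast Nat.choose_le_two_pow l i

lemma sm_lip (l : ℕ) {h : Rn n → ℝ} (hh : Measurable h) {M : ℝ} (hM : ∀ y, |h y| ≤ M) (x x' : Rn n) :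
    |sm l h x' - sm l h x| ≤ (Wc n)⁻¹ * (l * (2 ^ l * (2 * M * l))) * ‖x' - x‖ := by
  have hW := Wc_pos n
  unfold sm
  rw [← mul_sub, ← Finset.sum_sub_distrib, abs_mul, abs_mul, abs_neg, abs_pow, abs_neg, abs_one, one_pow, one_mul,
    abs_of_pos (inv_pos.2 hW), mul_assoc]
  refine mul_le_mul_of_nonneg_left ?_ (inv_pos.2 hW).le
  refine (Finset.abs_sum_le_sum_abs _ _).trans ?_
  calc _ ≤ ∑ i ∈ Finset.range l, 2 ^ l * (2 * M * l * ‖x' - x‖) := by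
        refine Finset.sum_le_sum fun i hi => ?_
        rw [← mul_sub, abs_mul]
        exact mul_le_mul (ac_abs _ _) (Fi_lip (Nat.succ_pos i) (by have := Finset.mem_range.1 hi; omega) hh hM x x')
          (abs_nonneg _) (by positivity)
    _ = _ := by rw [Finset.sum_const, Finset.card_range, nsmul_eq_mul]; ring

lemma sm_err (l : ℕ) {h : Rn n → ℝ} (hh : Measurable h) {M : ℝ} (hM : ∀ y, |h y| ≤ M) (x : Rn n) :
    h x - sm l h x = (-1) ^ l * (Wc n)⁻¹ * ∫ y, Dl l h x y * wt n y := by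
  have hW := (Wc_pos n).ne'
  have e : ∫ y, Dl l h x y * wt n y = (∑ i ∈ Finset.range l, ac l (i + 1) * Fi l (i + 1) h x) + (-1) ^ l * h x * Wc n := by
    simp only [Dl_split, add_mul, Finset.sum_mul]
    rw [integral_add, integral_finsetSum]
    · congr 1
      · refine Finset.sum_congr rfl fun i _ => ?_
        simp only [mul_assoc]
        rw [integral_const_mul]; rfl
      · rw [integral_const_mul]; rfl
    · intro i _; simp only [mul_assoc]; exact (Fi_integrable l (i + 1) hh hM x).const_mul _
    · exact integrable_finsetSum _ fun i _ => by simp only [mul_assoc]; exact (Fi_integrable l (i + 1) hh hM x).const_mul _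
    · exact wt_integrable.const_mul _
  rw [e, sm]
  have h2 : ((-1 : ℝ) ^ l) * (-1) ^ l = 1 := by rw [← mul_pow]; simp
  field_simp
  linear_combination (-(h x * Wc n)) * h2

lemma sm_err_le (l : ℕ) {h : Rn n → ℝ} (hh : Measurable h) {M : ℝ} (hM : ∀ y, |h y| ≤ M) (x : Rn n) :
    ‖h x - sm l h x‖ₑ ≤ ENNReal.ofReal (Wc n)⁻¹ * ∫⁻ y in UQ n, ‖Dl l h x y‖ₑ := by
  rw [sm_err l hh hM, mul_assoc, enorm_sgn, enorm_mul, Real.enorm_of_nonneg (inv_pos.2 (Wc_pos n)).le]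
  refine mul_le_mul_right ?_ _
  refine (enorm_integral_le_lintegral_enorm _).trans ?_
  rw [← lintegral_indicator UQ_meas]
  refine lintegral_mono fun y => ?_
  by_cases hy : y ∈ UQ n
  · rw [Set.indicator_of_mem hy, enorm_mul]
    calc _ ≤ ‖Dl l h x y‖ₑ * 1 := by
          refine mul_le_mul_right ?_ _
          rw [Real.enorm_of_nonneg (wt_nonneg y)]; exact ENNReal.ofReal_le_one.2 (wt_le y)
      _ = _ := mul_one _
  · rw [wt_zero hy]; simp

lemma Dl_bdd {l : ℕ} {h : Rn n → ℝ} {M : ℝ} (hM : ∀ y, |h y| ≤ M) (x y : Rn n) :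
    |Dl l h x y| ≤ (l + 1) * (2 ^ l * M) := by
  rw [Dl_eq]
  refine (Finset.abs_sum_le_sum_abs _ _).trans ?_
  calc _ ≤ ∑ i ∈ Finset.range (l + 1), 2 ^ l * M := by
        refine Finset.sum_le_sum fun i _ => ?_
        rw [abs_mul]; exact mul_le_mul (ac_abs _ _) (hM _) (abs_nonneg _) (by positivity)
    _ = _ := by rw [Finset.sum_const, Finset.card_range, nsmul_eq_mul]; push_cast; ring

lemma En_jensen {s : ℝ} (h0 : 0 < s) (h1 : s ≤ 1) {f : Rn n → ℝ} (hf : Measurable f) :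
    En s f ≤ (∫⁻ x in UQ n, ‖f x‖ₑ) ^ s := by
  have := eLpNorm'_le_eLpNorm'_of_exponent_le h0 h1 (volume.restrict (UQ n)) hf.aestronglyMeasurable
  have h2 := ENNReal.rpow_le_rpow this h0.le
  unfold eLpNorm' at h2
  rw [rpow_self_one_div h0] at h2
  unfold En
  simpa using h2

/-- regularization -/
lemma regul (n l : ℕ) {s : ℝ} (h0 : 0 < s) (h1 : s ≤ 1) : ∃ B L : ℝ, ∃ K : ℝ≥0∞, K < ∞ ∧ 0 ≤ B ∧ 0 ≤ L ∧
    ∀ g : Rn n → ℝ, Measurable g → En s g ≤ 1 → ∃ f : Rn n → ℝ, Continuous f ∧ (∀ x ∈ UQ n, |f x| ≤ B) ∧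
      (∀ x x', |f x' - f x| ≤ L * ‖x' - x‖) ∧
      En s (fun x => g x - f x) ≤ 2 * Dn l s g + (K * Dn l s g) ^ s := by
  obtain ⟨M, hM0, hM⟩ := trunc n l h0 h1
  set B' : ℝ := (l + 1) * (2 ^ l * M) with hB'
  set L : ℝ := (Wc n)⁻¹ * (l * (2 ^ l * (2 * M * l))) with hL
  have hW := Wc_pos n
  refine ⟨M + (Wc n)⁻¹ * B', L, ENNReal.ofReal (Wc n)⁻¹ * (ENNReal.ofReal B' ^ (1 - s) * (1 + (C0 n l + 1) * 2)), ?_, by positivity, by positivity, ?_⟩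
  · refine ENNReal.mul_lt_top (by simp) (ENNReal.mul_lt_top (ENNReal.rpow_lt_top_of_nonneg (by linarith) (by simp)) ?_)
    exact ENNReal.add_lt_top.2 ⟨by simp, ENNReal.mul_lt_top (ENNReal.add_lt_top.2 ⟨C0_lt n l, by simp⟩) (by simp)⟩
  intro g hg hE
  obtain ⟨h, hh, hhM, hgh⟩ := hM g hg hE
  have hlip := fun x x' => sm_lip l hh hhM x x'
  have hcont : Continuous (sm l h) := by
    refine (LipschitzWith.of_dist_le_mul (K := L.toNNReal) fun x x' => ?_).continuous
    rw [Real.coe_toNNReal _ (by positivity), Real.dist_eq, dist_eq_norm]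
    exact hlip x' x
  have herr : ∀ x, ‖h x - sm l h x‖ₑ ≤ ENNReal.ofReal (Wc n)⁻¹ * (ENNReal.ofReal B' ^ (1 - s) * ∫⁻ y in UQ n, ‖Dl l h x y‖ₑ ^ s) := by
    intro x
    refine (sm_err_le l hh hhM x).trans (mul_le_mul_right ?_ _)
    rw [← lintegral_const_mul' _ _ (ENNReal.rpow_ne_top_of_nonneg (by linarith) (by simp))]
    refine lintegral_mono fun y => ?_
    calc ‖Dl l h x y‖ₑ = ‖Dl l h x y‖ₑ ^ (1 - s) * ‖Dl l h x y‖ₑ ^ s := by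
          rw [← ENNReal.rpow_add_of_nonneg _ _ (by linarith) h0.le]; simp
      _ ≤ _ := by
          refine mul_le_mul_left (ENNReal.rpow_le_rpow ?_ (by linarith)) _
          rw [Real.enorm_eq_ofReal_abs]; exact ENNReal.ofReal_le_ofReal (Dl_bdd hhM x y)
  refine ⟨sm l h, hcont, ?_, hlip, ?_⟩
  · intro x _
    have h3 : |h x - sm l h x| ≤ (Wc n)⁻¹ * B' := by
      have := (sm_err_le l hh hhM x)
      have h4 : ENNReal.ofReal (Wc n)⁻¹ * ∫⁻ y in UQ n, ‖Dl l h x y‖ₑ ≤ ENNReal.ofReal ((Wc n)⁻¹ * B') := by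
        rw [ENNReal.ofReal_mul (by positivity)]
        refine mul_le_mul_right ?_ _
        calc _ ≤ ∫⁻ y in UQ n, ENNReal.ofReal B' := by
              refine lintegral_mono fun y => ?_
              rw [Real.enorm_eq_ofReal_abs]; exact ENNReal.ofReal_le_ofReal (Dl_bdd hhM x y)
          _ = _ := by simp
      have h5 := this.trans h4
      rw [Real.enorm_eq_ofReal_abs] at h5
      exact (ENNReal.ofReal_le_ofReal_iff (by positivity)).1 h5
    have h6 := hhM x
    have : |sm l h x| ≤ |h x| + |h x - sm l h x| := by
      have := abs_sub (h x) (h x - sm l h x); simpa using this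
    linarith
  · refine (En_tri h0.le h1 (g := h) hg hh).trans (add_le_add hgh ?_)
    refine (En_jensen h0 h1 (hh.sub hcont.measurable)).trans (ENNReal.rpow_le_rpow ?_ h0.le)
    have hD : Dn l s h ≤ (1 + (C0 n l + 1) * 2) * Dn l s g := by
      have a1 : Dn l s h ≤ Dn l s g + Dn l s (fun x => h x - g x) := by
        have := Dn_add h0.le h1 l (f := g) (g := fun x => h x - g x) hg
        simpa using this
      refine a1.trans ?_
      have a2 := Dn_le (l := l) h0 h1 (hh.sub hg)
      have a3 : Dn l s (fun x => h x - g x) ≤ (C0 n l + 1) * (2 * Dn l s g) := by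
        refine a2.trans (mul_le_mul_right ?_ _)
        calc _ = En s (fun x => g x - h x) := En_comm s h g
          _ ≤ _ := hgh
      calc _ ≤ Dn l s g + (C0 n l + 1) * (2 * Dn l s g) := add_le_add_right a3 _
        _ = _ := by ring
    calc _ ≤ ∫⁻ x in UQ n, ENNReal.ofReal (Wc n)⁻¹ * (ENNReal.ofReal B' ^ (1 - s) * ∫⁻ y in UQ n, ‖Dl l h x y‖ₑ ^ s) := lintegral_mono fun x => herr x
      _ = ENNReal.ofReal (Wc n)⁻¹ * (ENNReal.ofReal B' ^ (1 - s) * Dn l s h) := by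
        rw [lintegral_const_mul' _ _ (by simp), lintegral_const_mul' _ _ (ENNReal.rpow_ne_top_of_nonneg (by linarith) (by simp))]; rfl
      _ ≤ ENNReal.ofReal (Wc n)⁻¹ * (ENNReal.ofReal B' ^ (1 - s) * ((1 + (C0 n l + 1) * 2) * Dn l s g)) :=
        mul_le_mul_right (mul_le_mul_right hD _) _
      _ = _ := by ring

end Smooth

section Lagr
variable {n : ℕ}

lemma poly_diff {l : ℕ} (hl : 0 < l) {P : Polynomial ℝ} (hP : P.degree < l) (x h : ℝ) :
    ∑ i ∈ Finset.range (l + 1), ac l i * P.eval (x + i * h) = 0 := by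
  let Q := P.comp (Polynomial.C x + Polynomial.C h * Polynomial.X)
  have hQ : Q.natDegree < l := by
    have h1 : (Polynomial.C x + Polynomial.C h * Polynomial.X).natDegree ≤ 1 := by
      refine (Polynomial.natDegree_add_le _ _).trans (max_le (by simp) ?_)
      exact (Polynomial.natDegree_C_mul_le _ _).trans Polynomial.natDegree_X_le
    have h2 : P.natDegree < l := by
      by_cases hne : P = 0
      · rw [hne]; simpa using hl
      · exact (Polynomial.natDegree_lt_iff_degree_lt hne).2 hP
    calc Q.natDegree ≤ P.natDegree * _ := Polynomial.natDegree_comp_le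
      _ ≤ P.natDegree * 1 := Nat.mul_le_mul_left _ h1
      _ < l := by omega
  have := congrFun (Polynomial.fwdDiff_iter_eq_zero_of_degree_lt hQ) 0
  rw [fwdDiff_iter_eq_sum_shift] at this
  simp only [Pi.zero_apply, zsmul_eq_mul, nsmul_eq_mul, zero_add, mul_one] at this
  rw [← this]
  refine Finset.sum_congr rfl fun i hi => ?_
  have hi' : i ≤ l := by have := Finset.mem_range.1 hi; omega
  have e : (-1 : ℝ) ^ (l + i) = (-1) ^ (l - i) := by
    rw [show l + i = (l - i) + 2 * i by omega, pow_add, pow_mul]; simp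
  simp only [Q, Polynomial.eval_comp, ac, e]
  push_cast
  simp
  rw [mul_comm h]; ring

def nd (l : ℕ) (j : ℕ) : ℝ := (j : ℝ) / l
def LB (l j : ℕ) : Polynomial ℝ := Lagrange.basis (Finset.range l) (nd l) j

lemma nd_inj {l : ℕ} (hl : 0 < l) : Function.Injective (nd l) := by
  intro a b h
  unfold nd at h
  have : (l : ℝ) ≠ 0 := by positivity
  field_simp at h
  exact_mod_cast h

lemma LB_degree {l j : ℕ} (hj : j < l) : (LB l j).degree < l := by
  unfold LB
  rw [Lagrange.degree_basis ((nd_inj (by omega)).injOn) (Finset.mem_range.2 hj), Finset.card_range]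
  exact_mod_cast Nat.sub_lt (by omega) one_pos

lemma LB_eval {l j i : ℕ} (hi : i < l) (hj : j < l) : (LB l j).eval (nd l i) = if i = j then 1 else 0 := by
  split_ifs with h
  · subst h; exact Lagrange.eval_basis_self ((nd_inj (by omega)).injOn) (Finset.mem_range.2 hi)
  · exact Lagrange.eval_basis_of_ne (Ne.symm h) (Finset.mem_range.2 hi)

lemma ac_self (l : ℕ) : ac l l = 1 := by
  unfold ac; rw [← two_mul, pow_mul]; simp

/-- one-dimensional classification -/
lemma class1 {l : ℕ} (hl : 0 < l) {u : ℝ → ℝ} (hu : ContinuousOn u (Set.Icc 0 1))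
    (hd : ∀ x ∈ Set.Icc (0 : ℝ) 1, ∀ y ∈ Set.Icc (0 : ℝ) 1,
      ∑ i ∈ Finset.range (l + 1), ac l i * u (x + (i : ℝ) / l * (y - x)) = 0)
    {x : ℝ} (hx : x ∈ Set.Icc (0 : ℝ) 1) :
    u x = ∑ j ∈ Finset.range l, u (nd l j) * (LB l j).eval x := by
  have hl' : (0 : ℝ) < l := by exact_mod_cast hl
  let P : Polynomial ℝ := Lagrange.interpolate (Finset.range l) (nd l) (fun j => u (nd l j))
  have hP : ∀ x, P.eval x = ∑ j ∈ Finset.range l, u (nd l j) * (LB l j).eval x := by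
    intro x
    simp only [P, Lagrange.interpolate_apply, Polynomial.eval_finsetSum, Polynomial.eval_mul, Polynomial.eval_C]; rfl
  rw [← hP]
  have hPd : P.degree < l := by
    have := Lagrange.degree_interpolate_lt (r := fun j => u (nd l j)) ((nd_inj hl).injOn (s := Finset.range l))
    rwa [Finset.card_range] at this
  have key : ∀ N : ℕ, 0 < N → ∀ a : ℕ, a ≤ l * N → u ((a : ℝ) / (l * N)) = P.eval ((a : ℝ) / (l * N)) := by
    intro N hN
    have hN' : (0 : ℝ) < N := by exact_mod_cast hN
    let v : ℕ → ℝ := fun a => (a : ℝ) / (l * N)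
    have hv : Function.Injective v := by
      intro a b h
      simp only [v] at h
      field_simp at h
      exact_mod_cast h
    have hv01 : ∀ a : ℕ, a ≤ l * N → v a ∈ Set.Icc (0 : ℝ) 1 := by
      intro a ha
      refine ⟨by positivity, ?_⟩
      simp only [v]
      rw [div_le_one (by positivity)]
      exact_mod_cast ha
    let Q : Polynomial ℝ := Lagrange.interpolate (Finset.range l) v (fun j => u (v j))
    have hQd : Q.degree < l := by
      have := Lagrange.degree_interpolate_lt (r := fun j => u (v j)) (hv.injOn (s := Finset.range l))
      rwa [Finset.card_range] at this
    have hrec : ∀ f : ℕ → ℝ, (∑ i ∈ Finset.range (l + 1), ac l i * f i = 0) → f l = -∑ i ∈ Finset.range l, ac l i * f i := by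
      intro f hf
      rw [Finset.sum_range_succ, ac_self] at hf
      linarith
    have hUQ : ∀ a : ℕ, a ≤ l * N → u (v a) = Q.eval (v a) := by
      intro a
      induction a using Nat.strong_induction_on with
      | _ a ih =>
        intro ha
        by_cases hal : a < l
        · exact (Lagrange.eval_interpolate_at_node (r := fun j => u (v j)) (hv.injOn) (Finset.mem_range.2 hal)).symm
        · obtain ⟨b, rfl⟩ := Nat.exists_eq_add_of_le (not_lt.1 hal)
          have e1 := hrec (fun i => u (v (b + i))) (by
            have := hd (v b) (hv01 b (by omega)) (v (l + b)) (hv01 _ ha)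
            rw [← this]
            refine Finset.sum_congr rfl fun i _ => ?_
            congr 2
            simp only [v]; push_cast; field_simp; ring)
          have e2 := hrec (fun i => Q.eval (v (b + i))) (by
            have := poly_diff hl hQd (v b) (1 / (l * N))
            rw [← this]
            refine Finset.sum_congr rfl fun i _ => ?_
            congr 2
            simp only [v]; push_cast; field_simp)
          rw [add_comm l b]
          rw [e1, e2]
          congr 1
          refine Finset.sum_congr rfl fun i hi => ?_
          have := Finset.mem_range.1 hi
          rw [ih (b + i) (by omega) (by omega)]
    have hPQ : P = Q := by
      refine Polynomial.eq_of_degrees_lt_of_eval_index_eq (s := Finset.range l) (v := nd l) ((nd_inj hl).injOn) (by rwa [Finset.card_range]) (by rwa [Finset.card_range]) ?_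
      intro j hj
      have hj' := Finset.mem_range.1 hj
      have e : nd l j = v (j * N) := by simp only [v, nd]; push_cast; field_simp
      have h1 := hUQ (j * N) (Nat.mul_le_mul_right _ hj'.le)
      rw [← e] at h1
      rw [← h1]
      exact Lagrange.eval_interpolate_at_node (r := fun j => u (nd l j)) ((nd_inj hl).injOn) hj
    intro a ha
    rw [hPQ]; exact hUQ a ha
  -- density
  let w : ℕ → ℝ := fun N => (⌊x * ((l : ℝ) * ((N + 1 : ℕ) : ℝ))⌋₊ : ℝ) / ((l : ℝ) * ((N + 1 : ℕ) : ℝ))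
  have hw : Tendsto w atTop (nhds x) := by
    have h1 : Tendsto (fun N : ℕ => (l : ℝ) * ((N + 1 : ℕ) : ℝ)) atTop atTop :=
      Tendsto.const_mul_atTop hl' (tendsto_natCast_atTop_atTop.comp (tendsto_add_atTop_nat 1))
    exact (tendsto_nat_floor_mul_div_atTop hx.1).comp h1
  have hfl : ∀ N : ℕ, ⌊x * ((l : ℝ) * ((N + 1 : ℕ) : ℝ))⌋₊ ≤ l * (N + 1) := by
    intro N
    refine Nat.floor_le_of_le ?_
    push_cast
    have := hx.2
    have h3 : (0 : ℝ) ≤ l * (N + 1) := by positivity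
    nlinarith
  have hw01 : ∀ N, w N ∈ Set.Icc (0 : ℝ) 1 := by
    intro N
    refine ⟨by positivity, ?_⟩
    simp only [w]
    rw [div_le_one (by positivity)]
    exact_mod_cast hfl N
  have hwe : ∀ N, u (w N) = P.eval (w N) := fun N => key (N + 1) (Nat.succ_pos N) _ (hfl N)
  have t1 : Tendsto (fun N => u (w N)) atTop (nhds (u x)) :=
    (hu x hx).tendsto.comp (tendsto_nhdsWithin_iff.2 ⟨hw, Eventually.of_forall hw01⟩)
  have t2 : Tendsto (fun N => P.eval (w N)) atTop (nhds (P.eval x)) :=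
    (P.continuous.tendsto x).comp hw
  simp only [hwe] at t1
  exact tendsto_nhds_unique t1 t2

def Lb (n l : ℕ) (ν : Fin n → Fin l) (x : Rn n) : ℝ := ∏ i, (LB l (ν i)).eval (x i)
def PL (n l : ℕ) (c : (Fin n → Fin l) → ℝ) (x : Rn n) : ℝ := ∑ ν, c ν * Lb n l ν x
def ndv (n l : ℕ) (ν : Fin n → Fin l) : Rn n := fun i => nd l (ν i)

lemma Lb_cont (l : ℕ) (ν : Fin n → Fin l) : Continuous (Lb n l ν) := by
  unfold Lb
  refine continuous_finsetProd _ fun i _ => ?_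
  exact (Polynomial.continuous _).comp (continuous_apply i)

lemma PL_cont (l : ℕ) (c : (Fin n → Fin l) → ℝ) : Continuous (PL n l c) := by
  unfold PL
  exact continuous_finsetSum _ fun ν _ => continuous_const.mul (Lb_cont l ν)

lemma nd_mem {l j : ℕ} (hj : j < l) : 0 ≤ nd l j ∧ nd l j ≤ 1 := by
  have : (0 : ℝ) < l := by exact_mod_cast (show 0 < l by omega)
  refine ⟨by unfold nd; positivity, ?_⟩
  unfold nd
  rw [div_le_one this]; exact_mod_cast hj.le

lemma ndv_mem {l : ℕ} (ν : Fin n → Fin l) : ndv n l ν ∈ UQ n := by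
  rw [mem_UQ]; exact fun i => nd_mem (ν i).2

lemma Lb_node {l : ℕ} (ν μ : Fin n → Fin l) : Lb n l ν (ndv n l μ) = if μ = ν then 1 else 0 := by
  unfold Lb ndv
  simp only [LB_eval (μ _).2 (ν _).2]
  split_ifs with h
  · subst h; simp
  · obtain ⟨i, hi⟩ := Function.ne_iff.1 h
    refine Finset.prod_eq_zero (Finset.mem_univ i) ?_
    rw [if_neg]; intro hc; exact hi (Fin.ext hc)

lemma PL_node {l : ℕ} (c : (Fin n → Fin l) → ℝ) (μ : Fin n → Fin l) : PL n l c (ndv n l μ) = c μ := by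
  unfold PL
  simp only [Lb_node]
  simp

lemma Lb_indep (l : ℕ) (c : (Fin n → Fin l) → ℝ) (h : ∀ x ∈ UQ n, ∑ ν, c ν * Lb n l ν x = 0) : c = 0 := by
  funext μ
  rw [← PL_node c μ]; exact h _ (ndv_mem μ)

lemma PL_line {l : ℕ} (hl : 0 < l) (c : (Fin n → Fin l) → ℝ) (x : Rn n) (a : Fin n) :
    ∃ Q : Polynomial ℝ, Q.degree < l ∧ ∀ τ, PL n l c (Function.update x a τ) = Q.eval τ := by
  refine ⟨∑ ν : Fin n → Fin l, Polynomial.C (c ν * ∏ i ∈ Finset.univ.erase a, (LB l (ν i)).eval (x i)) * LB l (ν a), ?_, ?_⟩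
  · rw [← Polynomial.mem_degreeLT]
    refine Submodule.sum_mem _ fun ν _ => ?_
    rw [← Polynomial.smul_eq_C_mul]
    exact Submodule.smul_mem _ _ (Polynomial.mem_degreeLT.2 (LB_degree (ν a).2))
  · intro τ
    unfold PL Lb
    rw [Polynomial.eval_finsetSum]
    refine Finset.sum_congr rfl fun ν _ => ?_
    rw [← Finset.mul_prod_erase _ _ (Finset.mem_univ a), Polynomial.eval_mul, Polynomial.eval_C, Function.update_self]
    rw [Finset.prod_congr rfl (g := fun i => (LB l (ν i)).eval (x i))]
    · ring
    · intro i hi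
      rw [Function.update_of_ne (Finset.ne_of_mem_erase hi)]

/-- classification of continuous functions with vanishing differences -/
lemma classN {l : ℕ} (hl : 0 < l) {F : Rn n → ℝ} (hF : ContinuousOn F (UQ n))
    (hd : ∀ x ∈ UQ n, ∀ y ∈ UQ n, Dl l F x y = 0) :
    ∀ x ∈ UQ n, F x = PL n l (fun ν => F (ndv n l ν)) x := by
  set c : (Fin n → Fin l) → ℝ := fun ν => F (ndv n l ν) with hc
  let G : Rn n → ℝ := fun x => F x - PL n l c x
  have hG : ContinuousOn G (UQ n) := hF.sub (PL_cont l c).continuousOn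
  have hup : ∀ x ∈ UQ n, ∀ a : Fin n, ∀ τ ∈ Set.Icc (0 : ℝ) 1, Function.update x a τ ∈ UQ n := by
    intro x hx a τ hτ
    rw [mem_UQ] at *
    intro i
    by_cases hi : i = a
    · subst hi; rw [Function.update_self]; exact hτ
    · rw [Function.update_of_ne hi]; exact hx i
  have hline : ∀ x ∈ UQ n, ∀ a : Fin n, G x = ∑ j ∈ Finset.range l, G (Function.update x a (nd l j)) * (LB l j).eval (x a) := by
    intro x hx a
    have := class1 hl (u := fun τ => G (Function.update x a τ)) (x := x a) ?_ ?_ (mem_UQ.1 hx a)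
    · simpa using this
    · refine hG.comp (Continuous.continuousOn ?_) (fun τ hτ => hup x hx a τ hτ)
      exact continuous_const.update a continuous_id
    · intro σ hσ τ hτ
      obtain ⟨Q, hQ, hQe⟩ := PL_line hl c x a
      have h1 := hd _ (hup x hx a σ hσ) _ (hup x hx a τ hτ)
      have h2 := poly_diff hl hQ σ ((τ - σ) / l)
      rw [Dl_eq] at h1
      simp only [G, mul_sub, Finset.sum_sub_distrib, hQe]
      rw [← sub_zero (0 : ℝ)]
      nth_rewrite 1 [← h1]
      rw [← h2]
      congr 1
      · refine Finset.sum_congr rfl fun i _ => ?_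
        congr 2
        ext b
        rw [mid_apply]
        by_cases hb : b = a
        · subst hb; simp only [Function.update_self]; ring
        · simp only [Function.update_of_ne hb]; ring
      · refine Finset.sum_congr rfl fun i _ => ?_
        congr 2
        ring
  have hz : ∀ S : Finset (Fin n), ∀ x ∈ UQ n, (∀ i ∉ S, ∃ j < l, x i = nd l j) → G x = 0 := by
    intro S
    induction S using Finset.induction_on with
    | empty =>
      intro x _ h
      choose j hj hxj using fun i => h i (by simp)
      have : x = ndv n l (fun i => ⟨j i, hj i⟩) := by
        ext i; rw [hxj i]; rfl
      rw [this]
      simp only [G, PL_node, hc, sub_self]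
    | insert a S ha ih =>
      intro x hx h
      rw [hline x hx a]
      refine Finset.sum_eq_zero fun j hj => ?_
      have hj' := Finset.mem_range.1 hj
      rw [ih _ (hup x hx a _ (nd_mem hj')), zero_mul]
      intro i hi
      by_cases hia : i = a
      · subst hia; exact ⟨j, hj', by rw [Function.update_self]⟩
      · rw [Function.update_of_ne hia]; exact h i (by simp [hia, hi])
  intro x hx
  exact sub_eq_zero.1 (hz Finset.univ x hx (by simp))

end Lagr

section WhitCore
variable {n : ℕ}

def VP (n l : ℕ) : Set ((Fin n → Fin l) → ℝ) := {c | ∀ x ∈ UQ n, ∀ y ∈ UQ n, Dl l (PL n l c) x y = 0}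

lemma PL_sub (l : ℕ) (c d : (Fin n → Fin l) → ℝ) (x : Rn n) : PL n l (c - d) x = PL n l c x - PL n l d x := by
  simp [PL, sub_mul]

lemma PL_add (l : ℕ) (c d : (Fin n → Fin l) → ℝ) (x : Rn n) : PL n l (c + d) x = PL n l c x + PL n l d x := by
  simp [PL, add_mul, Finset.sum_add_distrib]

lemma PL_smul (l : ℕ) (a : ℝ) (d : (Fin n → Fin l) → ℝ) (x : Rn n) : PL n l (a • d) x = a * PL n l d x := by
  simp [PL, Finset.mul_sum, mul_assoc]

lemma VP_add {l : ℕ} {c d : (Fin n → Fin l) → ℝ} (hc : c ∈ VP n l) (hd : d ∈ VP n l) : c + d ∈ VP n l := by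
  intro x hx y hy
  have : PL n l (c + d) = fun z => PL n l c z + PL n l d z := funext (PL_add l c d)
  rw [this, Dl_add, hc x hx y hy, hd x hx y hy, add_zero]

lemma VP_smul {l : ℕ} (a : ℝ) {d : (Fin n → Fin l) → ℝ} (hd : d ∈ VP n l) : a • d ∈ VP n l := by
  intro x hx y hy
  have : PL n l (a • d) = fun z => a * PL n l d z := funext (PL_smul l a d)
  rw [this, Dl_smul, hd x hx y hy, mul_zero]

lemma VP_zero (l : ℕ) : (0 : (Fin n → Fin l) → ℝ) ∈ VP n l := by
  intro x _ y _
  have : PL n l (0 : (Fin n → Fin l) → ℝ) = fun z => 0 := by funext z; simp [PL]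
  rw [this, Dl_eq]; simp

lemma VP_closed (l : ℕ) : IsClosed (VP n l) := by
  have : VP n l = ⋂ x ∈ UQ n, ⋂ y ∈ UQ n, {c | Dl l (PL n l c) x y = 0} := by
    ext c; simp [VP]
  rw [this]
  refine isClosed_biInter fun x _ => isClosed_biInter fun y _ => isClosed_eq ?_ continuous_const
  simp only [Dl_eq, PL]
  fun_prop

lemma PL_bound (n l : ℕ) : ∃ S : ℝ, 0 ≤ S ∧ ∀ c, ∀ x ∈ UQ n, |PL n l c x| ≤ S * ‖c‖ := by
  have : ∀ ν : Fin n → Fin l, ∃ S : ℝ, ∀ x ∈ UQ n, |Lb n l ν x| ≤ S := by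
    intro ν
    obtain ⟨S, hS⟩ := UQ_compact.exists_bound_of_continuousOn (Lb_cont l ν).continuousOn
    exact ⟨S, hS⟩
  choose S hS using this
  refine ⟨∑ ν, |S ν|, by positivity, fun c x hx => ?_⟩
  unfold PL
  refine (Finset.abs_sum_le_sum_abs _ _).trans ?_
  rw [Finset.sum_mul]
  refine Finset.sum_le_sum fun ν _ => ?_
  rw [abs_mul, mul_comm]
  exact mul_le_mul ((hS ν x hx).trans (le_abs_self _)) (norm_le_pi_norm c ν) (abs_nonneg _) (abs_nonneg _)

lemma En_eq_eLp {s : ℝ} (h0 : 0 < s) (g : Rn n → ℝ) :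
    eLpNorm g (ENNReal.ofReal s) (volume.restrict (UQ n)) = En s g ^ (1 / s) := by
  rw [eLpNorm_eq_lintegral_rpow_enorm_toReal (by simpa using h0) (by simp), ENNReal.toReal_ofReal h0.le]; rfl

lemma En_congr {s : ℝ} {f g : Rn n → ℝ} (h : ∀ x ∈ UQ n, f x = g x) : En s f = En s g := by
  unfold En
  exact setLIntegral_congr_fun UQ_meas fun x hx => by simp only [h x hx]

lemma Dn_congr {l : ℕ} (hl : 0 < l) {s : ℝ} {f g : Rn n → ℝ} (h : ∀ x ∈ UQ n, ∀ y ∈ UQ n, Dl l f x y = Dl l g x y) : Dn l s f = Dn l s g := by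
  unfold Dn
  exact setLIntegral_congr_fun UQ_meas fun x hx => setLIntegral_congr_fun UQ_meas fun y hy => by simp only [h x hx y hy]

lemma Dl_congr {l : ℕ} (hl : 0 < l) {f g : Rn n → ℝ} (h : ∀ x ∈ UQ n, f x = g x) {x y : Rn n} (hx : x ∈ UQ n) (hy : y ∈ UQ n) :
    Dl l f x y = Dl l g x y := by
  rw [Dl_eq, Dl_eq]
  refine Finset.sum_congr rfl fun i hi => ?_
  rw [h _ (mid_mem hl (by have := Finset.mem_range.1 hi; omega) hx hy)]

lemma Dn_eq_prod (l : ℕ) (s : ℝ) {g : Rn n → ℝ} (hg : Measurable g) :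
    Dn l s g = ∫⁻ q, ‖Dl l g q.1 q.2‖ₑ ^ s ∂((volume.restrict (UQ n)).prod (volume.restrict (UQ n))) := by
  rw [lintegral_prod _ ((Dl_measurable l hg).enorm.pow_const s).aemeasurable]; rfl

lemma Dn_zero {l : ℕ} {s : ℝ} (h0 : 0 < s) {f : Rn n → ℝ} (hf : Continuous f) (h : Dn l s f = 0) :
    ∀ x ∈ UQ n, ∀ y ∈ UQ n, Dl l f x y = 0 := by
  have hc : Continuous (fun q : Rn n × Rn n => Dl l f q.1 q.2) := by
    simp only [Dl_eq, mid]; fun_prop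
  rw [Dn_eq_prod l s hf.measurable, lintegral_eq_zero_iff ((Dl_measurable l hf.measurable).enorm.pow_const s),
    Measure.prod_restrict] at h
  have h2 : (fun q : Rn n × Rn n => Dl l f q.1 q.2) =ᵐ[(volume.prod volume).restrict (UQ n ×ˢ UQ n)] fun _ => 0 := by
    filter_upwards [h] with q hq
    have := (ENNReal.rpow_eq_zero_iff_of_pos h0).1 hq
    simpa using this
  have h3 := Measure.eqOn_of_ae_eq h2 hc.continuousOn continuousOn_const (by
    rw [interior_prod_eq, closure_prod_eq]
    exact Set.prod_mono UQ_regular UQ_regular)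
  intro x hx y hy
  exact h3 (Set.mk_mem_prod hx hy)

lemma AA (B L : ℝ) (f : ℕ → Rn n → ℝ) (hf : ∀ j, Continuous (f j)) (hB : ∀ j, ∀ x ∈ UQ n, |f j x| ≤ B)
    (hL : ∀ j x x', |f j x' - f j x| ≤ L * ‖x' - x‖) :
    ∃ F : Rn n → ℝ, Continuous F ∧ ∃ φ : ℕ → ℕ, StrictMono φ ∧ ∃ e : ℕ → ℝ, Tendsto e atTop (nhds 0) ∧
      ∀ j, ∀ x ∈ UQ n, |f (φ j) x - F x| ≤ e j := by
  haveI : CompactSpace (UQ n) := isCompact_iff_compactSpace.1 UQ_compact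
  let f' : ℕ → BoundedContinuousFunction (UQ n) ℝ := fun j =>
    BoundedContinuousFunction.mkOfCompact ⟨fun x => f j x, (hf j).comp continuous_subtype_val⟩
  have hcomp : IsCompact (closure (Set.range f')) := by
    refine BoundedContinuousFunction.arzela_ascoli (Set.Icc (-B) B) isCompact_Icc _ ?_ ?_
    · rintro g x ⟨j, rfl⟩
      exact abs_le.1 (hB j x x.2)
    · have h2 : UniformEquicontinuous ((↑) : Set.range f' → (UQ n) → ℝ) := by
        refine LipschitzWith.uniformEquicontinuous _ L.toNNReal ?_
        rintro ⟨_, ⟨j, rfl⟩⟩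
        refine LipschitzWith.of_dist_le_mul fun x y => ?_
        have h3 := hL j y x
        have h4 : L ≤ (L.toNNReal : ℝ) := Real.le_coe_toNNReal L
        rw [Real.dist_eq, Subtype.dist_eq, dist_eq_norm]
        exact h3.trans (mul_le_mul_of_nonneg_right h4 (norm_nonneg _))
      exact h2.equicontinuous
  obtain ⟨F', -, φ, hφ, hlim⟩ := hcomp.tendsto_subseq (fun j => subset_closure (Set.mem_range_self j) : ∀ j, f' j ∈ closure (Set.range f'))
  obtain ⟨g, hg⟩ := ContinuousMap.exists_restrict_eq UQ_compact.isClosed F'.toContinuousMap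
  refine ⟨g, g.continuous, φ, hφ, fun j => dist (f' (φ j)) F', ?_, ?_⟩
  · have := tendsto_iff_dist_tendsto_zero.1 hlim
    exact this
  · intro j x hx
    have h5 : g x = F' ⟨x, hx⟩ := by
      have := DFunLike.congr_fun hg ⟨x, hx⟩
      simpa using this
    rw [h5, ← Real.dist_eq]
    exact BoundedContinuousFunction.dist_coe_le_dist (f := f' (φ j)) (g := F') ⟨x, hx⟩
end WhitCore

section WhitS
variable {n : ℕ}

lemma exists_scale {s : ℝ} (h0 : 0 < s) {J : ℝ≥0∞} (hJ0 : J ≠ 0) (hJ : J ≠ ∞) :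
    ∃ c : ℝ, 0 < c ∧ ‖c‖ₑ ^ s = J⁻¹ := by
  refine ⟨(J⁻¹ ^ (1 / s)).toReal, ?_, ?_⟩
  · refine ENNReal.toReal_pos ?_ ?_
    · rw [Ne, ENNReal.rpow_eq_zero_iff_of_pos (by positivity)]; simpa using hJ
    · exact ENNReal.rpow_ne_top_of_nonneg (by positivity) (by simpa using hJ0)
  · rw [Real.enorm_eq_ofReal ENNReal.toReal_nonneg, ENNReal.ofReal_toReal
      (ENNReal.rpow_ne_top_of_nonneg (by positivity) (by simpa using hJ0)), ← ENNReal.rpow_mul]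
    rw [one_div, inv_mul_cancel₀ h0.ne', ENNReal.rpow_one]

/-- difference with an element of `VP` does not change `Dn` -/
lemma Dn_sub_VP {l : ℕ} (hl : 0 < l) {s : ℝ} (g : Rn n → ℝ) {c : (Fin n → Fin l) → ℝ} (hc : c ∈ VP n l) :
    Dn l s (fun x => g x - PL n l c x) = Dn l s g := by
  refine Dn_congr hl fun x hx y hy => ?_
  rw [Dl_sub, hc x hx y hy, sub_zero]

lemma mem_VP_of {l : ℕ} (hl : 0 < l) {F : Rn n → ℝ} (hF : Continuous F)
    (hd : ∀ x ∈ UQ n, ∀ y ∈ UQ n, Dl l F x y = 0) : ∃ c ∈ VP n l, ∀ x ∈ UQ n, F x = PL n l c x := by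
  have h := classN hl hF.continuousOn hd
  refine ⟨fun ν => F (ndv n l ν), ?_, h⟩
  intro x hx y hy
  rw [← Dl_congr hl h hx hy]; exact hd x hx y hy

lemma Dn_le_of {l : ℕ} {s : ℝ} (h0 : 0 < s) (h1 : s ≤ 1) {f g : Rn n → ℝ} (hf : Measurable f) (hg : Measurable g) :
    Dn l s f ≤ Dn l s g + (C0 n l + 1) * En s (fun x => f x - g x) := by
  have h := Dn_add h0.le h1 l (f := g) (g := fun x => f x - g x) hg
  have e : (fun x => g x + (f x - g x)) = f := by funext x; ring
  rw [e] at h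
  exact h.trans (add_le_add_right (Dn_le h0 h1 (hf.sub hg)) _)

lemma whit_core {l : ℕ} (hl : 0 < l) {s : ℝ} (h0 : 0 < s) (h1 : s ≤ 1) :
    ∃ η : ℝ≥0∞, 0 < η ∧ ∀ g : Rn n → ℝ, Measurable g → En s g ≤ 1 →
      (∀ c ∈ VP n l, 1 / 2 < En s (fun x => g x - PL n l c x)) → η ≤ Dn l s g := by
  by_contra hcon
  push Not at hcon
  obtain ⟨B, L, K, hK, hB, hL, hreg⟩ := regul n l h0 h1
  have hpos : ∀ j : ℕ, (0 : ℝ≥0∞) < ((j : ℝ≥0∞) + 1)⁻¹ := fun j => by simp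
  choose g hgm hgE hgV hgD using fun j : ℕ => hcon _ (hpos j)
  choose f hfc hfB hfL hfE using fun j => hreg (g j) (hgm j) (hgE j)
  obtain ⟨F, hFc, φ, hφ, e, he, hfe⟩ := AA B L f hfc hfB hfL
  have hDlim : Tendsto (fun j => Dn l s (g j)) atTop (nhds 0) := by
    refine tendsto_of_tendsto_of_tendsto_of_le_of_le tendsto_const_nhds ?_ (fun j => zero_le) (fun j => (hgD j).le)
    have := ENNReal.tendsto_inv_nat_nhds_zero.comp (tendsto_add_atTop_nat 1)
    refine this.congr fun j => by simp
  have hD2 : Tendsto (fun j => Dn l s (g (φ j))) atTop (nhds 0) := hDlim.comp hφ.tendsto_atTop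
  have hw : Tendsto (fun j => 2 * Dn l s (g (φ j)) + (K * Dn l s (g (φ j))) ^ s + ENNReal.ofReal (e j) ^ s) atTop (nhds 0) := by
    have a1 : Tendsto (fun j => 2 * Dn l s (g (φ j))) atTop (nhds 0) := by
      simpa using ENNReal.Tendsto.const_mul hD2 (Or.inr (by simp : (2 : ℝ≥0∞) ≠ ∞))
    have a2 : Tendsto (fun j => (K * Dn l s (g (φ j))) ^ s) atTop (nhds 0) := by
      have := (ENNReal.continuous_rpow_const (y := s)).tendsto 0
      have h3 : Tendsto (fun j => K * Dn l s (g (φ j))) atTop (nhds 0) := by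
        simpa using ENNReal.Tendsto.const_mul hD2 (Or.inr hK.ne)
      have := this.comp h3
      simpa [h0, Function.comp_def] using this
    have a3 : Tendsto (fun j => ENNReal.ofReal (e j) ^ s) atTop (nhds 0) := by
      have := (ENNReal.continuous_rpow_const (y := s)).tendsto 0
      have h3 : Tendsto (fun j => ENNReal.ofReal (e j)) atTop (nhds 0) := by
        simpa [Function.comp_def] using (ENNReal.continuous_ofReal.tendsto 0).comp he
      have := this.comp h3
      simpa [h0, Function.comp_def] using this
    simpa using (a1.add a2).add a3
  have hE : ∀ j, En s (fun x => g (φ j) x - F x) ≤ 2 * Dn l s (g (φ j)) + (K * Dn l s (g (φ j))) ^ s + ENNReal.ofReal (e j) ^ s := by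
    intro j
    refine (En_tri h0.le h1 (g := f (φ j)) (hgm _) (hfc _).measurable).trans (add_le_add (hfE _) ?_)
    refine En_le_const h0.le fun x hx => ?_
    rw [← ofReal_norm]
    exact ENNReal.ofReal_le_ofReal (hfe j x hx)
  have hEl : Tendsto (fun j => En s (fun x => g (φ j) x - F x)) atTop (nhds 0) :=
    tendsto_of_tendsto_of_tendsto_of_le_of_le tendsto_const_nhds hw (fun j => zero_le) hE
  have hDF : Dn l s F = 0 := by
    have hle : ∀ j, Dn l s F ≤ Dn l s (g (φ j)) + (C0 n l + 1) * En s (fun x => g (φ j) x - F x) := by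
      intro j
      have := Dn_le_of (l := l) h0 h1 hFc.measurable (hgm (φ j))
      rwa [En_comm] at this
    have hlim : Tendsto (fun j => Dn l s (g (φ j)) + (C0 n l + 1) * En s (fun x => g (φ j) x - F x)) atTop (nhds 0) := by
      have : Tendsto (fun j => (C0 n l + 1) * En s (fun x => g (φ j) x - F x)) atTop (nhds 0) := by
        simpa using ENNReal.Tendsto.const_mul hEl (Or.inr (by simpa using (C0_lt n l).ne : C0 n l + 1 ≠ ∞))
      simpa using hD2.add this
    exact le_antisymm (ge_of_tendsto' hlim hle) zero_le
  obtain ⟨c, hc, hFc2⟩ := mem_VP_of hl hFc (Dn_zero h0 hFc hDF)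
  have : ∀ᶠ j in atTop, En s (fun x => g (φ j) x - F x) < 1 / 2 := hEl.eventually_lt_const (by simp)
  obtain ⟨j, hj⟩ := this.exists
  have h2 := hgV (φ j) c hc
  have h3 : En s (fun x => g (φ j) x - F x) = En s (fun x => g (φ j) x - PL n l c x) :=
    En_congr fun x hx => by rw [hFc2 x hx]
  rw [h3] at hj
  exact absurd hj (not_lt.2 h2.le)

lemma whit_zero {l : ℕ} (hl : 0 < l) {s : ℝ} (h0 : 0 < s) (h1 : s ≤ 1) {g : Rn n → ℝ} (hg : Measurable g)
    (hE : En s g ≠ ∞) (hD : Dn l s g = 0) : ∃ c ∈ VP n l, En s (fun x => g x - PL n l c x) = 0 := by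
  by_cases hE0 : En s g = 0
  · refine ⟨0, VP_zero l, ?_⟩
    rw [← hE0]; refine En_congr fun x _ => by simp [PL]
  obtain ⟨a, ha, has⟩ := exists_scale h0 hE0 hE
  obtain ⟨B, L, K, hK, hB, hL, hreg⟩ := regul n l h0 h1
  obtain ⟨f, hfc, -, -, hf⟩ := hreg (fun x => a * g x) (hg.const_mul a) (by
    rw [En_smul h0.le, has, ENNReal.inv_mul_cancel hE0 hE])
  rw [Dn_smul h0.le, hD] at hf
  simp only [mul_zero, ENNReal.zero_rpow_of_pos h0, add_zero, nonpos_iff_eq_zero] at hf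
  have hDf : Dn l s f = 0 := by
    have := Dn_le_of (l := l) h0 h1 hfc.measurable (hg.const_mul a)
    rw [En_comm, hf, Dn_smul h0.le, hD] at this
    simpa using this
  obtain ⟨c, hc, hfc2⟩ := mem_VP_of hl hfc (Dn_zero h0 hfc hDf)
  refine ⟨a⁻¹ • c, VP_smul _ hc, ?_⟩
  have h5 : En s (fun x => a * (g x - PL n l (a⁻¹ • c) x)) = 0 := by
    rw [← hf]
    refine En_congr fun x hx => ?_
    rw [PL_smul, hfc2 x hx]; field_simp
  rw [En_smul h0.le, has] at h5
  rcases mul_eq_zero.1 h5 with h | h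
  · exact absurd h (by simpa using hE)
  · exact h

lemma whit_s {l : ℕ} (hl : 0 < l) {s : ℝ} (h0 : 0 < s) (h1 : s ≤ 1) :
    ∃ C : ℝ≥0∞, C < ∞ ∧ ∀ g : Rn n → ℝ, Measurable g → En s g ≠ ∞ →
      ∃ c ∈ VP n l, En s (fun x => g x - PL n l c x) ≤ C * Dn l s g := by
  obtain ⟨η, hη, hcore⟩ := whit_core (n := n) hl h0 h1
  refine ⟨η⁻¹ + 1, by simpa using hη, fun g hg hE => ?_⟩
  by_cases hD : Dn l s g = 0
  · obtain ⟨c, hc, h⟩ := whit_zero hl h0 h1 hg hE hD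
    exact ⟨c, hc, by rw [h]; exact zero_le⟩
  by_contra hcon
  push Not at hcon
  set I := ⨅ c ∈ VP n l, En s (fun x => g x - PL n l c x) with hI
  have hID : (η⁻¹ + 1) * Dn l s g ≤ I := le_iInf₂ fun c hc => (hcon c hc).le
  have hI0 : I ≠ 0 := by
    intro h
    rw [h] at hID
    simp [hD] at hID
  have hIt : I ≠ ∞ := by
    have : I ≤ En s (fun x => g x - PL n l 0 x) := iInf₂_le 0 (VP_zero l)
    refine ne_top_of_le_ne_top hE (this.trans (le_of_eq (En_congr fun x _ => by simp [PL])))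
  have hlt : I < (3 / 2) * I := by
    have h32 : (1 : ℝ≥0∞) < 3 / 2 := by
      rw [ENNReal.lt_div_iff_mul_lt (by simp) (by simp)]; norm_num
    calc I = 1 * I := (one_mul I).symm
      _ < _ := ENNReal.mul_lt_mul_left hI0 hIt h32
  obtain ⟨c, hc, hJ⟩ : ∃ c ∈ VP n l, En s (fun x => g x - PL n l c x) < (3 / 2) * I := by
    by_contra h
    push Not at h
    exact absurd (le_iInf₂ h) (not_le.2 hlt)
  set J := En s (fun x => g x - PL n l c x) with hJd
  have hIJ : I ≤ J := iInf₂_le c hc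
  have hJ0 : J ≠ 0 := fun h => hI0 (by simpa [h] using hIJ)
  have hJt : J ≠ ∞ := hJ.ne_top
  obtain ⟨a, ha, has⟩ := exists_scale h0 hJ0 hJt
  have hm : Measurable (fun x => g x - PL n l c x) := hg.sub (PL_cont l c).measurable
  have key := hcore (fun x => a * (g x - PL n l c x)) (hm.const_mul a) (by
    rw [En_smul h0.le, has, ← hJd, ENNReal.inv_mul_cancel hJ0 hJt]) (by
    intro d hd
    have e1 : En s (fun x => a * (g x - PL n l c x) - PL n l d x)
        = En s (fun x => a * (g x - PL n l (c + a⁻¹ • d) x)) := by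
      refine En_congr fun x hx => ?_
      rw [PL_add, PL_smul]; field_simp; ring
    rw [e1, En_smul h0.le, has]
    have h6 : I ≤ En s (fun x => g x - PL n l (c + a⁻¹ • d) x) := iInf₂_le _ (VP_add hc (VP_smul _ hd))
    refine lt_of_lt_of_le ?_ (mul_le_mul_right h6 J⁻¹)
    rw [mul_comm, ← div_eq_mul_inv, ENNReal.lt_div_iff_mul_lt (Or.inl hJ0) (Or.inl hJt)]
    calc 1 / 2 * J ≤ 1 / 2 * (3 / 2 * I) := mul_le_mul_right hJ.le _
      _ = (3 / 4) * I := by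
        rw [← mul_assoc]; congr 1
        rw [← ENNReal.toReal_eq_toReal_iff' (by finiteness) (by finiteness)]
        simp; norm_num
      _ < 1 * I := by
        refine ENNReal.mul_lt_mul_left hI0 hIt ?_
        rw [ENNReal.div_lt_iff (by simp) (by simp)]; norm_num
      _ = I := one_mul I)
  rw [Dn_smul h0.le, has, Dn_sub_VP hl g hc] at key
  have h7 : J ≤ η⁻¹ * Dn l s g := by
    have h8 : η * J ≤ Dn l s g := by
      calc η * J ≤ (J⁻¹ * Dn l s g) * J := mul_le_mul_left key _
        _ = Dn l s g := by rw [mul_right_comm, ENNReal.inv_mul_cancel hJ0 hJt, one_mul]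
    have hηt : η ≠ ∞ := by
      intro h
      rw [h, ENNReal.top_mul hJ0, top_le_iff] at h8
      have := hID
      rw [h8, ENNReal.mul_top (by simp), top_le_iff] at this
      exact hIt this
    rw [mul_comm, ← div_eq_mul_inv, ENNReal.le_div_iff_mul_le (Or.inl hη.ne') (Or.inl hηt), mul_comm]; exact h8
  have h9 := hcon c hc
  have h10 : (η⁻¹ + 1) * Dn l s g ≤ η⁻¹ * Dn l s g := h9.le.trans h7
  exact absurd (h9.trans_le h7) (not_lt.2 (mul_le_mul_left le_self_add _))
end WhitS

section WhitR
variable {n : ℕ}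

lemma lpNormE_const_prob {α : Type*} [MeasurableSpace α] {μ : Measure α} [IsProbabilityMeasure μ] {p : ℝ≥0∞}
    (hp : 0 < p) (c : ℝ≥0∞) : lpNormE p μ (fun _ => c) = c := by
  unfold lpNormE
  split_ifs with h
  · exact essSup_const _ (IsProbabilityMeasure.ne_zero μ)
  · have := toReal_pos_of hp h
    simp [this.ne']

lemma slice_norm {α β : Type*} [MeasurableSpace α] [MeasurableSpace β] {μ : Measure α} {ν : Measure β}
    [SFinite μ] [SFinite ν] {r : ℝ≥0∞} (hr : 0 < r) {H : α × β → ℝ} (hH : Measurable H) :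
    lpNormE r μ (fun x => eLpNorm (fun y => H (x, y)) r ν) ≤ eLpNorm H r (μ.prod ν) := by
  rw [eLpNorm_eq_lpNormE hr]
  by_cases h : r = ∞
  · subst h
    simp only [lpNormE, if_true]
    refine essSup_le_of_ae_le _ ?_
    have h1 := ENNReal.ae_le_essSup (μ := μ.prod ν) (fun q => ‖H q‖ₑ)
    have h2 := Measure.ae_ae_of_ae_prod h1
    filter_upwards [h2] with x hx
    rw [eLpNorm_exponent_top]
    exact essSup_le_of_ae_le _ hx
  · have hr' := toReal_pos_of hr h
    simp only [lpNormE, if_neg h]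
    refine ENNReal.rpow_le_rpow (le_of_eq ?_) (by positivity)
    rw [lintegral_prod _ (hH.enorm.pow_const _).aemeasurable]
    refine lintegral_congr fun x => ?_
    rw [eLpNorm_eq_lintegral_rpow_enorm_toReal hr.ne' h, rpow_self_one_div hr']

lemma whit_unit {l : ℕ} (hl : 0 < l) {r : ℝ≥0∞} (hr : 0 < r) :
    ∃ C : ℝ≥0∞, C < ∞ ∧ ∀ g : Rn n → ℝ, Measurable g → eLpNorm g r (volume.restrict (UQ n)) < ∞ →
      ∃ c ∈ VP n l, eLpNorm (fun x => g x - PL n l c x) r (volume.restrict (UQ n)) ≤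
        C * eLpNorm (fun q : Rn n × Rn n => Dl l g q.1 q.2) r
          ((volume.restrict (UQ n)).prod (volume.restrict (UQ n))) := by
  set s := uu r with hs
  have h0 : 0 < s := uu_pos hr
  have h1 : s ≤ 1 := uu_le_one
  obtain ⟨C, hC, hw⟩ := whit_s (n := n) hl h0 h1
  set C1 := C0 n l * C with hC1
  refine ⟨(1 + C1) ^ (1 / s), ENNReal.rpow_lt_top_of_nonneg (by positivity) (by
    have := C0_lt n l; finiteness), fun g hg hgr => ?_⟩
  set μ := volume.restrict (UQ n) with hμ
  set R := eLpNorm (fun q : Rn n × Rn n => Dl l g q.1 q.2) r (μ.prod μ) with hR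
  have hEn : En s g ≠ ∞ := by
    have h2 := eLpNorm_le_eLpNorm_of_exponent_le (μ := μ) (uu_le (p := r)) hg.aestronglyMeasurable
    rw [← hs, En_eq_eLp h0] at h2
    intro h
    rw [h, ENNReal.top_rpow_of_pos (by positivity)] at h2
    exact absurd (h2.trans_lt hgr) (by simp)
  obtain ⟨c, hc, hE⟩ := hw g hg hEn
  refine ⟨c, hc, ?_⟩
  have hDR : Dn l s g ≤ R ^ s := by
    have h2 := eLpNorm_le_eLpNorm_of_exponent_le (μ := μ.prod μ) (uu_le (p := r)) (Dl_measurable l hg).aestronglyMeasurable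
    rw [← hs, eLpNorm_eq_lintegral_rpow_enorm_toReal (by simpa using h0) (by simp), ENNReal.toReal_ofReal h0.le,
      ← Dn_eq_prod l s hg] at h2
    have := ENNReal.rpow_le_rpow h2 h0.le
    rwa [rpow_self_one_div h0] at this
  let G : Rn n → ℝ≥0∞ := fun x => (∫⁻ y in UQ n, ‖Dl l g x y‖ₑ ^ s) ^ (1 / s)
  have hGm : Measurable G := (Dl_inner_measurable l hg s).pow_const _
  have hGR : lpNormE r μ G ≤ R := by
    refine le_trans (lpNormE_mono fun x => ?_) (slice_norm hr (Dl_measurable l hg))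
    have h3 : Measurable (fun y => Dl l g x y) := (Dl_measurable l hg).comp measurable_prodMk_left
    have h2 := eLpNorm_le_eLpNorm_of_exponent_le (μ := μ) (uu_le (p := r)) h3.aestronglyMeasurable
    rwa [← hs, eLpNorm_eq_lintegral_rpow_enorm_toReal (by simpa using h0) (by simp), ENNReal.toReal_ofReal h0.le] at h2
  let F : ℕ → Rn n → ℝ≥0∞ := fun j => if j = 0 then G else if j = 1 then fun _ => C1 ^ (1 / s) * R else fun _ => 0
  have hvm : Measurable (fun x => g x - PL n l c x) := hg.sub (PL_cont l c).measurable
  have key := lpNormE_le_tsum' (μ := μ) h0 (uu_le (p := r)) (fun x => ‖g x - PL n l c x‖ₑ) F (by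
    intro j; simp only [F]; split_ifs
    · exact hGm.aemeasurable
    · exact aemeasurable_const
    · exact aemeasurable_const) (by
    refine (ae_restrict_iff' UQ_meas).2 (Eventually.of_forall fun x hx => ?_)
    have hp := PW (l := l) h0 h1 hvm hx
    have e1 : (∫⁻ y in UQ n, ‖Dl l (fun x => g x - PL n l c x) x y‖ₑ ^ s) = ∫⁻ y in UQ n, ‖Dl l g x y‖ₑ ^ s :=
      setLIntegral_congr_fun UQ_meas fun y hy => by simp only [Dl_sub, hc x hx y hy, sub_zero]
    rw [e1] at hp
    refine hp.trans ?_
    rw [tsum_eq_sum (s := Finset.range 2) (by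
      intro j hj
      have : ¬ j = 0 ∧ ¬ j = 1 := by simp at hj; omega
      simp [F, this.1, this.2, h0])]
    simp only [Finset.sum_range_succ, Finset.sum_range_zero, zero_add, F, if_true, one_ne_zero, if_false]
    refine add_le_add (le_of_eq ?_) ?_
    · simp only [G]; rw [rpow_self_one_div h0]
    · rw [ENNReal.mul_rpow_of_nonneg _ _ h0.le, rpow_self_one_div h0, hC1, mul_assoc]
      exact mul_le_mul_right (hE.trans (mul_le_mul_right hDR _)) _)
  rw [tsum_eq_sum (s := Finset.range 2) (by
      intro j hj
      have : ¬ j = 0 ∧ ¬ j = 1 := by simp at hj; omega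
      simp only [F, this.1, this.2, if_false]
      rw [lpNormE_const_prob hr, ENNReal.zero_rpow_of_pos h0])] at key
  simp only [Finset.sum_range_succ, Finset.sum_range_zero, zero_add, F, if_true, one_ne_zero, if_false] at key
  rw [lpNormE_const_prob hr, ENNReal.mul_rpow_of_nonneg _ _ h0.le, rpow_self_one_div h0] at key
  rw [eLpNorm_eq_lpNormE hr]
  have h5 : lpNormE r μ (fun x => ‖g x - PL n l c x‖ₑ) ^ s ≤ (1 + C1) * R ^ s := by
    refine key.trans ?_
    rw [add_mul, one_mul]
    exact add_le_add_left (ENNReal.rpow_le_rpow hGR h0.le) _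
  have h6 := ENNReal.rpow_le_rpow h5 (by positivity : 0 ≤ 1 / s)
  rwa [rpow_one_div_self h0, ENNReal.mul_rpow_of_nonneg _ _ (by positivity), rpow_one_div_self h0] at h6
end WhitR

section WhitLoc
variable {n : ℕ}

lemma PL_spline (l : ℕ) (c : (Fin n → Fin l) → ℝ) (a : Rn n) (s : ℝ) :
    ∃ b : Zn n → ℝ, ∀ x, PL n l c (a + s • x) = splineSum n l 0 b x := by
  have h1 : ∀ (i : Fin n) (j : Fin l), ∃ b : ℤ → ℝ, ∀ x : ℝ,
      ∑ m ∈ Finset.Icc (⌊x⌋ - (l : ℤ)) ⌊x⌋, b m * cardB l (x - m) = (LB l j).eval (a i + s * x) := by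
    intro i j
    obtain ⟨b, hb⟩ := poly_repr (d := l) ((LB l j).comp (Polynomial.C (a i) + Polynomial.C s * Polynomial.X)) (by
      refine Polynomial.natDegree_comp_le.trans ?_
      have e1 : (LB l j).natDegree ≤ l := Polynomial.natDegree_le_of_degree_le (LB_degree j.2).le
      have e2 : (Polynomial.C (a i) + Polynomial.C s * Polynomial.X : Polynomial ℝ).natDegree ≤ 1 := by
        refine (Polynomial.natDegree_add_le _ _).trans (max_le (by simp) ?_)
        exact (Polynomial.natDegree_C_mul_le _ _).trans Polynomial.natDegree_X_le
      calc _ ≤ l * 1 := Nat.mul_le_mul e1 e2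
        _ = l := mul_one l)
    refine ⟨b, fun x => ?_⟩
    have := hb x
    rw [Polynomial.eval_comp] at this
    simp only [Polynomial.eval_add, Polynomial.eval_C, Polynomial.eval_mul, Polynomial.eval_X] at this
    rw [← this, tsum_eq_sum]
    intro m hm
    by_contra h
    exact hm (cardB_ne_zero (right_ne_zero_of_mul h))
  choose b hb using h1
  refine ⟨fun m => ∑ ν, c ν * ∏ i, b i (ν i) (m i), fun x => ?_⟩
  rw [splineSum_finset (s := Fintype.piFinset fun i => Finset.Icc (⌊x i⌋ - (l : ℤ)) ⌊x i⌋) (by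
    intro m hm
    rw [Fintype.mem_piFinset]
    intro i
    rw [mem_nbox] at hm
    have h2 := hm i
    simp only [Pi.sub_apply, fl, pow_zero, one_mul] at h2
    rw [Finset.mem_Icc]; constructor <;> omega)]
  simp only [PL, Lb, Pi.add_apply, Pi.smul_apply, smul_eq_mul, Finset.sum_mul]
  rw [Finset.sum_comm]
  refine Finset.sum_congr rfl fun ν _ => ?_
  simp only [← hb]
  rw [Finset.prod_univ_sum, Finset.mul_sum]
  refine Finset.sum_congr rfl fun m _ => ?_
  rw [Finset.prod_mul_distrib, Bspl]; simp only [pow_zero, one_mul]; ring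

lemma eLpNorm_le_of_map {α β : Type*} [MeasurableSpace α] [MeasurableSpace β] {μ : Measure α} {ν : Measure β}
    {Φ : α → β} (hΦ : Measurable Φ) {K : ℝ≥0∞} (hK : K ≠ 0)
    (h : ∀ E, MeasurableSet E → μ (Φ ⁻¹' E) ≤ K * ν E) {f : β → ℝ} (hf : Measurable f) (r : ℝ≥0∞) :
    eLpNorm (fun x => f (Φ x)) r μ ≤ K ^ (1 / r.toReal) * eLpNorm f r ν := by
  have h1 : Measure.map Φ μ ≤ K • ν := by
    refine Measure.le_iff.2 fun E hE => ?_
    rw [Measure.map_apply hΦ hE, Measure.smul_apply, smul_eq_mul]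
    exact h E hE
  have h2 := eLpNorm_mono_measure f (p := r) h1
  rw [eLpNorm_map_measure hf.aestronglyMeasurable hΦ.aemeasurable, eLpNorm_smul_measure_of_ne_zero hK] at h2
  have e : (1 / r).toReal = 1 / r.toReal := by simp
  rw [e] at h2
  exact h2

lemma pair_measure {a : Rn n} {s τ : ℝ} (hs : 0 < s) (hτ : 0 < τ) {A B H Q : Set (Rn n)} (hA : MeasurableSet A)
    (h1 : ∀ u ∈ A, a + s • u ∈ Q) (h2 : ∀ u ∈ A, ∀ v ∈ B, τ • (v - u) ∈ H)
    {E : Set (Rn n × Rn n)} (hE : MeasurableSet E) :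
    ((volume.restrict A).prod (volume.restrict B)) ((fun q : Rn n × Rn n => (τ • (q.2 - q.1), a + s • q.1)) ⁻¹' E)
      ≤ (ENNReal.ofReal (τ ^ n)⁻¹ * ENNReal.ofReal (s ^ n)⁻¹) * ((volume.restrict H).prod (volume.restrict Q)) E := by
  have hm : Measurable (fun q : Rn n × Rn n => (τ • (q.2 - q.1), a + s • q.1)) := by fun_prop
  rw [Measure.prod_apply (hm hE), Measure.prod_apply_symm hE]
  calc ∫⁻ u in A, (volume.restrict B) (Prod.mk u ⁻¹' ((fun q : Rn n × Rn n => (τ • (q.2 - q.1), a + s • q.1)) ⁻¹' E))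
      ≤ ∫⁻ u in A, ENNReal.ofReal (τ ^ n)⁻¹ * (volume.restrict H) ((fun h => (h, a + s • u)) ⁻¹' E) := by
        refine setLIntegral_mono' hA fun u hu => ?_
        have hE2 : MeasurableSet ((fun h : Rn n => (h, a + s • u)) ⁻¹' E) := measurable_prodMk_right hE
        have h3 := lintegral_aff_le (-τ • u) hτ.ne' (A := B) (B := H) (by
          intro v hv
          have := h2 u hu v hv
          rwa [smul_sub, sub_eq_neg_add, ← neg_smul] at this)
          (((fun h : Rn n => (h, a + s • u)) ⁻¹' E).indicator 1)
        rw [abs_of_pos hτ, lintegral_indicator_one hE2] at h3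
        refine le_trans (le_of_eq ?_) h3
        rw [← lintegral_indicator_one (measurable_prodMk_left (hm hE))]
        refine lintegral_congr fun v => ?_
        have e : -τ • u + τ • v = τ • (v - u) := by rw [smul_sub, sub_eq_neg_add, neg_smul]
        rw [e]; rfl
    _ = ENNReal.ofReal (τ ^ n)⁻¹ * ∫⁻ u in A, (volume.restrict H) ((fun h => (h, a + s • u)) ⁻¹' E) := by
        rw [lintegral_const_mul' _ _ (by simp)]
    _ ≤ ENNReal.ofReal (τ ^ n)⁻¹ * (ENNReal.ofReal (s ^ n)⁻¹ * ∫⁻ x in Q, (volume.restrict H) ((fun h => (h, x)) ⁻¹' E)) := by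
        refine mul_le_mul_right ?_ _
        have h3 := lintegral_aff_le a hs.ne' (A := A) (B := Q) h1 (fun x => (volume.restrict H) ((fun h => (h, x)) ⁻¹' E))
        rwa [abs_of_pos hs] at h3
    _ = _ := by rw [mul_assoc]

lemma PL_pline (l : ℕ) (c : (Fin n → Fin l) → ℝ) (x v : Rn n) :
    ∃ Q : Polynomial ℝ, ∀ τ : ℝ, PL n l c (x + τ • v) = Q.eval τ := by
  refine ⟨∑ ν : Fin n → Fin l, Polynomial.C (c ν) *
    ∏ i, (LB l (ν i)).comp (Polynomial.C (x i) + Polynomial.C (v i) * Polynomial.X), fun τ => ?_⟩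
  simp only [PL, Lb, Polynomial.eval_finsetSum, Polynomial.eval_mul, Polynomial.eval_C, Polynomial.eval_prod,
    Polynomial.eval_comp, Polynomial.eval_add, Polynomial.eval_X, Pi.add_apply, Pi.smul_apply, smul_eq_mul, mul_comm τ]

lemma VP_ext {l : ℕ} {c : (Fin n → Fin l) → ℝ} (hc : c ∈ VP n l) {x : Rn n} (hx : x ∈ UQ n) (y : Rn n) :
    Dl l (PL n l c) x y = 0 := by
  set z : Rn n := fun _ => 1 / 2
  set w : Rn n := y - z
  have h1 : ∀ i : ℕ, ∃ Q : Polynomial ℝ, ∀ τ : ℝ, PL n l c (mid l i x (z + τ • w)) = Q.eval τ := by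
    intro i
    obtain ⟨Q, hQ⟩ := PL_pline l c (mid l i x z) (((i : ℝ) / l) • w)
    refine ⟨Q, fun τ => ?_⟩
    rw [← hQ]; congr 1
    unfold mid
    funext a
    simp only [Pi.add_apply, Pi.smul_apply, Pi.sub_apply, smul_eq_mul]; ring
  choose Q hQ using h1
  have h2 : ∀ τ : ℝ, Dl l (PL n l c) x (z + τ • w) = (∑ i ∈ Finset.range (l + 1), Polynomial.C (ac l i) * Q i).eval τ := by
    intro τ
    rw [Dl_eq, Polynomial.eval_finsetSum]
    simp [hQ]
  have h3 : (∑ i ∈ Finset.range (l + 1), Polynomial.C (ac l i) * Q i) = 0 := by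
    refine Polynomial.eq_zero_of_infinite_isRoot _ ?_
    have hτ : (0 : ℝ) < 1 / (2 * (‖w‖ + 1)) := by positivity
    refine (Set.Icc_infinite hτ).mono fun τ hτ' => ?_
    rw [Set.mem_ofPred_eq, Polynomial.IsRoot, ← h2]
    refine hc x hx _ ?_
    rw [mem_UQ]; intro a
    have h4 : |τ * w a| ≤ 1 / 2 := by
      rw [abs_mul, abs_of_nonneg hτ'.1]
      have h5 : |w a| ≤ ‖w‖ := norm_le_pi_norm w a
      calc τ * |w a| ≤ 1 / (2 * (‖w‖ + 1)) * (‖w‖ + 1) :=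
            mul_le_mul hτ'.2 (by linarith) (abs_nonneg _) (by positivity)
        _ = 1 / 2 := by field_simp
    rw [abs_le] at h4
    simp only [Pi.add_apply, Pi.smul_apply, smul_eq_mul, z]
    constructor <;> linarith [h4.1, h4.2]
  have h6 := h2 1
  rw [h3] at h6
  simpa [w] using h6

/-- slightly enlarged unit cube -/
def UD (n l : ℕ) : Set (Rn n) := Set.Icc (fun _ => -(1 / (4 * (l : ℝ)))) (fun _ => 1 + 1 / (4 * (l : ℝ)))

lemma mem_UD {l : ℕ} {x : Rn n} : x ∈ UD n l ↔ ∀ a, -(1 / (4 * (l : ℝ))) ≤ x a ∧ x a ≤ 1 + 1 / (4 * (l : ℝ)) := by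
  simp [UD, Set.mem_Icc, Pi.le_def, forall_and]

lemma UD_meas (l : ℕ) : MeasurableSet (UD n l) := measurableSet_Icc
lemma UD_fin (l : ℕ) : volume (UD n l) < ∞ := isCompact_Icc.measure_lt_top
lemma UQ_sub_UD (l : ℕ) : UQ n ⊆ UD n l := by
  intro x hx
  rw [mem_UD]; intro a
  have := mem_UQ.1 hx a
  have h : (0 : ℝ) ≤ 1 / (4 * (l : ℝ)) := by positivity
  constructor <;> linarith [this.1, this.2]

/-- concentric half cube -/
def UH (n : ℕ) : Set (Rn n) := Set.Icc (fun _ => 1 / 4) (fun _ => 3 / 4)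

lemma mem_UH {x : Rn n} : x ∈ UH n ↔ ∀ a, 1 / 4 ≤ x a ∧ x a ≤ 3 / 4 := by
  simp only [UH, Set.mem_Icc, Pi.le_def, forall_and]

lemma UH_vol : volume (UH n) = ENNReal.ofReal ((1 / 2 : ℝ) ^ n) := by
  rw [UH, Real.volume_Icc_pi]
  simp only [Finset.prod_const, Finset.card_univ, Fintype.card_fin]
  rw [ENNReal.ofReal_pow (by norm_num)]; norm_num

lemma UH_sub : UH n ⊆ UQ n := by
  intro x hx
  rw [mem_UQ]; intro a
  have := mem_UH.1 hx a
  constructor <;> linarith [this.1, this.2]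

lemma mid_mem_ext {l i : ℕ} (hi : i < l) {x y : Rn n} (hx : x ∈ UH n) (hy : y ∈ UD n l) : mid l i x y ∈ UQ n := by
  rw [mem_UQ]; intro a
  rw [mid_apply]
  have h1 := mem_UH.1 hx a
  have h2 := mem_UD.1 hy a
  have hl : (0 : ℝ) < l := by exact_mod_cast (Nat.zero_le i).trans_lt hi
  have hi0 : (0 : ℝ) ≤ (i : ℝ) / l := by positivity
  have hi1 : (i : ℝ) / l ≤ 1 - 1 / l := by
    rw [div_le_iff₀ hl, sub_mul, one_div, inv_mul_cancel₀ hl.ne']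
    have : (i : ℝ) + 1 ≤ l := by exact_mod_cast hi
    linarith
  have e : 1 / (4 * (l : ℝ)) = (1 / l) / 4 := by field_simp
  rw [e] at h2
  set t := (i : ℝ) / l
  set d := 1 / (l : ℝ) with hd
  have hd0 : 0 < d := by positivity
  constructor
  · nlinarith [h1.1, h2.1, mul_nonneg hi0 hd0.le]
  · nlinarith [h1.2, h2.2, mul_nonneg hi0 hd0.le]

lemma mid_measure {l i : ℕ} (hi : i < l) {E : Set (Rn n)} (hE : MeasurableSet E) :
    ((volume.restrict (UH n)).prod (volume.restrict (UD n l))) ((fun q : Rn n × Rn n => mid l i q.1 q.2) ⁻¹' E)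
      ≤ (ENNReal.ofReal ((l : ℝ) ^ n) * volume (UD n l)) * volume.restrict (UQ n) E := by
  have hm := mid_measurable (n := n) l i
  have hl : (0 : ℝ) < l := by exact_mod_cast (Nat.zero_le i).trans_lt hi
  have h1 : (1 : ℝ) / l ≤ 1 - (i : ℝ) / l := by
    rw [div_le_iff₀ hl, sub_mul, div_mul_cancel₀ _ hl.ne']
    have : (i : ℝ) + 1 ≤ l := by exact_mod_cast hi
    linarith
  have hl1 : (0 : ℝ) < 1 / l := by positivity
  have h2 : 0 < 1 - (i : ℝ) / l := hl1.trans_le h1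
  rw [Measure.prod_apply_symm (hm hE)]
  calc _ ≤ ∫⁻ y in UD n l, ENNReal.ofReal ((l : ℝ) ^ n) * volume.restrict (UQ n) E := by
        refine setLIntegral_mono' (UD_meas l) fun y hy => ?_
        have e : ∀ x, ((i : ℝ) / l) • y + (1 - (i : ℝ) / l) • x = mid l i x y := by
          intro x; funext a; rw [mid_apply]; simp; ring
        have h3 := lintegral_aff_le (((i : ℝ) / l) • y) h2.ne' (A := UH n) (B := UQ n) (by
          intro x hx; rw [e]; exact mid_mem_ext hi hx hy) (E.indicator 1)
        rw [abs_of_pos h2, lintegral_indicator_one hE] at h3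
        have hml : MeasurableSet ((fun x => (x, y)) ⁻¹' ((fun q : Rn n × Rn n => mid l i q.1 q.2) ⁻¹' E)) :=
          measurable_prodMk_right (hm hE)
        rw [← lintegral_indicator_one hml]
        refine le_trans (le_of_eq ?_) (h3.trans ?_)
        · refine lintegral_congr fun x => ?_
          rw [e]; rfl
        · refine mul_le_mul_left (ENNReal.ofReal_le_ofReal ?_) _
          rw [inv_le_comm₀ (by positivity) (by positivity), ← inv_pow, ← one_div]
          exact pow_le_pow_left₀ (by positivity) h1 n
    _ = _ := by
      rw [lintegral_const, Measure.restrict_apply MeasurableSet.univ, Set.univ_inter]; ring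

lemma whit_extend {l : ℕ} (hl : 0 < l) {r : ℝ≥0∞} (hr : 0 < r) :
    ∃ C : ℝ≥0∞, C < ∞ ∧ ∀ v : Rn n → ℝ, Measurable v →
      eLpNorm v r (volume.restrict (UD n l)) ≤
        C * (eLpNorm (fun q : Rn n × Rn n => Dl l v q.1 q.2) r
          ((volume.restrict (UQ n)).prod (volume.restrict (UD n l))) + eLpNorm v r (volume.restrict (UQ n))) := by
  set K := ENNReal.ofReal ((l : ℝ) ^ n) * volume (UD n l) with hK
  have hr0 : 0 ≤ 1 / r.toReal := by positivity
  have hK0 : K ≠ 0 := by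
    refine mul_ne_zero (by simp only [ne_eq, ENNReal.ofReal_eq_zero, not_le]; positivity) ?_
    intro h
    have := measure_mono (μ := volume) (UQ_sub_UD (n := n) l)
    rw [h, UQ_vol] at this; simp at this
  have hKt : K ^ (1 / r.toReal) ≠ ∞ := by
    refine ENNReal.rpow_ne_top_of_nonneg hr0 ?_
    have := UD_fin (n := n) l
    rw [hK]; finiteness
  set c0 := (volume (UH n)) ^ (1 / r.toReal) with hc0
  have hUH0 : volume (UH n) ≠ 0 := by rw [UH_vol]; simp only [ne_eq, ENNReal.ofReal_eq_zero, not_le]; positivity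
  have hUHt : volume (UH n) ≠ ∞ := by rw [UH_vol]; simp
  have hc00 : c0 ≠ 0 := by
    intro h
    rcases ENNReal.rpow_eq_zero_iff.1 h with h | h
    · exact hUH0 h.1
    · exact hUHt h.1
  have hc0t : c0 ≠ ∞ := ENNReal.rpow_ne_top_of_nonneg hr0 hUHt
  refine ⟨c0⁻¹ * (Kq r (l + 1) * (1 + ∑ i ∈ Finset.range l, ‖ac l i‖ₑ * K ^ (1 / r.toReal))), ?_, fun v hv => ?_⟩
  · have : (∑ i ∈ Finset.range l, ‖ac l i‖ₑ * K ^ (1 / r.toReal)) < ∞ :=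
      ENNReal.sum_lt_top.2 fun i _ => ENNReal.mul_lt_top (by simp) hKt.lt_top
    have h2 : c0⁻¹ < ∞ := by simpa [pos_iff_ne_zero] using hc00
    exact ENNReal.mul_lt_top h2 (ENNReal.mul_lt_top (Kq_lt_top hr _) (ENNReal.add_lt_top.2 ⟨by simp, this⟩))
  set μ := (volume.restrict (UH n)).prod (volume.restrict (UD n l)) with hμ
  set D := eLpNorm (fun q : Rn n × Rn n => Dl l v q.1 q.2) r
          ((volume.restrict (UQ n)).prod (volume.restrict (UD n l)))
  set V := eLpNorm v r (volume.restrict (UQ n))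
  have e1 : eLpNorm (fun q : Rn n × Rn n => v q.2) r μ = c0 * eLpNorm v r (volume.restrict (UD n l)) := by
    have h1 : Measure.map Prod.snd μ = volume (UH n) • volume.restrict (UD n l) := by
      rw [hμ, Measure.map_snd_prod, Measure.restrict_apply MeasurableSet.univ, Set.univ_inter]
    have h2 : eLpNorm v r (Measure.map Prod.snd μ) = eLpNorm (fun q : Rn n × Rn n => v q.2) r μ :=
      eLpNorm_map_measure hv.aestronglyMeasurable measurable_snd.aemeasurable
    rw [← h2, h1, eLpNorm_smul_measure_of_ne_zero hUH0, smul_eq_mul, hc0]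
    simp
  let F : ℕ → Rn n × Rn n → ℝ≥0∞ := fun i q => if i < l then ‖ac l i‖ₑ * ‖v (mid l i q.1 q.2)‖ₑ else ‖Dl l v q.1 q.2‖ₑ
  have h3 := lpNormE_sum_le (μ := μ) hr (Finset.range (l + 1)) (fun q => ‖v q.2‖ₑ) F (by
      intro i; simp only [F]; split_ifs
      · exact ((hv.comp (mid_measurable l i)).enorm.const_mul _).aemeasurable
      · exact (Dl_measurable l hv).enorm.aemeasurable) (by
      refine Eventually.of_forall fun q => ?_
      have h4 : v q.2 = Dl l v q.1 q.2 - ∑ i ∈ Finset.range l, ac l i * v (mid l i q.1 q.2) := by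
        rw [Dl_eq, Finset.sum_range_succ, ac_self]
        have : mid l l q.1 q.2 = q.2 := by
          have hl' : (l : ℝ) ≠ 0 := by exact_mod_cast hl.ne'
          funext a; rw [mid_apply, div_self hl']; ring
        rw [this]; ring
      rw [Finset.sum_range_succ]
      have e2 : F l q = ‖Dl l v q.1 q.2‖ₑ := by simp [F]
      have e3 : ∑ i ∈ Finset.range l, F i q = ∑ i ∈ Finset.range l, ‖ac l i * v (mid l i q.1 q.2)‖ₑ := by
        refine Finset.sum_congr rfl fun i hi => ?_
        simp only [F, Finset.mem_range.1 hi, if_true]; rw [enorm_mul]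
      rw [e2, e3]
      conv_lhs => rw [h4]
      rw [add_comm]
      refine (enorm_sub_le).trans (add_le_add_right (enorm_sum_le _ _) _))
  rw [← eLpNorm_eq_lpNormE hr (fun q : Rn n × Rn n => v q.2), e1, Finset.card_range, Finset.sum_range_succ] at h3
  have h5 : lpNormE r μ (F l) ≤ D := by
    have : F l = fun q => ‖Dl l v q.1 q.2‖ₑ := by funext q; simp [F]
    rw [this, ← eLpNorm_eq_lpNormE hr (fun q : Rn n × Rn n => Dl l v q.1 q.2)]
    refine eLpNorm_mono_measure _ ?_
    exact Measure.prod_mono (Measure.restrict_mono UH_sub le_rfl) le_rfl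
  have h6 : ∀ i ∈ Finset.range l, lpNormE r μ (F i) ≤ (‖ac l i‖ₑ * K ^ (1 / r.toReal)) * V := by
    intro i hi
    have hi := Finset.mem_range.1 hi
    have : F i = fun q => ‖ac l i‖ₑ * ‖v (mid l i q.1 q.2)‖ₑ := by funext q; simp [F, hi]
    rw [this, lpNormE_const_mul hr (by simp), ← eLpNorm_eq_lpNormE hr (fun q : Rn n × Rn n => v (mid l i q.1 q.2)), mul_assoc]
    refine mul_le_mul_right ?_ _
    exact eLpNorm_le_of_map (mid_measurable l i) hK0 (fun E hE => mid_measure hi hE) hv r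
  have h7 : c0 * eLpNorm v r (volume.restrict (UD n l)) ≤ Kq r (l + 1) * (1 + ∑ i ∈ Finset.range l, ‖ac l i‖ₑ * K ^ (1 / r.toReal)) * (D + V) := by
    refine h3.trans ?_
    rw [mul_assoc]
    refine mul_le_mul_right ?_ _
    refine (add_le_add (Finset.sum_le_sum h6) h5).trans ?_
    rw [← Finset.sum_mul, add_comm, add_mul, one_mul]
    refine add_le_add le_self_add ?_
    exact mul_le_mul_right le_add_self _
  calc eLpNorm v r (volume.restrict (UD n l)) = c0⁻¹ * (c0 * eLpNorm v r (volume.restrict (UD n l))) := by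
        rw [← mul_assoc, ENNReal.inv_mul_cancel hc00 hc0t, one_mul]
    _ ≤ _ := by rw [mul_assoc c0⁻¹]; exact mul_le_mul_right h7 _

end WhitLoc

section WhitLoc2
variable {n : ℕ}

lemma whit_ext {l : ℕ} (hl : 0 < l) {r : ℝ≥0∞} (hr : 0 < r) :
    ∃ C : ℝ≥0∞, C < ∞ ∧ ∀ g : Rn n → ℝ, Measurable g → eLpNorm g r (volume.restrict (UQ n)) < ∞ →
      ∃ c : (Fin n → Fin l) → ℝ, eLpNorm (fun x => g x - PL n l c x) r (volume.restrict (UD n l)) ≤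
        C * eLpNorm (fun q : Rn n × Rn n => Dl l g q.1 q.2) r
          ((volume.restrict (UQ n)).prod (volume.restrict (UD n l))) := by
  obtain ⟨C, hC, hw⟩ := whit_unit (n := n) hl hr
  obtain ⟨C', hC', he⟩ := whit_extend (n := n) hl hr
  refine ⟨C' * (1 + C), by finiteness, fun g hg hfin => ?_⟩
  obtain ⟨c, hc, h1⟩ := hw g hg hfin
  refine ⟨c, ?_⟩
  have hvm : Measurable (fun x => g x - PL n l c x) := hg.sub (PL_cont l c).measurable
  refine (he _ hvm).trans ?_
  rw [mul_assoc]
  refine mul_le_mul_right ?_ _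
  rw [add_mul, one_mul]
  refine add_le_add (le_of_eq ?_) (h1.trans (mul_le_mul_right ?_ _))
  · refine eLpNorm_congr_ae ?_
    have : ∀ᵐ q ∂((volume.restrict (UQ n)).prod (volume.restrict (UD n l))), q.1 ∈ UQ n := by
      rw [Measure.prod_restrict]
      filter_upwards [ae_restrict_mem (UQ_meas.prod (UD_meas l))] with q hq
      exact hq.1
    filter_upwards [this] with q hq
    rw [Dl_sub, VP_ext hc hq, sub_zero]
  · exact eLpNorm_mono_measure _ (Measure.prod_mono le_rfl (Measure.restrict_mono (UQ_sub_UD l) le_rfl))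

/-- the slightly enlarged closed dyadic cube -/
def QD (n l j : ℕ) (m : Zn n) : Set (Rn n) :=
  {x | ∀ i, ((m i : ℝ) - 1 / (4 * (l : ℝ))) / 2 ^ j ≤ x i ∧ x i ≤ ((m i : ℝ) + 1 + 1 / (4 * (l : ℝ))) / 2 ^ j}

lemma QD_eq (l j : ℕ) (m : Zn n) : QD n l j m = Set.Icc (fun i => ((m i : ℝ) - 1 / (4 * (l : ℝ))) / 2 ^ j)
    (fun i => ((m i : ℝ) + 1 + 1 / (4 * (l : ℝ))) / 2 ^ j) := by
  ext x; simp [QD, Set.mem_Icc, Pi.le_def, forall_and]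

lemma QD_compact (l j : ℕ) (m : Zn n) : IsCompact (QD n l j m) := by rw [QD_eq]; exact isCompact_Icc

lemma QD_preimage (l j : ℕ) (m : Zn n) :
    (fun x : Rn n => (fun i => (m i : ℝ) / 2 ^ j) + (1 / 2 ^ j : ℝ) • x) ⁻¹' (QD n l j m) = UD n l := by
  ext x
  have h2 : (0 : ℝ) < 2 ^ j := by positivity
  simp only [Set.mem_preimage, QD, mem_UD, Set.mem_ofPred_eq, Pi.add_apply, Pi.smul_apply, smul_eq_mul]
  refine forall_congr' fun i => ?_
  have e : (m i : ℝ) / 2 ^ j + 1 / 2 ^ j * x i = ((m i : ℝ) + x i) / 2 ^ j := by ring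
  rw [e, div_le_div_iff_of_pos_right h2, div_le_div_iff_of_pos_right h2]
  constructor
  · rintro ⟨h, h'⟩; constructor <;> linarith
  · rintro ⟨h, h'⟩; constructor <;> linarith

lemma delta_const (l j : ℕ) (hl : 0 < l) :
    ENNReal.ofReal ((1 / 2 ^ j / l : ℝ) ^ n)⁻¹ * ENNReal.ofReal ((1 / 2 ^ j : ℝ) ^ n)⁻¹
      = ENNReal.ofReal ((l * 4 : ℝ) ^ n) * ENNReal.ofReal (2 / 2 ^ j) ^ (-(2 * (n : ℝ))) := by
  have hl' : (0 : ℝ) < l := by exact_mod_cast hl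
  rw [ENNReal.ofReal_rpow_of_pos (by positivity), ← ENNReal.ofReal_mul (by positivity), ← ENNReal.ofReal_mul (by positivity)]
  congr 1
  rw [Real.rpow_neg (by positivity)]
  have : ((2 : ℝ) / 2 ^ j) ^ (2 * (n : ℝ)) = (2 / 2 ^ j) ^ (2 * n) := by
    rw [← Real.rpow_natCast (2 / 2 ^ j) (2 * n)]; congr 1; push_cast; ring
  rw [this, pow_mul, ← inv_pow, ← inv_pow, ← inv_pow, ← mul_pow, ← mul_pow]
  congr 1
  field_simp; norm_num

lemma diffl_measurable (l : ℕ) {φ : Rn n → ℝ} (hφ : Measurable φ) :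
    Measurable (fun hx : Rn n × Rn n => diffl l hx.1 φ hx.2) := by
  unfold diffl
  exact Finset.measurable_sum _ fun i _ => (hφ.comp (by fun_prop)).const_mul _

lemma whit_loc {l : ℕ} (hl : 0 < l) {r : ℝ≥0∞} (hr : 0 < r) :
    ∃ C : ℝ≥0∞, C < ∞ ∧ ∀ φ : Rn n → ℝ, MemLrLoc n r φ → ∀ (k : ℕ) (m : Zn n), ∃ b : Zn n → ℝ,
      ∀ x0 ∈ dyadicCubeHalf n (k + 1) m,
        (2 : ℝ≥0∞) ^ ((((k + 1) * n : ℕ) : ℝ) / r.toReal) *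
          eLpNorm (fun x => φ x - splineSum n l (k + 1) b x) r (volume.restrict (QD n l (k + 1) m)) ≤
        C * deltaE n l r ((2 : ℝ) ^ (1 - ((k : ℤ) + 1))) (openCube x0 ((2 : ℝ) ^ (-((k : ℤ) + 1)))) φ := by
  obtain ⟨C, hC, hw⟩ := whit_ext (n := n) hl hr
  have hl' : (0 : ℝ) < l := by exact_mod_cast hl
  refine ⟨C * ENNReal.ofReal ((l * 4 : ℝ) ^ n) ^ (1 / r.toReal), by
    have : 0 ≤ 1 / r.toReal := by positivity
    finiteness, fun φ hφ k m => ?_⟩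
  obtain ⟨j, hk⟩ : ∃ j, j = k + 1 := ⟨_, rfl⟩
  rw [← hk]
  have hj0 : (0 : ℝ) < 2 ^ j := by positivity
  set a : Rn n := fun i => (m i : ℝ) / 2 ^ j with ha
  set s : ℝ := 1 / 2 ^ j with hs
  have hs0 : 0 < s := by positivity
  have hgm : Measurable (fun u => φ (a + s • u)) := hφ.1.comp (by fun_prop)
  have hfin : eLpNorm (fun u => φ (a + s • u)) r (volume.restrict (UQ n)) < ∞ := by
    refine (eLpNorm_mono_measure _ (Measure.restrict_mono (UQ_sub_UD l) le_rfl)).trans_lt ?_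
    rw [← QD_preimage l j m, eLpNorm_aff a hs0.ne']
    have := hφ.2 _ (QD_compact l j m)
    have h2 : 0 ≤ 1 / r.toReal := by positivity
    finiteness
  obtain ⟨c, hc⟩ := hw _ hgm hfin
  obtain ⟨b, hb⟩ := PL_spline l c (fun i => -(m i : ℝ)) 1
  refine ⟨b, fun x0 hx0 => ?_⟩
  have hP : ∀ u, splineSum n l j b (a + s • u) = PL n l c u := by
    intro u
    rw [splineSum_scale, ← hb]
    congr 1
    funext i
    simp only [ha, hs, Pi.add_apply, Pi.smul_apply, smul_eq_mul]
    field_simp; ring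
  have e1 : eLpNorm (fun u => φ (a + s • u) - PL n l c u) r (volume.restrict (UD n l)) =
      ENNReal.ofReal (s ^ n)⁻¹ ^ (1 / r.toReal) * eLpNorm (fun x => φ x - splineSum n l j b x) r (volume.restrict (QD n l j m)) := by
    have := eLpNorm_aff (r := r) a hs0.ne' (QD n l j m) (fun x => φ x - splineSum n l j b x)
    rw [QD_preimage l j m, abs_of_pos hs0] at this
    rw [← this]; simp only [hP]
  have e2 : (2 : ℝ≥0∞) ^ (((j * n : ℕ) : ℝ) / r.toReal) = ENNReal.ofReal (s ^ n)⁻¹ ^ (1 / r.toReal) := by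
    have : (s ^ n)⁻¹ = 2 ^ (j * n) := by
      rw [← inv_pow, hs, pow_mul]; congr 1; field_simp
    rw [this, ENNReal.ofReal_pow (by norm_num), ← ENNReal.rpow_natCast, ← ENNReal.rpow_mul]
    simp only [ENNReal.ofReal_ofNat]
    congr 1; ring
  have hτ : 0 < s / l := by positivity
  have p1 : (2 : ℝ) ^ (1 - ((k : ℤ) + 1)) = 2 / 2 ^ j := by
    rw [hk]
    have : (1 - ((k : ℤ) + 1)) = -(k : ℤ) := by ring
    rw [this, zpow_neg, zpow_natCast, pow_succ]; field_simp
  have p2 : (2 : ℝ) ^ (-((k : ℤ) + 1)) = 1 / 2 ^ j := by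
    rw [hk, zpow_neg, zpow_add₀ (by norm_num), zpow_natCast, pow_succ]; field_simp
  rw [p1, p2, deltaE]
  have key := eLpNorm_le_of_map (μ := (volume.restrict (dyadicCubeHalf n 0 0)).prod (volume.restrict (UD n l)))
    (ν := (volume.restrict (openCube (0 : Rn n) (2 / 2 ^ j))).prod (volume.restrict (openCube x0 (1 / 2 ^ j))))
    (Φ := fun q : Rn n × Rn n => ((s / l) • (q.2 - q.1), a + s • q.1)) (by fun_prop)
    (K := ENNReal.ofReal ((s / l) ^ n)⁻¹ * ENNReal.ofReal (s ^ n)⁻¹)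
    (mul_ne_zero (by simp only [ne_eq, ENNReal.ofReal_eq_zero, not_le]; positivity) (by simp only [ne_eq, ENNReal.ofReal_eq_zero, not_le]; positivity))
    (fun E hE => pair_measure hs0 hτ (measurableSet_half 0 0) ?_ ?_ hE) (diffl_measurable l hφ.1) r
  · have e3 : (fun q : Rn n × Rn n => diffl l ((s / l) • (q.2 - q.1)) φ (a + s • q.1)) =
        fun q : Rn n × Rn n => Dl l (fun u => φ (a + s • u)) q.1 q.2 := by
      funext q
      simp only [Dl, diffl]
      refine Finset.sum_congr rfl fun i _ => ?_
      congr 2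
      rw [smul_add, add_assoc, smul_smul, smul_smul, smul_smul]
      congr 3
      ring
    simp only [e3] at key
    rw [half_zero_ae] at key
    rw [e2, ← e1, mul_assoc]
    refine (hc.trans (mul_le_mul_right (key.trans (le_of_eq ?_)) _))
    rw [hs, delta_const l j hl, ENNReal.mul_rpow_of_nonneg _ _ (by positivity), ← ENNReal.rpow_mul, mul_assoc]
    congr 3
    ring
  · intro u hu i
    have h1 := hu i
    have h2 := hx0 i
    simp only [pow_zero, div_one, Pi.zero_apply, Int.cast_zero, zero_add] at h1
    have e4 : (a + s • u) i - x0 i = ((m i : ℝ) + u i) / 2 ^ j - x0 i := by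
      simp only [ha, hs, Pi.add_apply, Pi.smul_apply, smul_eq_mul]; ring
    rw [e4, abs_lt]
    rw [div_le_iff₀ hj0, lt_div_iff₀ hj0] at h2
    have e5 : ((m i : ℝ) + u i) / 2 ^ j - x0 i = ((m i : ℝ) + u i - x0 i * 2 ^ j) / 2 ^ j := by field_simp
    rw [e5, ← neg_div, div_lt_div_iff_of_pos_right hj0, div_lt_div_iff_of_pos_right hj0]
    constructor <;> linarith [h1.1, h1.2]
  · intro u hu v hv i
    have h1 := hu i
    simp only [pow_zero, div_one, Pi.zero_apply, Int.cast_zero, zero_add] at h1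
    have h2 := mem_UD.1 hv i
    have e4 : ((s / l) • (v - u)) i - (0 : Rn n) i = (1 / l * (v i - u i)) / 2 ^ j := by
      simp only [hs, Pi.sub_apply, Pi.smul_apply, smul_eq_mul, Pi.zero_apply]; ring
    have h3 : (1 : ℝ) / l ≤ 1 := div_le_self (by norm_num) (by exact_mod_cast hl)
    have h5 : (1 : ℝ) / (4 * l) ≤ 1 / 4 := by
      rw [one_div, mul_inv, ← one_div, ← one_div]; nlinarith
    have h4 : |1 / (l : ℝ) * (v i - u i)| ≤ 1 * (5 / 4) := by
      rw [abs_mul, abs_of_pos (by positivity)]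
      exact mul_le_mul h3 (by rw [abs_le]; constructor <;> linarith [h1.1, h1.2, h2.1, h2.2]) (abs_nonneg _) (by norm_num)
    rw [e4, abs_div, abs_of_pos hj0, div_lt_div_iff_of_pos_right hj0]
    linarith

end WhitLoc2

section P16
variable {n : ℕ} {p q r : ℝ≥0∞}

lemma lpNormE_mul_const {α : Type*} [MeasurableSpace α] {μ : Measure α} (hp : 0 < p) (c : ℝ≥0∞)
    {f : α → ℝ≥0∞} (hf : Measurable f) :
    lpNormE p μ (fun x => f x * c) = lpNormE p μ f * c := by
  simp only [mul_comm _ c]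
  unfold lpNormE
  split_ifs with h
  · exact ENNReal.essSup_const_mul
  · have hp' := toReal_pos_of hp h
    simp only [ENNReal.mul_rpow_of_nonneg _ _ hp'.le]
    rw [lintegral_const_mul _ (hf.pow_const _), ENNReal.mul_rpow_of_nonneg _ _ (by positivity),
      rpow_one_div_self hp']

lemma tkm_eq (hp : 0 < p) {t : ℕ → Rn n → ℝ} (ht : pAdmissible n p t) (k : ℕ) (m : Zn n)  :
    tkm n p t k m = lpNormE p (volume.restrict (dyadicCubeHalf n k m)) (fun x => ENNReal.ofReal (t k x)) := by
  rw [tkm, restrict_cube, eLpNorm_eq_lpNormE hp]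
  congr 1; funext x
  exact Real.enorm_of_nonneg (((ht k).1.2 x).le)

lemma link_low (hp : 0 < p) {t : ℕ → Rn n → ℝ} (ht : pAdmissible n p t) (k : ℕ)
    (d : Zn n → ℝ≥0∞) (F : Rn n → ℝ≥0∞) (h : ∀ m, ∀ x ∈ dyadicCubeHalf n k m, d m ≤ F x) :
    lqNorm p (fun m => tkm n p t k m * d m) ≤ lpNormE p volume (fun x => ENNReal.ofReal (t k x) * F x) := by
  rw [lpNormE_cubes hp k]
  refine lqNorm_mono fun m => ?_
  rw [tkm_eq hp ht, ← lpNormE_mul_const hp _ ((ht k).1.1.ennreal_ofReal)]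
  apply lpNormE_mono_ae
  filter_upwards [ae_restrict_mem (measurableSet_half k m)] with x hx
  exact mul_le_mul' le_rfl (h m x hx)

lemma link_up (hp : 0 < p) {t : ℕ → Rn n → ℝ} (ht : pAdmissible n p t) (k : ℕ)
    (d : Zn n → ℝ≥0∞) (F : Rn n → ℝ≥0∞) (h : ∀ m, ∀ x ∈ dyadicCubeHalf n k m, F x ≤ d m) :
    lpNormE p volume (fun x => ENNReal.ofReal (t k x) * F x) ≤ lqNorm p (fun m => tkm n p t k m * d m) := by
  rw [lpNormE_cubes hp k]
  refine lqNorm_mono fun m => ?_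
  rw [tkm_eq hp ht, ← lpNormE_mul_const hp _ ((ht k).1.1.ennreal_ofReal)]
  apply lpNormE_mono_ae
  filter_upwards [ae_restrict_mem (measurableSet_half k m)] with x hx
  exact mul_le_mul' le_rfl (h m x hx)

lemma add_rpow_le (s : ℝ) (hs : 0 ≤ s) (a b : ℝ≥0∞) : (a + b) ^ s ≤ 2 ^ s * (a ^ s + b ^ s) := by
  calc (a + b) ^ s ≤ (2 * max a b) ^ s := by
        refine ENNReal.rpow_le_rpow ?_ hs
        rw [two_mul]; exact add_le_add (le_max_left _ _) (le_max_right _ _)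
    _ = 2 ^ s * (max a b) ^ s := ENNReal.mul_rpow_of_nonneg _ _ hs
    _ ≤ _ := by
        refine mul_le_mul' le_rfl ?_
        rcases le_total a b with h | h
        · rw [max_eq_right h]; exact le_add_self
        · rw [max_eq_left h]; exact le_self_add

lemma lqNorm_succ (hq : 0 < q) (g : ℕ → ℝ≥0∞) :
    lqNorm q g ≤ 2 ^ (1 / q.toReal) * (g 0 + lqNorm q (fun k => g (k + 1))) := by
  unfold lqNorm
  split_ifs with h
  · subst h
    have e0 : (1 : ℝ) / (∞ : ℝ≥0∞).toReal = 0 := by simp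
    rw [e0, ENNReal.rpow_zero, one_mul]
    refine iSup_le fun i => ?_
    rcases i with _ | i
    · exact le_self_add
    · exact (le_iSup (fun k => g (k + 1)) i).trans le_add_self
  · have hq' := toReal_pos_of hq h
    rw [tsum_eq_zero_add' ENNReal.summable]
    refine (add_rpow_le _ (by positivity) _ _).trans ?_
    rw [rpow_one_div_self hq']

lemma lqNorm_split (hq : 0 < q) (N : ℕ) : ∃ C < ∞, ∀ g : ℕ → ℝ≥0∞,
    lqNorm q g ≤ C * (∑ i ∈ Finset.range N, g i + lqNorm q (fun k => g (k + N))) := by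
  induction N with
  | zero => exact ⟨1, by simp, fun g => by simp⟩
  | succ N ih =>
    obtain ⟨C, hC, h⟩ := ih
    set c : ℝ≥0∞ := 2 ^ (1 / q.toReal) with hc
    have hc1 : 1 ≤ c := by
      rw [hc, ← ENNReal.rpow_zero (x := 2)]
      exact ENNReal.rpow_le_rpow_of_exponent_le (by norm_num) (by positivity)
    refine ⟨C * c, ENNReal.mul_lt_top hC (two_rpow_lt _), fun g => (h g).trans ?_⟩
    rw [mul_assoc]
    refine mul_le_mul' le_rfl ?_
    have := lqNorm_succ hq (fun k => g (k + N))
    simp only [zero_add] at this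
    rw [Finset.sum_range_succ, add_assoc, mul_add c]
    refine add_le_add (le_mul_of_one_le_left' hc1) (this.trans ?_)
    refine le_of_eq ?_
    congr 3; funext k; congr 1; ring

lemma lqNorm_shift (hq : 0 < q) (i : ℕ) (B : ℕ → ℝ≥0∞) :
    lqNorm q (fun k => if i ≤ k then B (k - i) else 0) ≤ lqNorm q B := by
  rw [← lqNorm_fiber hq (fun k => k + i) B]
  refine lqNorm_mono fun k => ?_
  split_ifs with h
  · refine le_trans ?_ (le_lqNorm hq _ (k - i))
    simp [h]
  · exact zero_le

lemma lqNorm_single [Countable (Zn n)] (hq : 0 < q) (s : Finset (Zn n)) (a : Zn n → ℝ≥0∞) :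
    lqNorm q (fun m => if m ∈ s then a m else 0) ≤ Kq q s.card * ∑ m ∈ s, a m := by
  refine (lqNorm_sum_le hq s _ (fun j m => if m = j then a m else 0) fun m => ?_).trans ?_
  · simp
  · refine mul_le_mul' le_rfl (Finset.sum_le_sum fun j _ => ?_)
    have := lqNorm_fiber (ι := Zn n) (κ := Unit) hq (fun _ => j) (fun _ => a j)
    have h2 : lqNorm q (fun _ : Unit => a j) = a j := by
      unfold lqNorm
      split_ifs with h
      · simp
      · simp only [tsum_fintype, Finset.univ_unique, Finset.sum_singleton]
        rw [rpow_one_div_self (toReal_pos_of hq h)]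
    rw [h2] at this
    rw [← this]
    refine lqNorm_mono fun m => ?_
    by_cases h : m = j
    · refine le_trans ?_ (le_lqNorm hq _ ())
      simp [h]
    · simp [h]

/-- compact sets are controlled by unit cubes -/
lemma compact_cover (hr : 0 < r) {K : Set (Rn n)} (hK : IsCompact K) : ∃ (s : Finset (Zn n)),
    ∀ f : Rn n → ℝ, eLpNorm f r (volume.restrict K) ≤
      Kq r s.card * ∑ m ∈ s, eLpNorm f r (volume.restrict (dyadicCubeHalf n 0 m)) := by
  obtain ⟨R, hR⟩ := hK.isBounded.subset_closedBall 0
  refine ⟨box n (⌈R⌉₊ + 1), fun f => ?_⟩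
  refine le_trans ?_ (lqNorm_single hr _ _)
  rw [eLpNorm_eq_lpNormE hr, lpNormE_fiber hr _ (measurableSet_half 0) (half_disj 0) (half_cover 0)]
  refine lqNorm_mono fun m => ?_
  split_ifs with h
  · rw [eLpNorm_eq_lpNormE hr, Measure.restrict_restrict (measurableSet_half 0 m)]
    exact lpNormE_mono_measure (Measure.restrict_mono Set.inter_subset_left le_rfl)
  · rw [Measure.restrict_restrict (measurableSet_half 0 m)]
    have : dyadicCubeHalf n 0 m ∩ K = ∅ := by
      ext x
      simp only [Set.mem_inter_iff, Set.mem_empty_iff_false, iff_false, not_and]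
      intro hx hxK
      apply h
      rw [mem_box]
      intro i
      rw [mem_half_iff] at hx
      have h1 : ‖x‖ ≤ R := by simpa using hR hxK
      have h2 : |x i| ≤ R := (norm_le_pi_norm x i).trans h1
      rw [abs_le] at h2
      have h3 : m i = ⌊x i⌋ := by rw [← hx]; simp [fl]
      have h4 := Int.floor_le (x i)
      have h5 := Int.lt_floor_add_one (x i)
      have h6 := Nat.le_ceil R
      rw [h3, abs_le]
      constructor
      · have : (-((⌈R⌉₊ : ℝ) + 1)) ≤ (⌊x i⌋ : ℝ) := by linarith
        exact_mod_cast this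
      · have : (⌊x i⌋ : ℝ) ≤ (⌈R⌉₊ : ℝ) + 1 := by linarith
        exact_mod_cast this
    rw [this, Measure.restrict_empty, lpNormE_zero_measure hr]

lemma tendsto_compact (hr : 0 < r) (f : ℕ → Rn n → ℝ)
    (h : ∀ m, Tendsto (fun N => eLpNorm (f N) r (volume.restrict (dyadicCubeHalf n 0 m))) atTop (nhds 0))
    {K : Set (Rn n)} (hK : IsCompact K) :
    Tendsto (fun N => eLpNorm (f N) r (volume.restrict K)) atTop (nhds 0) := by
  obtain ⟨s, hs⟩ := compact_cover hr hK
  refine tendsto_of_tendsto_of_tendsto_of_le_of_le tendsto_const_nhds ?_ (fun _ => zero_le)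
    (fun N => hs (f N))
  have : Tendsto (fun N => Kq r s.card * ∑ m ∈ s, eLpNorm (f N) r (volume.restrict (dyadicCubeHalf n 0 m)))
    atTop (nhds (Kq r s.card * ∑ m ∈ s, 0)) :=
    ENNReal.Tendsto.const_mul (tendsto_finsetSum _ fun m _ => h m) (Or.inr (Kq_lt_top hr _).ne)
  simpa using this

lemma WT.HIGHf {T : ℕ → Zn n → ℝ≥0∞} {ε α₂ : ℝ} {C A : ℝ≥0∞} (h : WT n p r T ε α₂ C A)
    (hp : 0 < p) (hr : 0 < r) (R : ℕ) {k j : ℕ} (hk : k ≤ j)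
    (o : Zn n) (ho : ∀ i, |o i| ≤ R) (f : Rn n → ℝ) :
    lqNorm p (fun m => T k m * (2 ^ (((k * n : ℕ) : ℝ) / r.toReal) *
      eLpNorm f r (volume.restrict (dyadicCubeHalf n k (m + o))))) ≤
      C * A ^ R * 2 ^ (-ε * ((j : ℝ) - k)) * lqNorm p (fun m => T j m * (2 ^ (((j * n : ℕ) : ℝ) / r.toReal) *
      eLpNorm f r (volume.restrict (dyadicCubeHalf n j m)))) := by
  refine le_trans (le_of_eq ?_) (h.HIGH hp R hk _ o ho)
  congr 1; funext m; congr 1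
  rw [eLpNorm_eq_lpNormE hr, lpNormE_subcubes hr hk]
  have : (fun m' => if anc (j - k) m' = m + o then 2 ^ (((j * n : ℕ) : ℝ) / r.toReal) *
      eLpNorm f r (volume.restrict (dyadicCubeHalf n j m')) else 0) =
    fun m' => 2 ^ (((j * n : ℕ) : ℝ) / r.toReal) * (if anc (j - k) m' = m + o then
      lpNormE r (volume.restrict (dyadicCubeHalf n j m')) (fun x => ‖f x‖ₑ) else 0) := by
    funext m'
    split_ifs
    · rw [eLpNorm_eq_lpNormE hr]
    · simp
  rw [this, lqNorm_const_mul hr, ← mul_assoc, ← two_rpow_add]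
  congr 2
  push_cast; ring

end P16

section P17
variable {n : ℕ} {p q r : ℝ≥0∞}

def cc (l : ℕ) : ℕ := 2 * l + 2

lemma cc_bound (l : ℕ) : 4 * l * l ≤ 2 ^ cc l := by
  have h : l < 2 ^ l := Nat.lt_two_pow_self
  rw [cc, pow_add, two_mul, pow_add]
  nlinarith

lemma anc_near (l : ℕ) {m o : Zn n} (ho : o ∈ nbox n l) : anc (cc l) (m + o) - anc (cc l) m ∈ box n 1 := by
  rw [mem_box]; rw [mem_nbox] at ho
  intro i
  have h1 := ho i
  simp only [Pi.sub_apply, anc, Pi.add_apply]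
  have hb : (l : ℤ) ≤ 2 ^ cc l := by
    have : l ≤ 2 ^ cc l := by
      have h := cc_bound l
      rcases Nat.eq_zero_or_pos l with h0 | h0
      · omega
      · nlinarith
    exact_mod_cast this
  have hpos : (0 : ℤ) < 2 ^ cc l := by positivity
  generalize (2 : ℤ) ^ cc l = N at *
  have a1 : (m i + o i) / N ≤ m i / N := Int.ediv_le_ediv hpos (by omega)
  have a2 : (m i - N) / N ≤ (m i + o i) / N := Int.ediv_le_ediv hpos (by omega)
  have a3 : (m i - N) / N = m i / N - 1 := by
    rw [Int.sub_ediv_of_dvd _ dvd_rfl, Int.ediv_self hpos.ne']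
  rw [abs_le]
  push_cast
  constructor <;> omega

lemma half_sub_QD {l : ℕ} (hl : 0 < l) (k : ℕ) {m o : Zn n} (ho : o ∈ nbox n l) :
    dyadicCubeHalf n (k + cc l) m ⊆ QD n l k (anc (cc l) (m + o)) := by
  intro x hx i
  rw [mem_nbox] at ho
  have h1 := ho i
  have h2 := hx i
  have hb : (4 * l * l : ℝ) ≤ 2 ^ cc l := by exact_mod_cast cc_bound l
  have hpos : (0 : ℤ) < 2 ^ cc l := by positivity
  have hl' : (0 : ℝ) < l := by exact_mod_cast hl
  set a := anc (cc l) (m + o) i with ha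
  have e1 : a * 2 ^ cc l ≤ m i + o i := Int.ediv_mul_le _ hpos.ne'
  have e2 : m i + o i < (a + 1) * 2 ^ cc l := Int.lt_ediv_add_one_mul_self _ hpos
  have f1 : (a : ℝ) * 2 ^ cc l ≤ m i := by
    have : a * 2 ^ cc l ≤ m i := by omega
    exact_mod_cast this
  have f2 : (m i : ℝ) + 1 ≤ (a + 1) * 2 ^ cc l + l := by
    have : m i + 1 ≤ (a + 1) * 2 ^ cc l + l := by omega
    exact_mod_cast this
  have hP : (0 : ℝ) < 2 ^ cc l := by positivity
  have hk : (0 : ℝ) < 2 ^ k := by positivity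
  rw [pow_add] at h2
  generalize (2 : ℝ) ^ cc l = N at *
  generalize (2 : ℝ) ^ k = M at *
  rw [div_le_iff₀ (by positivity), lt_div_iff₀ (by positivity)] at h2
  rw [div_le_iff₀ hk, le_div_iff₀ hk]
  have g1 : (l : ℝ) ≤ (1 / (4 * l)) * N := by
    rw [div_mul_eq_mul_div, le_div_iff₀ (by positivity)]; nlinarith
  have hq : (0 : ℝ) < 1 / (4 * l) := by positivity
  generalize (1 : ℝ) / (4 * l) = w at *
  constructor
  · refine le_of_mul_le_mul_right ?_ hP
    nlinarith
  · refine le_of_mul_le_mul_right ?_ hP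
    nlinarith

lemma eLp_tri {α : Type*} [MeasurableSpace α] {μ : Measure α} {f g h : α → ℝ} (hf : Measurable f) (hg : Measurable g)
    (hh : Measurable h) (r : ℝ≥0∞) : eLpNorm (fun x => f x - h x) r μ ≤
      LpAddConst r * (eLpNorm (fun x => f x - g x) r μ + eLpNorm (fun x => g x - h x) r μ) := by
  have := eLpNorm_add_le' (μ := μ) (hf.sub hg).aestronglyMeasurable (hg.sub hh).aestronglyMeasurable r
  refine le_trans (le_of_eq ?_) this
  congr 1; funext x; simp

lemma eLp_symm {α : Type*} [MeasurableSpace α] {μ : Measure α} (f g : α → ℝ) (r : ℝ≥0∞) :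
    eLpNorm (fun x => f x - g x) r μ = eLpNorm (fun x => g x - f x) r μ := by
  rw [← eLpNorm_neg]; congr 1; funext x; simp

lemma eLp_half_const (hr : 0 < r) (k : ℕ) (m : Zn n) {f : Rn n → ℝ} {c : ℝ≥0∞}
    (h : ∀ x ∈ dyadicCubeHalf n k m, ‖f x‖ₑ ≤ c) :
    2 ^ (((k * n : ℕ) : ℝ) / r.toReal) * eLpNorm f r (volume.restrict (dyadicCubeHalf n k m)) ≤ c := by
  rw [eLpNorm_eq_lpNormE hr]
  have h1 : lpNormE r (volume.restrict (dyadicCubeHalf n k m)) (fun x => ‖f x‖ₑ) ≤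
      c * 2 ^ (-((k * n : ℕ) : ℝ) / r.toReal) := by
    rw [← lpNormE_const_half hr]
    apply lpNormE_mono_ae
    filter_upwards [ae_restrict_mem (measurableSet_half k m)] with x hx using h x hx
  refine (mul_le_mul' le_rfl h1).trans (le_of_eq ?_)
  rw [mul_left_comm, neg_div, two_rpow_mul_neg, mul_one]

lemma spl_enorm (l k : ℕ) (b : Zn n → ℝ) (x : Rn n) :
    ‖splineSum n l k b x‖ₑ ≤ ENNReal.ofReal ((4 ^ l) ^ n) * ∑ o ∈ nbox n l, ENNReal.ofReal |b (fl k x + o)| := by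
  rw [Real.enorm_eq_ofReal_abs, ← ENNReal.ofReal_sum_of_nonneg (fun _ _ => abs_nonneg _),
    ← ENNReal.ofReal_mul (by positivity)]
  exact ENNReal.ofReal_le_ofReal (splineSum_abs l k b x)

lemma glue {l : ℕ} (hl : 0 < l) (hr : 0 < r) : ∃ C : ℝ≥0∞, C < ∞ ∧ ∀ φ : Rn n → ℝ, Measurable φ →
    ∀ (k : ℕ) (e : Zn n → Zn n → ℝ) (m0 : Zn n),
    2 ^ ((((k + cc l) * n : ℕ) : ℝ) / r.toReal) *
      eLpNorm (fun x => φ x - splineSum n l (k + cc l) (fun m => e (anc (cc l) m) m) x) r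
        (volume.restrict (dyadicCubeHalf n (k + cc l) m0)) ≤
    C * ∑ o ∈ box n 1, (2 ^ (((k * n : ℕ) : ℝ) / r.toReal) *
      eLpNorm (fun x => φ x - splineSum n l (k + cc l) (e (anc (cc l) m0 + o)) x) r
        (volume.restrict (QD n l k (anc (cc l) m0 + o)))) := by
  obtain ⟨Cs, hCs, hst⟩ := spline_stable (n := n) hl hr
  set L := LpAddConst r with hL
  have hLf : L < ∞ := LpAddConst_lt_top r
  set w : ℝ≥0∞ := 2 ^ (((cc l * n : ℕ) : ℝ) / r.toReal) with hw
  have hwf : w < ∞ := two_rpow_lt _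
  set c1 := Cs * (L * (w + w)) with hc1
  set c2 := ENNReal.ofReal ((4 ^ l) ^ n) * ((nbox n l).card * c1) with hc2
  refine ⟨L * (w + c2), by finiteness, fun φ hφ k e m0 => ?_⟩
  set D := ∑ o ∈ box n 1, (2 ^ (((k * n : ℕ) : ℝ) / r.toReal) *
      eLpNorm (fun x => φ x - splineSum n l (k + cc l) (e (anc (cc l) m0 + o)) x) r
        (volume.restrict (QD n l k (anc (cc l) m0 + o)))) with hD
  set W : ℝ≥0∞ := 2 ^ ((((k + cc l) * n : ℕ) : ℝ) / r.toReal) with hW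
  have hWw : W = w * 2 ^ (((k * n : ℕ) : ℝ) / r.toReal) := by
    rw [hW, hw, ← two_rpow_add]; congr 1; push_cast; ring
  set μ := volume.restrict (dyadicCubeHalf n (k + cc l) m0) with hμ
  have hE : ∀ o ∈ nbox n l, W * eLpNorm (fun x => φ x - splineSum n l (k + cc l) (e (anc (cc l) (m0 + o))) x) r μ ≤ w * D := by
    intro o ho
    rw [hWw, mul_assoc]
    refine mul_le_mul' le_rfl ?_
    have hδ := anc_near l (m := m0) ho
    have h2 := Finset.single_le_sum (f := fun o => (2 : ℝ≥0∞) ^ (((k * n : ℕ) : ℝ) / r.toReal) *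
      eLpNorm (fun x => φ x - splineSum n l (k + cc l) (e (anc (cc l) m0 + o)) x) r
        (volume.restrict (QD n l k (anc (cc l) m0 + o)))) (fun _ _ => zero_le) hδ
    refine le_trans ?_ h2
    rw [add_sub_cancel]
    exact mul_le_mul' le_rfl (eLpNorm_mono_measure _ (Measure.restrict_mono (half_sub_QD hl k ho) le_rfl))
  have h0 : (0 : Zn n) ∈ nbox n l := by rw [mem_nbox]; intro i; simp
  have hE0 := hE 0 h0
  rw [add_zero] at hE0
  have hco : ∀ o ∈ nbox n l, ENNReal.ofReal |e (anc (cc l) (m0 + o)) (m0 + o) - e (anc (cc l) m0) (m0 + o)| ≤ c1 * D := by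
    intro o ho
    have h1 := hst (k + cc l) (fun m => e (anc (cc l) (m0 + o)) m - e (anc (cc l) m0) m) m0 o ho
    refine h1.trans ?_
    rw [hc1, mul_assoc]
    refine mul_le_mul' le_rfl ?_
    have h2 : splineSum n l (k + cc l) (fun m => e (anc (cc l) (m0 + o)) m - e (anc (cc l) m0) m) =
      fun x => splineSum n l (k + cc l) (e (anc (cc l) (m0 + o))) x - splineSum n l (k + cc l) (e (anc (cc l) m0)) x :=
      funext fun x => splineSum_sub _ _ _ _ x
    rw [h2, ← hW, ← hμ]
    refine (mul_le_mul' le_rfl (eLp_tri (splineSum_measurable _ _ _) hφ (splineSum_measurable _ _ _) r)).trans ?_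
    rw [mul_left_comm, mul_add W, mul_assoc L, add_mul, eLp_symm _ φ]
    exact mul_le_mul' le_rfl (add_le_add (hE o ho) hE0)
  have hS : W * eLpNorm (fun x => splineSum n l (k + cc l) (e (anc (cc l) m0)) x -
      splineSum n l (k + cc l) (fun m => e (anc (cc l) m) m) x) r μ ≤ c2 * D := by
    rw [eLp_symm]
    refine eLp_half_const hr _ _ fun x hx => ?_
    rw [← splineSum_sub]
    refine (spl_enorm _ _ _ _).trans ?_
    rw [hc2, mul_assoc]
    refine mul_le_mul' le_rfl ?_
    rw [mem_half_iff] at hx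
    rw [hx, mul_assoc, ← nsmul_eq_mul]
    exact Finset.sum_le_card_nsmul _ _ _ fun o ho => hco o ho
  refine (mul_le_mul' le_rfl (eLp_tri hφ (splineSum_measurable l (k + cc l) (e (anc (cc l) m0))) (splineSum_measurable _ _ _) r)).trans ?_
  rw [mul_left_comm, mul_add, mul_assoc, add_mul]
  exact mul_le_mul' le_rfl (add_le_add hE0 hS)

end P17

section P18
variable {n : ℕ} {p q r : ℝ≥0∞}

lemma lqNorm_add_le {ι : Type*} [Countable ι] (hq : 0 < q) (a b : ι → ℝ≥0∞) :
    lqNorm q (fun i => a i + b i) ≤ Kq q 2 * (lqNorm q a + lqNorm q b) := by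
  have := lqNorm_sum_le hq (Finset.univ : Finset Bool) (fun i => a i + b i)
    (fun j i => if j then a i else b i) (fun i => by simp)
  simpa using this

lemma tendsto_two_rpow {ε : ℝ} (hε : 0 < ε) : Tendsto (fun K : ℕ => (2 : ℝ≥0∞) ^ (-ε * (K : ℝ))) atTop (nhds 0) := by
  have h : (fun K : ℕ => (2 : ℝ≥0∞) ^ (-ε * (K : ℝ))) = fun K => ((2 : ℝ≥0∞) ^ (-ε)) ^ K := by
    funext K; rw [ENNReal.rpow_mul, ENNReal.rpow_natCast]
  rw [h]
  apply ENNReal.tendsto_pow_atTop_nhds_zero_of_lt_one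
  exact ENNReal.rpow_lt_one_of_one_lt_of_neg (by norm_num) (by linarith)

lemma half_zero_sub {m : Zn n} {x : Rn n} (hx : x ∈ dyadicCubeHalf n 0 m) :
    dyadicCubeHalf n 0 m ⊆ openCube x 1 := by
  intro y hy i
  have h1 := hx i
  have h2 := hy i
  simp only [pow_zero, div_one] at h1 h2
  rw [abs_lt]; constructor <;> linarith [h1.1, h1.2, h2.1, h2.2]

lemma anc_fl_sub {K : ℕ} (m : Zn n) : dyadicCubeHalf n (K + 1) m ⊆ dyadicCubeHalf n K (anc 1 m) := by
  have := half_subset (n := n) (Nat.le_succ K) m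
  simpa using this

lemma part1 {l : ℕ} (hl : 0 < l) (hp : 0 < p) (hq : 0 < q) (hr : 0 < r) {t : ℕ → Rn n → ℝ}
    (ht : pAdmissible n p t) {ε α₂ : ℝ} (hε : 0 < ε) {C0 A : ℝ≥0∞} (hT : WT n p r (tkm n p t) ε α₂ C0 A) :
    ∃ C : ℝ≥0∞, C < ∞ ∧ ∀ φ : Rn n → ℝ, MemTildeB n l p q r t φ →
        ∃ β : ℕ → (Fin n → ℤ) → ℝ,
          (∀ K : Set (Rn n), IsCompact K →
            Filter.Tendsto (fun N : ℕ =>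
                eLpNorm (fun x => (∑ k ∈ Finset.range N, splineSum n l k (β k) x) - φ x) r
                  (volume.restrict K)) Filter.atTop (nhds 0)) ∧
          lqNorm q (fun k : ℕ => lqNorm p (fun m : Fin n → ℤ =>
              tkm n p t k m * ENNReal.ofReal |β k m|)) ≤
            C * tildeBnorm n l p q r t φ := by
  obtain ⟨Cw, hCw, hwhit⟩ := whit_loc (n := n) hl hr
  obtain ⟨Cg, hCg, hglue⟩ := glue (n := n) hl hr
  obtain ⟨Cs, hCs, hst⟩ := spline_stable (n := n) hl hr
  obtain ⟨Cp, hCp, hsplit⟩ := lqNorm_split hq (cc l + 1)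
  have hC0 := hT.hC
  have hA := hT.hA
  set L := LpAddConst r with hL
  have hLf : L < ∞ := LpAddConst_lt_top r
  set c := cc l with hc
  set T := tkm n p t with hTdef
  set w : ℝ≥0∞ := 2 ^ (((c * n : ℕ) : ℝ) / r.toReal) with hw
  have hwf : w < ∞ := two_rpow_lt _
  set w1 : ℝ≥0∞ := 2 ^ ((n : ℝ) / r.toReal) with hw1
  have hw1f : w1 < ∞ := two_rpow_lt _
  set v : ℝ≥0∞ := 2 ^ (|α₂| * c) with hv
  have hvf : v < ∞ := two_rpow_lt _
  set v1 : ℝ≥0∞ := 2 ^ α₂ with hv1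
  have hv1f : v1 < ∞ := two_rpow_lt _
  set C1 := C0 * v * w with hC1
  set C2 := Cg * (Kq p (box n 1).card * ((box n 1).card * (C0 * A * v * Cw))) with hC2
  have hKp := Kq_lt_top hp (box n 1).card
  have hKp2 := Kq_lt_top hp 2
  have hKq2 := Kq_lt_top hq 2
  set C3 := Cp * ((c + 1 : ℕ) * C1 + C2) with hC3
  set C4 := Cs * L * (Kq p 2 * (1 + w1 * (C0 * v1))) with hC4
  have hz : (2 : ℝ≥0∞) ^ (1 / q.toReal) < ∞ := two_rpow_lt _
  have hC1f : C1 < ∞ := ENNReal.mul_lt_top (ENNReal.mul_lt_top hC0 hvf) hwf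
  have hC2f : C2 < ∞ := ENNReal.mul_lt_top hCg (ENNReal.mul_lt_top hKp
    (ENNReal.mul_lt_top (ENNReal.natCast_lt_top _) (ENNReal.mul_lt_top (ENNReal.mul_lt_top (ENNReal.mul_lt_top hC0 hA) hvf) hCw)))
  have hC3f : C3 < ∞ := ENNReal.mul_lt_top hCp (ENNReal.add_lt_top.2
    ⟨ENNReal.mul_lt_top (ENNReal.natCast_lt_top _) hC1f, hC2f⟩)
  have hC4f : C4 < ∞ := ENNReal.mul_lt_top (ENNReal.mul_lt_top hCs hLf) (ENNReal.mul_lt_top hKp2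
    (ENNReal.add_lt_top.2 ⟨ENNReal.one_lt_top, ENNReal.mul_lt_top hw1f (ENNReal.mul_lt_top hC0 hv1f)⟩))
  refine ⟨2 ^ (1 / q.toReal) * (C4 * (Kq q 2 * (C3 + C3))), ENNReal.mul_lt_top hz (ENNReal.mul_lt_top hC4f
    (ENNReal.mul_lt_top hKq2 (ENNReal.add_lt_top.2 ⟨hC3f, hC3f⟩))), fun φ hφ => ?_⟩
  obtain ⟨hloc, hfin⟩ := hφ
  choose b hb using hwhit φ hloc
  have hex : ∀ k m, ∃ e : Zn n → ℝ, splineSum n l (k + 1) (b k m) = splineSum n l (k + 1 + c) e :=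
    fun k m => splineSum_refines l (by omega) _
  choose e he using hex
  set bk : ℕ → ℝ≥0∞ := fun k => lpNormE p volume (fun x => ENNReal.ofReal (t (k + 1) x) *
    deltaE n l r ((2 : ℝ) ^ (1 - ((k : ℤ) + 1))) (openCube x ((2 : ℝ) ^ (-((k : ℤ) + 1)))) φ) with hbk
  set b0 : ℝ≥0∞ := lpNormE p volume (fun x => ENNReal.ofReal (t 0 x) * eLpNorm φ r (volume.restrict (openCube x 1))) with hb0
  have hnorm : tildeBnorm n l p q r t φ = lqNorm q bk + b0 := rfl
  set d : ℕ → Zn n → ℝ≥0∞ := fun k m => 2 ^ ((((k + 1) * n : ℕ) : ℝ) / r.toReal) *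
    eLpNorm (fun x => φ x - splineSum n l (k + 1 + c) (e k m) x) r (volume.restrict (QD n l (k + 1) m)) with hd
  have hd1 : ∀ k, lqNorm p (fun m => T (k + 1) m * d k m) ≤ Cw * bk k := by
    intro k
    refine (link_low hp ht (k + 1) (d k) (fun x => Cw * deltaE n l r ((2 : ℝ) ^ (1 - ((k : ℤ) + 1)))
      (openCube x ((2 : ℝ) ^ (-((k : ℤ) + 1)))) φ) fun m x hx => ?_).trans (le_of_eq ?_)
    · rw [hd]
      show (2 : ℝ≥0∞) ^ ((((k + 1) * n : ℕ) : ℝ) / r.toReal) * _ ≤ _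
      rw [← he k m]
      exact hb k m x hx
    · rw [hbk]
      show _ = Cw * lpNormE p volume _
      rw [← lpNormE_const_mul hp hCw.ne]
      congr 1; funext x; ring
  set s : ℕ → Zn n → ℝ := fun K m => if K ≤ c then 0 else e (K - c - 1) (anc c m) m with hs
  set S : ℕ → Rn n → ℝ := fun K => splineSum n l K (s K) with hS
  have hSm : ∀ K, Measurable (S K) := fun K => splineSum_measurable _ _ _
  have hS0 : ∀ K, K ≤ c → ∀ x, S K x = 0 := by
    intro K hK x
    have : s K = fun _ => 0 := by funext m; simp [hs, hK]
    rw [hS]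
    show splineSum n l K (s K) x = 0
    rw [this, splineSum_zero]
  have hS1 : ∀ k, S (k + 1 + c) = splineSum n l (k + 1 + c) (fun m => e k (anc c m) m) := by
    intro k
    have : s (k + 1 + c) = fun m => e k (anc c m) m := by
      funext m
      have h1 : ¬ (k + 1 + c ≤ c) := by omega
      have h2 : k + 1 + c - c - 1 = k := by omega
      simp only [hs, h1, if_false, h2]
    show splineSum n l (k + 1 + c) (s (k + 1 + c)) = _
    rw [this]
  set G : ℕ → Zn n → ℝ≥0∞ := fun K m => 2 ^ (((K * n : ℕ) : ℝ) / r.toReal) *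
    eLpNorm (fun x => φ x - S K x) r (volume.restrict (dyadicCubeHalf n K m)) with hG
  set g : ℕ → ℝ≥0∞ := fun K => lqNorm p (fun m => T K m * G K m) with hg
  have hv2 : ∀ K : ℕ, K ≤ c → (2 : ℝ≥0∞) ^ (α₂ * (K : ℝ)) ≤ v := by
    intro K hK
    refine ENNReal.rpow_le_rpow_of_exponent_le (by norm_num) ?_
    have h1 : (K : ℝ) ≤ c := by exact_mod_cast hK
    calc α₂ * K ≤ |α₂| * K := mul_le_mul_of_nonneg_right (le_abs_self _) (by positivity)
      _ ≤ _ := mul_le_mul_of_nonneg_left h1 (abs_nonneg _)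
  have hgs : ∀ K, K ≤ c → g K ≤ C1 * b0 := by
    intro K hK
    have h1 : ∀ m, T K m * G K m ≤ T K m * (w * eLpNorm φ r (volume.restrict (dyadicCubeHalf n 0 (anc (K - 0) m + 0)))) := by
      intro m
      refine mul_le_mul' le_rfl (mul_le_mul' ?_ ?_)
      · refine ENNReal.rpow_le_rpow_of_exponent_le (by norm_num) ?_
        refine div_le_div_of_nonneg_right ?_ ENNReal.toReal_nonneg
        exact_mod_cast Nat.mul_le_mul_right n hK
      · simp only [hS0 K hK, sub_zero]
        rw [add_zero]
        exact eLpNorm_mono_measure _ (Measure.restrict_mono (half_subset (Nat.zero_le K) m) le_rfl)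
    refine (lqNorm_mono h1).trans ?_
    refine (hT.LOW hp 0 (Nat.zero_le K) (fun m => w * eLpNorm φ r (volume.restrict (dyadicCubeHalf n 0 m))) 0 (by simp)).trans ?_
    have h2 : lqNorm p (fun m => T 0 m * (w * eLpNorm φ r (volume.restrict (dyadicCubeHalf n 0 m)))) ≤ w * b0 := by
      simp only [mul_left_comm _ w]
      rw [lqNorm_const_mul hp]
      refine mul_le_mul' le_rfl (link_low hp ht 0 _ _ fun m x hx => ?_)
      exact eLpNorm_mono_measure _ (Measure.restrict_mono (half_zero_sub hx) le_rfl)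
    refine (mul_le_mul' (mul_le_mul' le_rfl ?_) h2).trans (le_of_eq ?_) (b := C0 * A ^ 0 * v * (w * b0))
    · have := hv2 K hK; simpa using this
    · rw [hC1, pow_zero]; ring
  have hgb : ∀ k, g (k + 1 + c) ≤ C2 * bk k := by
    intro k
    have h1 : ∀ m, T (k + 1 + c) m * G (k + 1 + c) m ≤
        Cg * ∑ o ∈ box n 1, T (k + 1 + c) m * d k (anc c m + o) := by
      intro m
      have := hglue φ hloc.1 (k + 1) (e k) m
      rw [← Finset.mul_sum, mul_left_comm Cg]
      refine mul_le_mul' le_rfl ?_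
      show (2 : ℝ≥0∞) ^ ((((k + 1 + c) * n : ℕ) : ℝ) / r.toReal) * eLpNorm (fun x => φ x - S (k + 1 + c) x) r _ ≤ _
      rw [hS1]
      exact this
    refine (lqNorm_mono h1).trans ?_
    rw [lqNorm_const_mul hp, hC2, mul_assoc]
    refine mul_le_mul' le_rfl ?_
    refine (lqNorm_sum_le hp (box n 1) _ (fun o m => T (k + 1 + c) m * d k (anc c m + o)) fun m => le_rfl).trans ?_
    rw [mul_assoc]
    refine mul_le_mul' le_rfl ?_
    rw [mul_assoc, ← nsmul_eq_mul]
    refine Finset.sum_le_card_nsmul _ _ _ fun o ho => ?_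
    have h3 := hT.LOW hp 1 (k := k + 1) (K := k + 1 + c) (by omega) (d k) o (mem_box.1 ho)
    rw [show k + 1 + c - (k + 1) = c by omega] at h3
    refine h3.trans ?_
    rw [pow_one, mul_assoc _ Cw]
    refine mul_le_mul' (mul_le_mul' le_rfl ?_) (hd1 k)
    refine le_trans (le_of_eq ?_) (hv2 c le_rfl)
    congr 1; push_cast; ring
  have hgq : lqNorm q g ≤ C3 * tildeBnorm n l p q r t φ := by
    refine (hsplit g).trans ?_
    rw [hC3, mul_assoc, hnorm]
    refine mul_le_mul' le_rfl ?_
    rw [add_comm (lqNorm q bk), mul_add, add_mul, add_mul]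
    have h1 : ∑ i ∈ Finset.range (c + 1), g i ≤ (c + 1 : ℕ) * C1 * b0 := by
      rw [mul_assoc, ← nsmul_eq_mul]
      refine (Finset.sum_le_card_nsmul _ _ (C1 * b0) fun i hi => ?_).trans (by simp)
      exact hgs i (by simpa [Nat.lt_succ_iff] using hi)
    have h2 : lqNorm q (fun k => g (k + (c + 1))) ≤ C2 * lqNorm q bk := by
      rw [← lqNorm_const_mul hq]
      refine lqNorm_mono fun k => ?_
      have := hgb k
      rwa [show k + 1 + c = k + (c + 1) by omega] at this
    exact add_le_add (h1.trans le_self_add) (h2.trans le_add_self)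
  have hex2 : ∀ K, ∃ ρ : Zn n → ℝ, S K = splineSum n l (K + 1) ρ := fun K => splineSum_refine l K _
  choose ρ hρ using hex2
  set β : ℕ → Zn n → ℝ := fun K => Nat.casesOn K (fun _ => 0) (fun K m => s (K + 1) m - ρ K m) with hβ
  have hβ0 : β 0 = fun _ => 0 := rfl
  have hβ1 : ∀ K, β (K + 1) = fun m => s (K + 1) m - ρ K m := fun K => rfl
  have hβS : ∀ K x, splineSum n l (K + 1) (β (K + 1)) x = S (K + 1) x - S K x := by
    intro K x
    rw [hβ1, splineSum_sub, ← hρ]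
  have htel : ∀ N x, ∑ k ∈ Finset.range (N + 1), splineSum n l k (β k) x = S N x := by
    intro N x
    induction N with
    | zero => rw [Finset.sum_range_one, hβ0, splineSum_zero, hS0 0 (Nat.zero_le _)]
    | succ N ih => rw [Finset.sum_range_succ, ih, hβS]; ring
  refine ⟨β, fun K hK => ?_, ?_⟩
  · refine tendsto_compact hr _ (fun m => ?_) hK
    rw [← tendsto_add_atTop_iff_nat 1]
    simp only [htel]
    have hM : lqNorm q g < ∞ := hgq.trans_lt (ENNReal.mul_lt_top hC3f hfin)
    have hb : ∀ N : ℕ, eLpNorm (fun x => S N x - φ x) r (volume.restrict (dyadicCubeHalf n 0 m)) ≤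
        ((T 0 m)⁻¹ * (C0 * lqNorm q g)) * 2 ^ (-ε * (N : ℝ)) := by
      intro N
      have h1 := hT.HIGHf hp hr 0 (Nat.zero_le N) 0 (by simp) (fun x => φ x - S N x)
      have h2 := (le_lqNorm hp _ m).trans h1
      simp only [zero_mul, Nat.cast_zero, zero_div, ENNReal.rpow_zero, one_mul, add_zero, pow_zero, mul_one, sub_zero] at h2
      have h3 : lqNorm p (fun m => T N m * (2 ^ (((N * n : ℕ) : ℝ) / r.toReal) *
        eLpNorm (fun x => φ x - S N x) r (volume.restrict (dyadicCubeHalf n N m)))) ≤ lqNorm q g := le_lqNorm hq g N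
      have h4 := h2.trans (mul_le_mul' le_rfl h3)
      rw [eLp_symm]
      calc _ = (T 0 m)⁻¹ * (T 0 m * eLpNorm (fun x => φ x - S N x) r (volume.restrict (dyadicCubeHalf n 0 m))) := by
            rw [← mul_assoc, ENNReal.inv_mul_cancel (hT.pos 0 m).ne' (hT.fin 0 m).ne, one_mul]
        _ ≤ (T 0 m)⁻¹ * (C0 * 2 ^ (-ε * (N : ℝ)) * lqNorm q g) := mul_le_mul' le_rfl h4
        _ = _ := by ring
    refine tendsto_of_tendsto_of_tendsto_of_le_of_le tendsto_const_nhds ?_ (fun _ => zero_le) hb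
    have hTi : (T 0 m)⁻¹ < ∞ := ENNReal.inv_lt_top.2 (hT.pos 0 m)
    have := ENNReal.Tendsto.const_mul (a := (T 0 m)⁻¹ * (C0 * lqNorm q g)) (tendsto_two_rpow hε) (Or.inr (ENNReal.mul_lt_top hTi (ENNReal.mul_lt_top hC0 hM)).ne)
    simpa using this
  · have hB : ∀ K, lqNorm p (fun m => T (K + 1) m * ENNReal.ofReal |β (K + 1) m|) ≤ C4 * (g (K + 1) + g K) := by
      intro K
      have h1 : ∀ m, T (K + 1) m * ENNReal.ofReal |β (K + 1) m| ≤
          (Cs * L) * (T (K + 1) m * G (K + 1) m + w1 * (T (K + 1) m * G K (anc (K + 1 - K) m + 0))) := by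
        intro m
        have h2 := hst (K + 1) (β (K + 1)) m 0 (by rw [mem_nbox]; intro i; simp)
        rw [add_zero, show splineSum n l (K + 1) (β (K + 1)) = fun x => S (K + 1) x - S K x from funext (hβS K)] at h2
        have h3 := eLp_tri (μ := volume.restrict (dyadicCubeHalf n (K + 1) m)) (hSm (K + 1)) hloc.1 (hSm K) r
        rw [eLp_symm _ φ] at h3
        have h4 : 2 ^ ((((K + 1) * n : ℕ) : ℝ) / r.toReal) *
            eLpNorm (fun x => φ x - S K x) r (volume.restrict (dyadicCubeHalf n (K + 1) m)) ≤ w1 * G K (anc (K + 1 - K) m + 0) := by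
          rw [show K + 1 - K = 1 by omega, add_zero, hG, hw1]
          show _ ≤ (2 : ℝ≥0∞) ^ ((n : ℝ) / r.toReal) * (2 ^ (((K * n : ℕ) : ℝ) / r.toReal) * _)
          rw [← mul_assoc, ← two_rpow_add]
          refine mul_le_mul' (le_of_eq ?_) (eLpNorm_mono_measure _ (Measure.restrict_mono (anc_fl_sub m) le_rfl))
          congr 1; push_cast; ring
        refine (mul_le_mul' le_rfl (h2.trans (mul_le_mul' le_rfl (mul_le_mul' le_rfl h3)))).trans ?_
        rw [mul_left_comm (2 ^ _) L, mul_add (2 ^ _)]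
        refine (mul_le_mul' le_rfl (mul_le_mul' le_rfl (mul_le_mul' le_rfl (add_le_add le_rfl h4)))).trans (le_of_eq ?_)
        rw [hG]
        ring
      refine (lqNorm_mono h1).trans ?_
      rw [lqNorm_const_mul hp, hC4, mul_assoc (Cs * L)]
      refine mul_le_mul' le_rfl ((lqNorm_add_le hp _ _).trans ?_)
      rw [mul_assoc]
      refine mul_le_mul' le_rfl ?_
      rw [lqNorm_const_mul hp]
      have h5 := hT.LOW hp 0 (k := K) (K := K + 1) (by omega) (G K) 0 (by simp)
      have h6 : lqNorm p (fun m => T (K + 1) m * G K (anc (K + 1 - K) m + 0)) ≤ C0 * v1 * g K := by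
        refine h5.trans (le_of_eq ?_)
        rw [pow_zero, mul_one, hv1]; congr 3; push_cast; ring
      calc g (K + 1) + w1 * lqNorm p (fun m => T (K + 1) m * G K (anc (K + 1 - K) m + 0)) ≤
          g (K + 1) + w1 * (C0 * v1 * g K) := add_le_add le_rfl (mul_le_mul' le_rfl h6)
        _ ≤ (1 * g (K + 1) + 1 * g K) + (w1 * (C0 * v1) * g (K + 1) + w1 * (C0 * v1) * g K) := by
          rw [one_mul, one_mul, ← mul_assoc]
          exact add_le_add le_self_add le_add_self
        _ = _ := by ring
    refine (lqNorm_succ hq _).trans ?_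
    rw [mul_assoc]
    refine mul_le_mul' le_rfl ?_
    have h0 : lqNorm p (fun m => T 0 m * ENNReal.ofReal |β 0 m|) = 0 := by
      rw [hβ0]; simp only [abs_zero, ENNReal.ofReal_zero, mul_zero]; exact lqNorm_zero hp
    rw [h0, zero_add]
    refine (lqNorm_mono hB).trans ?_
    rw [lqNorm_const_mul hq, mul_assoc C4]
    refine mul_le_mul' le_rfl ((lqNorm_add_le hq _ _).trans ?_)
    rw [mul_assoc (Kq q 2), add_mul]
    refine mul_le_mul' le_rfl (add_le_add ?_ hgq)
    exact (lqNorm_comp_le g (add_left_injective 1)).trans hgq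

end P18

section P19
variable {n : ℕ} {p q r : ℝ≥0∞}

lemma fl_near {k N : ℕ} {x y : Rn n} (h : ∀ i, |y i - x i| < N / 2 ^ k) : fl k y - fl k x ∈ box n N := by
  rw [mem_box]; intro i
  have h2 : (0 : ℝ) < 2 ^ k := by positivity
  have h1 := h i
  rw [abs_lt, lt_div_iff₀ h2, ← neg_div, div_lt_iff₀ h2] at h1
  have a1 := Int.floor_le ((2 : ℝ) ^ k * x i)
  have a2 := Int.lt_floor_add_one ((2 : ℝ) ^ k * x i)
  have b1 := Int.floor_le ((2 : ℝ) ^ k * y i)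
  have b2 := Int.lt_floor_add_one ((2 : ℝ) ^ k * y i)
  simp only [Pi.sub_apply, fl]
  have c1 : (⌊(2 : ℝ) ^ k * y i⌋ : ℝ) < ⌊(2 : ℝ) ^ k * x i⌋ + N + 1 := by nlinarith
  have c2 : (⌊(2 : ℝ) ^ k * x i⌋ : ℝ) < ⌊(2 : ℝ) ^ k * y i⌋ + N + 1 := by nlinarith
  have d1 : ⌊(2 : ℝ) ^ k * y i⌋ < ⌊(2 : ℝ) ^ k * x i⌋ + N + 1 := by exact_mod_cast c1
  have d2 : ⌊(2 : ℝ) ^ k * x i⌋ < ⌊(2 : ℝ) ^ k * y i⌋ + N + 1 := by exact_mod_cast c2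
  rw [abs_le]; omega

lemma cube_cover (hr : 0 < r) {k N : ℕ} {m0 : Zn n} {x0 : Rn n} (hx : x0 ∈ dyadicCubeHalf n k m0)
    (f : Rn n → ℝ) :
    eLpNorm f r (volume.restrict (openCube x0 (N / 2 ^ k))) ≤
      Kq r (box n N).card * ∑ o ∈ box n N, eLpNorm f r (volume.restrict (dyadicCubeHalf n k (m0 + o))) := by
  have e1 : ∑ o ∈ box n N, eLpNorm f r (volume.restrict (dyadicCubeHalf n k (m0 + o))) =
      ∑ m ∈ (box n N).map (addLeftEmbedding m0), eLpNorm f r (volume.restrict (dyadicCubeHalf n k m)) := by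
    rw [Finset.sum_map]; rfl
  rw [e1, ← Finset.card_map (addLeftEmbedding m0)]
  refine le_trans ?_ (lqNorm_single hr _ _)
  rw [eLpNorm_eq_lpNormE hr, lpNormE_fiber hr _ (measurableSet_half k) (half_disj k) (half_cover k)]
  refine lqNorm_mono fun m => ?_
  split_ifs with h
  · rw [eLpNorm_eq_lpNormE hr, Measure.restrict_restrict (measurableSet_half k m)]
    exact lpNormE_mono_measure (Measure.restrict_mono Set.inter_subset_left le_rfl)
  · rw [Measure.restrict_restrict (measurableSet_half k m)]
    have : dyadicCubeHalf n k m ∩ openCube x0 (N / 2 ^ k) = ∅ := by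
      ext x
      simp only [Set.mem_inter_iff, Set.mem_empty_iff_false, iff_false, not_and]
      intro hx1 hxK
      apply h
      rw [mem_half_iff] at hx hx1
      have := fl_near (k := k) hxK
      rw [hx, hx1] at this
      exact Finset.mem_map.2 ⟨_, this, by simp [addLeftEmbedding]⟩
    rw [this, Measure.restrict_empty, lpNormE_zero_measure hr]

lemma openCube_meas (x : Rn n) (s : ℝ) : MeasurableSet (openCube x s) := by
  have : openCube x s = ⋂ i, {y : Rn n | |y i - x i| < s} := by ext y; simp [openCube]
  rw [this]
  refine MeasurableSet.iInter fun i => ?_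
  exact measurableSet_lt (by fun_prop) measurable_const

lemma openCube_vol (x : Rn n) (s : ℝ) : volume (openCube x s) = ENNReal.ofReal (2 * s) ^ n := by
  have : openCube x s = Set.pi Set.univ (fun i => Set.Ioo (x i - s) (x i + s)) := by
    ext y
    simp only [openCube, Set.mem_ofPred_eq, Set.mem_pi, Set.mem_univ, true_imp_iff, Set.mem_Ioo, abs_lt]
    refine forall_congr' fun i => ?_
    constructor <;> rintro ⟨h1, h2⟩ <;> constructor <;> linarith
  rw [this, Real.volume_pi_Ioo]
  have : ∀ i, x i + s - (x i - s) = 2 * s := fun i => by ring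
  simp [this]

lemma ofReal_two (a K : ℕ) : ENNReal.ofReal (2 ^ a / 2 ^ K) = (2 : ℝ≥0∞) ^ ((a : ℝ) - K) := by
  rw [ENNReal.ofReal_div_of_pos (by positivity), ENNReal.ofReal_pow (by norm_num), ENNReal.ofReal_pow (by norm_num),
    sub_eq_add_neg, two_rpow_add, ENNReal.rpow_neg, ENNReal.rpow_natCast, ENNReal.rpow_natCast]
  simp [div_eq_mul_inv]

lemma sh_measure {A Q B : Set (Rn n)} (hA : MeasurableSet A) (i : ℝ)
    (hB : ∀ h ∈ A, ∀ x ∈ Q, x + i • h ∈ B) {E : Set (Rn n)} (hE : MeasurableSet E) :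
    ((volume.restrict A).prod (volume.restrict Q)) ((fun z : Rn n × Rn n => z.2 + i • z.1) ⁻¹' E) ≤
      volume A * volume.restrict B E := by
  have hm : Measurable (fun z : Rn n × Rn n => z.2 + i • z.1) := by fun_prop
  rw [Measure.prod_apply (hm hE)]
  calc _ ≤ ∫⁻ h in A, volume.restrict B E := by
        refine setLIntegral_mono' hA fun h hh => ?_
        have e : Prod.mk h ⁻¹' ((fun z : Rn n × Rn n => z.2 + i • z.1) ⁻¹' E) = (fun x => x + i • h) ⁻¹' E := rfl
        rw [e, Measure.restrict_apply ((measurable_add_const _) hE), Measure.restrict_apply hE,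
          ← measure_preimage_add_right volume (i • h) (E ∩ B)]
        refine measure_mono fun x hx => ⟨hx.1, hB h hh x hx.2⟩
    _ = _ := by rw [lintegral_const, Measure.restrict_apply_univ, mul_comm]

lemma shift_mem {K l : ℕ} {x0 h x : Rn n} (hh : h ∈ openCube (0 : Rn n) (2 / 2 ^ K))
    (hx : x ∈ openCube x0 (1 / 2 ^ K)) {i : ℕ} (hi : i ∈ Finset.range (l + 1)) :
    x + (i : ℝ) • h ∈ openCube x0 ((2 * l + 1 : ℕ) / 2 ^ K) := by
  intro a
  have h1 := hh a
  have h2 := hx a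
  have hil : (i : ℝ) ≤ l := by exact_mod_cast Nat.lt_succ_iff.1 (Finset.mem_range.1 hi)
  simp only [Pi.zero_apply, sub_zero] at h1
  simp only [Pi.add_apply, Pi.smul_apply, smul_eq_mul]
  calc |x a + i * h a - x0 a| = |(x a - x0 a) + i * h a| := by ring_nf
    _ ≤ |x a - x0 a| + |i * h a| := abs_add_le _ _
    _ < 1 / 2 ^ K + l * (2 / 2 ^ K) := by
        rw [abs_mul, Nat.abs_cast]
        refine add_lt_add_of_lt_of_le h2 (mul_le_mul hil h1.le (abs_nonneg _) (by positivity))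
    _ = _ := by push_cast; ring

lemma delta_near (l : ℕ) (hr : 0 < r) : ∃ C : ℝ≥0∞, C < ∞ ∧ ∀ S : Rn n → ℝ, Measurable S →
    ∀ (K : ℕ) (m0 : Zn n), ∀ x0 ∈ dyadicCubeHalf n K m0,
      deltaE n l r (2 / 2 ^ K) (openCube x0 (1 / 2 ^ K)) S ≤
        C * ∑ o ∈ box n (2 * l + 1), (2 ^ (((K * n : ℕ) : ℝ) / r.toReal) *
          eLpNorm S r (volume.restrict (dyadicCubeHalf n K (m0 + o)))) := by
  set c : ℝ≥0∞ := ENNReal.ofReal (2 ^ l) with hc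
  have hcf : c < ∞ := ENNReal.ofReal_lt_top
  have hK1 := Kq_lt_top hr (Finset.range (l + 1)).card
  have hK2 := Kq_lt_top hr (box n (2 * l + 1)).card
  refine ⟨Kq r (Finset.range (l + 1)).card * ((Finset.range (l + 1)).card * (c * Kq r (box n (2 * l + 1)).card)),
    ENNReal.mul_lt_top hK1 (ENNReal.mul_lt_top (ENNReal.natCast_lt_top _) (ENNReal.mul_lt_top hcf hK2)),
    fun S hS K m0 x0 hx0 => ?_⟩
  set A := openCube (0 : Rn n) (2 / 2 ^ K) with hA
  set Q := openCube x0 (1 / 2 ^ K) with hQ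
  set B := openCube x0 ((2 * l + 1 : ℕ) / 2 ^ K) with hB
  set μ := (volume.restrict A).prod (volume.restrict Q) with hμ
  have hv : volume A = 2 ^ ((2 - (K : ℝ)) * n) := by
    rw [hA, openCube_vol, show (2 : ℝ) * (2 / 2 ^ K) = 2 ^ 2 / 2 ^ K by ring, ofReal_two, ENNReal.rpow_mul,
      ENNReal.rpow_natCast]; norm_num
  have h1 : eLpNorm (fun hx : Rn n × Rn n => diffl l hx.1 S hx.2) r μ ≤ Kq r (Finset.range (l + 1)).card *
      ∑ i ∈ Finset.range (l + 1), (c * ((volume A) ^ (1 / r.toReal) * eLpNorm S r (volume.restrict B))) := by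
    rw [eLpNorm_eq_lpNormE hr]
    have hm : ∀ i : ℝ, Measurable (fun z : Rn n × Rn n => z.2 + i • z.1) := fun i => by fun_prop
    refine (lpNormE_sum_le hr (Finset.range (l + 1)) _
      (fun i z => c * ‖S (z.2 + (i : ℝ) • z.1)‖ₑ) (fun i => ?_) (Eventually.of_forall fun z => ?_)).trans ?_
    · exact ((hS.comp (hm i)).enorm.const_mul c).aemeasurable
    · unfold diffl
      refine (enorm_sum_le _ _).trans (Finset.sum_le_sum fun i hi => ?_)
      rw [enorm_mul]
      refine mul_le_mul' ?_ le_rfl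
      rw [Real.enorm_eq_ofReal_abs, hc]
      refine ENNReal.ofReal_le_ofReal ?_
      rw [abs_mul, abs_pow, abs_neg, abs_one, one_pow, mul_one, Nat.abs_cast]
      exact_mod_cast Nat.choose_le_two_pow l i
    · refine mul_le_mul' le_rfl (Finset.sum_le_sum fun i hi => ?_)
      rw [lpNormE_const_mul hr hcf.ne, ← eLpNorm_eq_lpNormE hr]
      refine mul_le_mul' le_rfl ?_
      refine eLpNorm_le_of_map (hm i) (by rw [hv]; exact (two_rpow_pos _).ne') (fun E hE => ?_) hS r
      exact sh_measure (openCube_meas _ _) _ (fun h hh x hx => shift_mem hh hx hi) hE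
  have h2 := cube_cover hr (N := 2 * l + 1) hx0 S
  rw [deltaE, ← Finset.mul_sum]
  refine (mul_le_mul' le_rfl h1).trans ?_
  rw [Finset.sum_const, nsmul_eq_mul]
  have e : ENNReal.ofReal (2 / 2 ^ K) ^ (-(2 * (n : ℝ)) / r.toReal) * (volume A) ^ (1 / r.toReal) =
      2 ^ (((K * n : ℕ) : ℝ) / r.toReal) := by
    have := ofReal_two 1 K
    rw [pow_one] at this
    rw [this, hv, ← ENNReal.rpow_mul, ← ENNReal.rpow_mul, ← two_rpow_add]
    congr 1; push_cast; ring
  rw [← e]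
  calc _ = (Kq r (Finset.range (l + 1)).card * ((Finset.range (l + 1)).card * c)) *
      (ENNReal.ofReal (2 / 2 ^ K) ^ (-(2 * (n : ℝ)) / r.toReal) * (volume A) ^ (1 / r.toReal)) *
        eLpNorm S r (volume.restrict B) := by ring
    _ ≤ (Kq r (Finset.range (l + 1)).card * ((Finset.range (l + 1)).card * c)) *
      (ENNReal.ofReal (2 / 2 ^ K) ^ (-(2 * (n : ℝ)) / r.toReal) * (volume A) ^ (1 / r.toReal)) * _ :=
        mul_le_mul' le_rfl h2
    _ = _ := by ring

lemma delta_far (l : ℕ) (_hr : 0 < r) : ∃ C : ℝ≥0∞, C < ∞ ∧ ∀ (b : Zn n → ℝ) (j K : ℕ), j ≤ K → 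
    ∀ (m0 : Zn n), ∀ x0 ∈ dyadicCubeHalf n K m0,
      deltaE n l r (2 / 2 ^ K) (openCube x0 (1 / 2 ^ K)) (splineSum n l j b) ≤
        C * 2 ^ (-(l : ℝ) * ((K : ℝ) - j)) * ∑ o ∈ box n (3 * l + 1), ENNReal.ofReal |b (anc (K - j) m0 + o)| := by
  set c : ℝ := (4 ^ l) ^ n * (4 * n) ^ l with hc
  have hc0 : 0 ≤ c := by positivity
  refine ⟨ENNReal.ofReal c * 2 ^ ((n : ℝ) / r.toReal), ENNReal.mul_lt_top ENNReal.ofReal_lt_top (two_rpow_lt _), ?_⟩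
  intro b j K hjK m0 x0 hx0
  set A := openCube (0 : Rn n) (2 / 2 ^ K) with hA
  set Q := openCube x0 (1 / 2 ^ K) with hQ
  have hv : volume A = 2 ^ ((2 - (K : ℝ)) * n) := by
    rw [hA, openCube_vol, show (2 : ℝ) * (2 / 2 ^ K) = 2 ^ 2 / 2 ^ K by ring, ofReal_two, ENNReal.rpow_mul,
      ENNReal.rpow_natCast]; norm_num
  have hvQ : volume Q = 2 ^ ((1 - (K : ℝ)) * n) := by
    rw [hQ, openCube_vol, show (2 : ℝ) * (1 / 2 ^ K) = 2 ^ 1 / 2 ^ K by ring, ofReal_two, ENNReal.rpow_mul,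
      ENNReal.rpow_natCast]; norm_num
  set D : ℝ≥0∞ := ENNReal.ofReal c * 2 ^ (-(l : ℝ) * ((K : ℝ) - j)) *
    ∑ o ∈ box n (3 * l + 1), ENNReal.ofReal |b (anc (K - j) m0 + o)| with hD
  have hpt : ∀ h ∈ A, ∀ x ∈ Q, ‖diffl l h (splineSum n l j b) x‖ₑ ≤ D := by
    intro h hh x hx
    have h1 := splineSum_diff l j b h x ((box n (3 * l + 1)).map (addLeftEmbedding (anc (K - j) m0))) (by
      intro i hi m hm
      have h2 := shift_mem hh hx hi
      have h3 := fl_near (k := j) (N := 2 * l + 1) (x := x0) (y := x + (i : ℝ) • h) fun a => (h2 a).trans_le (by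
        refine div_le_div_of_nonneg_left (by positivity) (by positivity) ?_
        exact pow_le_pow_right₀ (by norm_num) hjK)
      rw [mem_half_iff] at hx0
      rw [← anc_fl hjK x0, hx0] at h3
      refine Finset.mem_map.2 ⟨m - anc (K - j) m0, ?_, by simp [addLeftEmbedding]⟩
      rw [mem_box] at h3 ⊢
      rw [mem_nbox] at hm
      intro a
      have h4 := h3 a
      have h5 := hm a
      simp only [Pi.sub_apply] at h4 h5 ⊢
      rw [abs_le] at h4 ⊢
      push_cast at h4 ⊢
      omega)
    rw [Finset.sum_map] at h1
    have h6 : ‖h‖ ≤ 2 / 2 ^ K := by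
      rw [pi_norm_le_iff_of_nonneg (by positivity)]
      intro a
      have := hh a
      simp only [Pi.zero_apply, sub_zero] at this
      exact this.le
    have h7 : (4 ^ l : ℝ) ^ n * (2 * n * (2 ^ j * ‖h‖)) ^ l ≤ c * (2 ^ j / 2 ^ K) ^ l := by
      rw [hc, mul_assoc _ ((4 * (n : ℝ)) ^ l), ← mul_pow]
      refine mul_le_mul_of_nonneg_left (pow_le_pow_left₀ (by positivity) ?_ _) (by positivity)
      calc (2 * n * (2 ^ j * ‖h‖) : ℝ) ≤ 2 * n * (2 ^ j * (2 / 2 ^ K)) := by gcongr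
        _ = _ := by ring
    have h8 := h1.trans (mul_le_mul_of_nonneg_right h7 (Finset.sum_nonneg fun _ _ => abs_nonneg _))
    rw [Real.enorm_eq_ofReal_abs]
    refine (ENNReal.ofReal_le_ofReal h8).trans (le_of_eq ?_)
    rw [ENNReal.ofReal_mul (by positivity), ENNReal.ofReal_mul hc0, ENNReal.ofReal_pow (by positivity), ofReal_two,
      ENNReal.ofReal_sum_of_nonneg (fun _ _ => abs_nonneg _), ← ENNReal.rpow_natCast, ← ENNReal.rpow_mul, hD]
    congr 3
    ring
  have hae : ∀ᵐ z ∂((volume.restrict A).prod (volume.restrict Q)), ‖diffl l z.1 (splineSum n l j b) z.2‖ₑ ≤ D := by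
    rw [Measure.prod_restrict, ae_restrict_iff' ((openCube_meas _ _).prod (openCube_meas _ _))]
    exact Eventually.of_forall fun z hz => hpt z.1 hz.1 z.2 hz.2
  have h1 := eLpNorm_le_of_ae_enorm_bound (p := r) hae
  rw [deltaE]
  refine (mul_le_mul' le_rfl h1).trans (le_of_eq ?_)
  have hu : ((volume.restrict A).prod (volume.restrict Q)) Set.univ = volume A * volume Q := by
    rw [← Set.univ_prod_univ, Measure.prod_prod, Measure.restrict_apply_univ, Measure.restrict_apply_univ]
  have := ofReal_two 1 K
  rw [pow_one] at this
  have e : (2 : ℝ≥0∞) ^ ((((1 : ℕ) : ℝ) - K) * (-(2 * (n : ℝ)) / r.toReal)) * 2 ^ (((2 - (K : ℝ)) * n + (1 - (K : ℝ)) * n) * r.toReal⁻¹)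
     = 2 ^ ((n : ℝ) / r.toReal) := by
    rw [← two_rpow_add]; congr 1; push_cast; ring
  rw [hu, hv, hvQ, this, ← two_rpow_add, ← ENNReal.rpow_mul, ← ENNReal.rpow_mul, smul_eq_mul, mul_left_comm, ← e, hD]
  ring

end P19

section P20
variable {n : ℕ} {p q r : ℝ≥0∞}

/-- own-scale bound of a spline -/
lemma spl_own (hp : 0 < p) (hr : 0 < r) (l : ℕ) {T : ℕ → Zn n → ℝ≥0∞} {ε α₂ : ℝ} {C0 A : ℝ≥0∞} (hT : WT n p r T ε α₂ C0 A) :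
    ∃ C : ℝ≥0∞, C < ∞ ∧ ∀ (j : ℕ) (b : Zn n → ℝ),
      lqNorm p (fun m => T j m * (2 ^ (((j * n : ℕ) : ℝ) / r.toReal) *
        eLpNorm (splineSum n l j b) r (volume.restrict (dyadicCubeHalf n j m)))) ≤
      C * lqNorm p (fun m => T j m * ENNReal.ofReal |b m|) := by
  set c := ENNReal.ofReal ((4 ^ l) ^ n) with hc
  refine ⟨c * (Kq p (nbox n l).card * ((nbox n l).card * (C0 * A ^ l))), 
    ENNReal.mul_lt_top ENNReal.ofReal_lt_top (ENNReal.mul_lt_top (Kq_lt_top hp _)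
      (ENNReal.mul_lt_top (ENNReal.natCast_lt_top _) (ENNReal.mul_lt_top hT.hC (ENNReal.pow_lt_top hT.hA)))), fun j b => ?_⟩
  have h1 : ∀ m, T j m * (2 ^ (((j * n : ℕ) : ℝ) / r.toReal) *
        eLpNorm (splineSum n l j b) r (volume.restrict (dyadicCubeHalf n j m))) ≤
      c * ∑ o ∈ nbox n l, T j m * ENNReal.ofReal |b (m + o)| := by
    intro m
    rw [← Finset.mul_sum, mul_left_comm c]
    refine mul_le_mul' le_rfl (eLp_half_const hr j m fun x hx => ?_)
    have := spl_enorm l j b x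
    rwa [(mem_half_iff j m x).1 hx] at this
  refine (lqNorm_mono h1).trans ?_
  rw [lqNorm_const_mul hp, mul_assoc c]
  refine mul_le_mul' le_rfl ?_
  refine (lqNorm_sum_le hp (nbox n l) _ (fun o m => T j m * ENNReal.ofReal |b (m + o)|) fun m => le_rfl).trans ?_
  rw [mul_assoc (Kq _ _)]
  refine mul_le_mul' le_rfl ?_
  rw [mul_assoc, ← nsmul_eq_mul]
  refine Finset.sum_le_card_nsmul _ _ _ fun o ho => ?_
  have h3 := hT.LOW hp l (le_refl j) (fun m => ENNReal.ofReal |b m|) o (mem_box.1 (nbox_sub l ho))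
  simpa [anc_zero] using h3

lemma spl_high (hp : 0 < p) (hr : 0 < r) (l R : ℕ) {T : ℕ → Zn n → ℝ≥0∞} {ε α₂ : ℝ} {C0 A : ℝ≥0∞} (hT : WT n p r T ε α₂ C0 A) :
    ∃ C : ℝ≥0∞, C < ∞ ∧ ∀ (k j : ℕ) (_ : k ≤ j) (b : Zn n → ℝ),
      lqNorm p (fun m => T k m * ∑ o ∈ box n R, (2 ^ (((k * n : ℕ) : ℝ) / r.toReal) *
        eLpNorm (splineSum n l j b) r (volume.restrict (dyadicCubeHalf n k (m + o))))) ≤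
      C * 2 ^ (-ε * ((j : ℝ) - k)) * lqNorm p (fun m => T j m * ENNReal.ofReal |b m|) := by
  obtain ⟨C, hC, h⟩ := spl_own hp hr l hT
  refine ⟨Kq p (box n R).card * ((box n R).card * (C0 * A ^ R * C)),
    ENNReal.mul_lt_top (Kq_lt_top hp _) (ENNReal.mul_lt_top (ENNReal.natCast_lt_top _)
      (ENNReal.mul_lt_top (ENNReal.mul_lt_top hT.hC (ENNReal.pow_lt_top hT.hA)) hC)), fun k j hk b => ?_⟩
  simp only [Finset.mul_sum]
  refine (lqNorm_sum_le hp (box n R) _ (fun o m => T k m * (2 ^ (((k * n : ℕ) : ℝ) / r.toReal) *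
        eLpNorm (splineSum n l j b) r (volume.restrict (dyadicCubeHalf n k (m + o))))) fun m => le_rfl).trans ?_
  rw [mul_assoc (Kq _ _), mul_assoc (Kq _ _)]
  refine mul_le_mul' le_rfl ?_
  rw [mul_assoc ((box n R).card : ℝ≥0∞), mul_assoc ((box n R).card : ℝ≥0∞), ← nsmul_eq_mul]
  refine Finset.sum_le_card_nsmul _ _ _ fun o ho => ?_
  refine (hT.HIGHf hp hr R hk o (mem_box.1 ho) (splineSum n l j b)).trans ?_
  refine (mul_le_mul' le_rfl (h j b)).trans (le_of_eq ?_)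
  ring

lemma spl_low (hp : 0 < p) (R : ℕ) {T : ℕ → Zn n → ℝ≥0∞} {ε α₂ : ℝ} {C0 A : ℝ≥0∞} (hT : WT n p r T ε α₂ C0 A) :
    ∃ C : ℝ≥0∞, C < ∞ ∧ ∀ (j K : ℕ) (_ : j ≤ K) (b : Zn n → ℝ),
      lqNorm p (fun m => T K m * ∑ o ∈ box n R, ENNReal.ofReal |b (anc (K - j) m + o)|) ≤
      C * 2 ^ (α₂ * ((K : ℝ) - j)) * lqNorm p (fun m => T j m * ENNReal.ofReal |b m|) := by
  refine ⟨Kq p (box n R).card * ((box n R).card * (C0 * A ^ R)),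
    ENNReal.mul_lt_top (Kq_lt_top hp _) (ENNReal.mul_lt_top (ENNReal.natCast_lt_top _)
      (ENNReal.mul_lt_top hT.hC (ENNReal.pow_lt_top hT.hA))), fun j K hk b => ?_⟩
  simp only [Finset.mul_sum]
  refine (lqNorm_sum_le hp (box n R) _ (fun o m => T K m * ENNReal.ofReal |b (anc (K - j) m + o)|) fun m => le_rfl).trans ?_
  rw [mul_assoc (Kq _ _), mul_assoc (Kq _ _)]
  refine mul_le_mul' le_rfl ?_
  rw [mul_assoc ((box n R).card : ℝ≥0∞), mul_assoc ((box n R).card : ℝ≥0∞), ← nsmul_eq_mul]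
  refine Finset.sum_le_card_nsmul _ _ _ fun o ho => ?_
  exact hT.LOW hp R hk (fun m => ENNReal.ofReal |b m|) o (mem_box.1 ho)

/-- the two-sided kernel -/
def kerD (ε : ℝ) (k j : ℕ) : ℝ≥0∞ := 2 ^ (-ε * |(k : ℝ) - j|)

lemma delta_bound (hp : 0 < p) (hr : 0 < r) (l : ℕ) {T : ℕ → Zn n → ℝ≥0∞} {ε α₂ ε' : ℝ} {C0 A : ℝ≥0∞}
    (hT : WT n p r T ε α₂ C0 A) (h1 : ε' ≤ ε) (h2 : ε' ≤ l - α₂) :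
    ∃ C : ℝ≥0∞, C < ∞ ∧ ∀ (K j : ℕ) (b : Zn n → ℝ), ∃ a : Zn n → ℝ≥0∞,
      (∀ m0, ∀ x0 ∈ dyadicCubeHalf n K m0, deltaE n l r (2 / 2 ^ K) (openCube x0 (1 / 2 ^ K)) (splineSum n l j b) ≤ a m0) ∧
      lqNorm p (fun m => T K m * a m) ≤ C * kerD ε' K j * lqNorm p (fun m => T j m * ENNReal.ofReal |b m|) := by
  obtain ⟨C1, hC1, H1⟩ := delta_near (n := n) l hr
  obtain ⟨C2, hC2, H2⟩ := delta_far (n := n) l hr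
  obtain ⟨C3, hC3, H3⟩ := spl_high hp hr l (2 * l + 1) hT
  obtain ⟨C4, hC4, H4⟩ := spl_low hp (3 * l + 1) hT
  refine ⟨C1 * C3 + C2 * C4, ENNReal.add_lt_top.2 ⟨ENNReal.mul_lt_top hC1 hC3, ENNReal.mul_lt_top hC2 hC4⟩, fun K j b => ?_⟩
  rcases le_total K j with hk | hk
  · have hk' : (K : ℝ) ≤ j := by exact_mod_cast hk
    refine ⟨_, fun m0 x0 hx0 => H1 _ (splineSum_measurable l j b) K m0 x0 hx0, ?_⟩
    simp only [mul_left_comm _ C1]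
    rw [lqNorm_const_mul hp]
    refine (mul_le_mul' le_rfl (H3 K j hk b)).trans ?_
    rw [← mul_assoc, ← mul_assoc]
    refine mul_le_mul' (mul_le_mul' le_self_add ?_) le_rfl
    refine ENNReal.rpow_le_rpow_of_exponent_le (by norm_num) ?_
    rw [abs_of_nonpos (by linarith)]
    nlinarith
  · have hk' : (j : ℝ) ≤ K := by exact_mod_cast hk
    refine ⟨_, fun m0 x0 hx0 => H2 b j K hk m0 x0 hx0, ?_⟩
    simp only [mul_left_comm _ (C2 * _)]
    rw [lqNorm_const_mul hp]
    refine (mul_le_mul' le_rfl (H4 j K hk b)).trans ?_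
    rw [← mul_assoc]
    refine mul_le_mul' ?_ le_rfl
    rw [mul_mul_mul_comm, ← two_rpow_add]
    refine mul_le_mul' le_add_self ?_
    refine ENNReal.rpow_le_rpow_of_exponent_le (by norm_num) ?_
    rw [abs_of_nonneg (by linarith)]
    nlinarith

lemma zero_bound (hp : 0 < p) (hr : 0 < r) (l : ℕ) {T : ℕ → Zn n → ℝ≥0∞} {ε α₂ ε' : ℝ} {C0 A : ℝ≥0∞}
    (hT : WT n p r T ε α₂ C0 A) (h1 : ε' ≤ ε) :
    ∃ C : ℝ≥0∞, C < ∞ ∧ ∀ (j : ℕ) (b : Zn n → ℝ), ∃ a : Zn n → ℝ≥0∞,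
      (∀ m0, ∀ x0 ∈ dyadicCubeHalf n 0 m0, eLpNorm (splineSum n l j b) r (volume.restrict (openCube x0 1)) ≤ a m0) ∧
      lqNorm p (fun m => T 0 m * a m) ≤ C * kerD ε' 0 j * lqNorm p (fun m => T j m * ENNReal.ofReal |b m|) := by
  obtain ⟨C3, hC3, H3⟩ := spl_high hp hr l 1 hT
  set C1 := Kq r (box n 1).card
  refine ⟨C1 * C3, ENNReal.mul_lt_top (Kq_lt_top hr _) hC3, fun j b => ?_⟩
  refine ⟨fun m0 => C1 * ∑ o ∈ box n 1, (2 ^ (((0 * n : ℕ) : ℝ) / r.toReal) *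
        eLpNorm (splineSum n l j b) r (volume.restrict (dyadicCubeHalf n 0 (m0 + o)))), fun m0 x0 hx0 => ?_, ?_⟩
  · have := cube_cover hr (N := 1) hx0 (splineSum n l j b)
    simpa using this
  · simp only [mul_left_comm _ C1]
    rw [lqNorm_const_mul hp]
    refine (mul_le_mul' le_rfl (H3 0 j (Nat.zero_le _) b)).trans ?_
    rw [← mul_assoc, ← mul_assoc]
    refine mul_le_mul' (mul_le_mul' le_rfl ?_) le_rfl
    refine ENNReal.rpow_le_rpow_of_exponent_le (by norm_num) ?_
    have hk' : (0 : ℝ) ≤ j := by positivity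
    rw [Nat.cast_zero, abs_of_nonpos (by linarith)]
    nlinarith

end P20

section P21
variable {n : ℕ} {p q r : ℝ≥0∞}

lemma geo_lt {ε u : ℝ} (hε : 0 < ε) (hu : 0 < u) : ∑' i : ℕ, ((2 : ℝ≥0∞) ^ (-ε * (i : ℝ))) ^ u < ∞ := by
  have h : ∀ i : ℕ, ((2 : ℝ≥0∞) ^ (-ε * (i : ℝ))) ^ u = ((2 : ℝ≥0∞) ^ (-ε * u)) ^ i := by
    intro i
    rw [← ENNReal.rpow_natCast, ← ENNReal.rpow_mul, ← ENNReal.rpow_mul]; congr 1; ring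
  simp only [h]
  rw [ENNReal.tsum_geometric]
  refine ENNReal.inv_lt_top.2 (tsub_pos_of_lt ?_)
  exact ENNReal.rpow_lt_one_of_one_lt_of_neg (by norm_num) (by nlinarith)

lemma tsum_two_sided (k : ℕ) (g : ℕ → ℝ≥0∞) :
    ∑' j, g j ≤ ∑' i, (g (k + i) + if i ≤ k then g (k - i) else 0) := by
  rw [ENNReal.tsum_add, ← Summable.sum_add_tsum_nat_add' (f := g) (k := k) ENNReal.summable, add_comm]
  simp only [add_comm k]
  refine add_le_add le_rfl ?_
  calc ∑ i ∈ Finset.range k, g i ≤ ∑ i ∈ Finset.range (k + 1), g i :=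
        Finset.sum_le_sum_of_subset (Finset.range_mono (Nat.le_succ k))
    _ = ∑ i ∈ Finset.range (k + 1), g (k - i) := by
        rw [← Finset.sum_range_reflect]
        refine Finset.sum_congr rfl fun i _ => ?_
        congr 1
    _ = ∑ i ∈ Finset.range (k + 1), (if i ≤ k then g (k - i) else 0) := by
        refine Finset.sum_congr rfl fun i hi => ?_
        rw [if_pos (Nat.lt_succ_iff.1 (Finset.mem_range.1 hi))]
    _ ≤ _ := ENNReal.sum_le_tsum _

lemma young (hq : 0 < q) {u ε : ℝ} (hu : 0 < u) (huq : ENNReal.ofReal u ≤ q) (hε : 0 < ε) :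
    ∃ C : ℝ≥0∞, C < ∞ ∧ ∀ b B : ℕ → ℝ≥0∞, (∀ k, b k ^ u ≤ ∑' j, (kerD ε k j * B j) ^ u) →
      lqNorm q b ≤ C * lqNorm q B := by
  set Z := ∑' i : ℕ, ((2 : ℝ≥0∞) ^ (-ε * (i : ℝ))) ^ u with hZ
  have hZf : Z < ∞ := geo_lt hε hu
  set c : ℝ≥0∞ := 2 ^ (1 / u) with hc
  have hcu : c ^ u = 2 := by rw [hc, ← ENNReal.rpow_mul, one_div_mul_cancel hu.ne', ENNReal.rpow_one]
  refine ⟨Z ^ (1 / u) * (c * (Kq q 2 * 2)), ENNReal.mul_lt_top (ENNReal.rpow_lt_top_of_nonneg (by positivity) hZf.ne)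
    (ENNReal.mul_lt_top (two_rpow_lt _) (ENNReal.mul_lt_top (Kq_lt_top hq 2) (by simp))), fun b B h => ?_⟩
  have h1 : ∀ k, b k ^ u ≤ ∑' i : ℕ, ((2 : ℝ≥0∞) ^ (-ε * (i : ℝ)) * (c * (B (k + i) + if i ≤ k then B (k - i) else 0))) ^ u := by
    intro k
    refine (h k).trans ((tsum_two_sided k _).trans (ENNReal.tsum_le_tsum fun i => ?_))
    have e1 : kerD ε k (k + i) = 2 ^ (-ε * (i : ℝ)) := by
      rw [kerD]; congr 2; push_cast; rw [show (k : ℝ) - (k + i) = -i by ring, abs_neg, Nat.abs_cast]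
    have e2 : i ≤ k → kerD ε k (k - i) = 2 ^ (-ε * (i : ℝ)) := by
      intro hi
      rw [kerD, Nat.cast_sub hi]; congr 2; rw [show (k : ℝ) - (k - i) = i by ring, Nat.abs_cast]
    rw [e1, ENNReal.mul_rpow_of_nonneg _ _ hu.le, ENNReal.mul_rpow_of_nonneg _ (c * _) hu.le, ENNReal.mul_rpow_of_nonneg c _ hu.le, hcu, two_mul,
      mul_add]
    refine add_le_add (mul_le_mul' le_rfl (ENNReal.rpow_le_rpow le_self_add hu.le)) ?_
    split_ifs with hi
    · rw [e2 hi, ENNReal.mul_rpow_of_nonneg _ _ hu.le]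
      exact mul_le_mul' le_rfl (ENNReal.rpow_le_rpow le_add_self hu.le)
    · exact zero_le
  have h2 := lqNorm_le_tsum' hu huq b (fun i k => (2 : ℝ≥0∞) ^ (-ε * (i : ℝ)) * (c * (B (k + i) + if i ≤ k then B (k - i) else 0))) h1
  have h3 : ∀ i : ℕ, lqNorm q (fun k => (2 : ℝ≥0∞) ^ (-ε * (i : ℝ)) * (c * (B (k + i) + if i ≤ k then B (k - i) else 0))) ≤
      2 ^ (-ε * (i : ℝ)) * (c * (Kq q 2 * 2) * lqNorm q B) := by
    intro i
    rw [lqNorm_const_mul hq, lqNorm_const_mul hq, mul_assoc c, mul_assoc (Kq q 2), two_mul]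
    refine mul_le_mul' le_rfl (mul_le_mul' le_rfl ((lqNorm_add_le hq _ _).trans (mul_le_mul' le_rfl (add_le_add ?_ ?_))))
    · exact lqNorm_comp_le B (add_left_injective i)
    · exact lqNorm_shift hq i B
  have h4 : lqNorm q b ^ u ≤ Z * (c * (Kq q 2 * 2) * lqNorm q B) ^ u := by
    refine h2.trans ?_
    rw [hZ, ← ENNReal.tsum_mul_right]
    refine ENNReal.tsum_le_tsum fun i => ?_
    rw [← ENNReal.mul_rpow_of_nonneg _ _ hu.le]
    exact ENNReal.rpow_le_rpow (h3 i) hu.le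
  have h5 := ENNReal.rpow_le_rpow h4 (z := 1 / u) (by positivity)
  rw [rpow_one_div_self hu, ENNReal.mul_rpow_of_nonneg _ _ (by positivity), rpow_one_div_self hu] at h5
  rwa [mul_assoc]

lemma link_tsum (hp : 0 < p) {t : ℕ → Rn n → ℝ} (ht : pAdmissible n p t) {u : ℝ} (hu : 0 < u) (hup : ENNReal.ofReal u ≤ p)
    (K : ℕ) (F : Rn n → ℝ≥0∞) (a : ℕ → Zn n → ℝ≥0∞) (D : ℕ → ℝ≥0∞)
    (h1 : ∀ m0, ∀ x0 ∈ dyadicCubeHalf n K m0, F x0 ^ u ≤ ∑' j, a j m0 ^ u)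
    (h2 : ∀ j, lqNorm p (fun m => tkm n p t K m * a j m) ≤ D j) :
    lpNormE p volume (fun x => ENNReal.ofReal (t K x) * F x) ^ u ≤ ∑' j, D j ^ u := by
  have h3 := link_up hp ht K (fun m => (∑' j, a j m ^ u) ^ (1 / u)) F (fun m x hx => by
    have := ENNReal.rpow_le_rpow (h1 m x hx) (z := 1 / u) (by positivity)
    rwa [rpow_one_div_self hu] at this)
  refine (ENNReal.rpow_le_rpow h3 hu.le).trans ?_
  refine (lqNorm_le_tsum' hu hup _ (fun j m => tkm n p t K m * a j m) fun m => ?_).trans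
    (ENNReal.tsum_le_tsum fun j => ENNReal.rpow_le_rpow (h2 j) hu.le)
  rw [ENNReal.mul_rpow_of_nonneg _ _ hu.le, rpow_self_one_div hu, ← ENNReal.tsum_mul_left]
  simp only [ENNReal.mul_rpow_of_nonneg _ _ hu.le]
  exact le_rfl

lemma eLp_tsum {α : Type*} [MeasurableSpace α] {μ : Measure α} (hr : 0 < r) {u : ℝ} (hu : 0 < u) (hu1 : u ≤ 1)
    (hur : ENNReal.ofReal u ≤ r) {f : ℕ → α → ℝ} {g : α → ℝ} (hf : ∀ j, Measurable (f j))
    (h : ∀ᵐ x ∂μ, HasSum (fun j => f j x) (g x)) :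
    eLpNorm g r μ ^ u ≤ ∑' j, eLpNorm (f j) r μ ^ u := by
  simp only [eLpNorm_eq_lpNormE hr]
  refine lpNormE_le_tsum hu hu1 hur _ (fun j x => ‖f j x‖ₑ) (fun j => (hf j).enorm.aemeasurable) ?_
  filter_upwards [h] with x hx
  rw [← hx.tsum_eq]
  exact enorm_tsum_le_tsum_enorm

lemma delta_tsum (l : ℕ) (hr : 0 < r) {u : ℝ} (hu : 0 < u) (hu1 : u ≤ 1)
    (hur : ENNReal.ofReal u ≤ r) {f : ℕ → Rn n → ℝ} {g : Rn n → ℝ} (hf : ∀ j, Measurable (f j))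
    (h : ∀ᵐ x, HasSum (fun j => f j x) (g x)) (s : ℝ) (x0 : Rn n) (s' : ℝ) :
    deltaE n l r s (openCube x0 s') g ^ u ≤ ∑' j, deltaE n l r s (openCube x0 s') (f j) ^ u := by
  unfold deltaE
  simp only [ENNReal.mul_rpow_of_nonneg _ _ hu.le]
  rw [ENNReal.tsum_mul_left]
  refine mul_le_mul' le_rfl (eLp_tsum hr hu hu1 hur (fun j => diffl_measurable l (hf j)) ?_)
  have h1 : ∀ i ∈ Finset.range (l + 1), ∀ᵐ z ∂((volume.restrict (openCube (0 : Rn n) s)).prod (volume.restrict (openCube x0 s'))),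
      HasSum (fun j => f j (z.2 + (i : ℝ) • z.1)) (g (z.2 + (i : ℝ) • z.1)) := by
    intro i _
    rw [ae_iff] at h ⊢
    set N := {x | ¬ HasSum (fun j => f j x) (g x)}
    have h2 := sh_measure (openCube_meas (0 : Rn n) s) (i : ℝ) (Q := openCube x0 s') (B := Set.univ)
      (fun _ _ _ _ => Set.mem_univ _) (measurableSet_toMeasurable volume N)
    rw [Measure.restrict_univ, measure_toMeasurable, h, mul_zero] at h2
    refine measure_mono_null (fun z hz => ?_) (le_antisymm h2 zero_le)
    exact subset_toMeasurable volume N hz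
  rw [← Finset.eventually_all] at h1
  filter_upwards [h1] with z hz
  unfold diffl
  exact hasSum_sum fun i hi => (hz i hi).mul_left _

lemma ae_lt_of_lp {α : Type*} [MeasurableSpace α] {μ : Measure α} (hr : 0 < r) {f : α → ℝ≥0∞} (hf : Measurable f)
    (h : lpNormE r μ f < ∞) : ∀ᵐ x ∂μ, f x < ∞ := by
  unfold lpNormE at h
  split_ifs at h with hr'
  · filter_upwards [ENNReal.ae_le_essSup f] with x hx using hx.trans_lt h
  · have hr1 := toReal_pos_of hr hr'
    have h2 : ∫⁻ x, f x ^ r.toReal ∂μ ≠ ∞ := by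
      intro h3
      rw [h3, ENNReal.top_rpow_of_pos (by positivity)] at h
      exact lt_irrefl _ h
    filter_upwards [ae_lt_top (hf.pow_const _) h2] with x hx
    by_contra h4
    rw [not_lt, top_le_iff] at h4
    rw [h4, ENNReal.top_rpow_of_pos hr1] at hx
    exact lt_irrefl _ hx

/-- measurable version of the sum of a series -/
def serSum (S : ℕ → Rn n → ℝ) (x : Rn n) : ℝ :=
  (∑' j, ENNReal.ofReal (S j x)).toReal - (∑' j, ENNReal.ofReal (-S j x)).toReal

lemma serSum_measurable {S : ℕ → Rn n → ℝ} (hS : ∀ j, Measurable (S j)) : Measurable (serSum S) := by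
  unfold serSum
  refine Measurable.sub ?_ ?_
  · exact (Measurable.tsum fun j => (hS j).ennreal_ofReal).ennreal_toReal
  · exact (Measurable.tsum fun j => (hS j).neg.ennreal_ofReal).ennreal_toReal

lemma serSum_hasSum {S : ℕ → Rn n → ℝ} {x : Rn n} (h : ∑' j, ‖S j x‖ₑ < ∞) : HasSum (fun j => S j x) (serSum S x) := by
  have h1 : ∑' j, ENNReal.ofReal (S j x) ≠ ∞ := by
    refine ((ENNReal.tsum_le_tsum fun j => ?_).trans_lt h).ne
    rw [Real.enorm_eq_ofReal_abs]; exact ENNReal.ofReal_le_ofReal (le_abs_self _)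
  have h2 : ∑' j, ENNReal.ofReal (-S j x) ≠ ∞ := by
    refine ((ENNReal.tsum_le_tsum fun j => ?_).trans_lt h).ne
    rw [Real.enorm_eq_ofReal_abs]; exact ENNReal.ofReal_le_ofReal (neg_le_abs _)
  have h3 := (ENNReal.hasSum_toReal h1).sub (ENNReal.hasSum_toReal h2)
  rw [← ENNReal.tsum_toReal_eq (fun _ => ENNReal.ofReal_ne_top), ← ENNReal.tsum_toReal_eq (fun _ => ENNReal.ofReal_ne_top)] at h3
  have e : (fun j => S j x) = fun j => (ENNReal.ofReal (S j x)).toReal - (ENNReal.ofReal (-S j x)).toReal := by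
    funext j
    rw [ENNReal.toReal_ofReal', ENNReal.toReal_ofReal']
    rcases le_total 0 (S j x) with h | h
    · rw [max_eq_left h, max_eq_right (by linarith)]; ring
    · rw [max_eq_right h, max_eq_left (by linarith)]; ring
  rw [e]; exact h3

end P21

section P22
variable {n : ℕ} {p q r : ℝ≥0∞}

lemma part2 {l : ℕ} (hp : 0 < p) (hq : 0 < q) (hr : 0 < r) {t : ℕ → Rn n → ℝ}
    (ht : pAdmissible n p t) {ε α₂ : ℝ} (hε : 0 < ε) (hα : α₂ < l) {C0 A : ℝ≥0∞} (hT : WT n p r (tkm n p t) ε α₂ C0 A) :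
    ∃ C : ℝ≥0∞, C < ∞ ∧ ∀ β : ℕ → (Fin n → ℤ) → ℝ,
      lqNorm q (fun k : ℕ => lqNorm p (fun m : Fin n → ℤ => tkm n p t k m * ENNReal.ofReal |β k m|)) < ∞ →
        ∃ φ : Rn n → ℝ, MemTildeB n l p q r t φ ∧
          (∀ K : Set (Rn n), IsCompact K →
            Filter.Tendsto (fun N : ℕ =>
                eLpNorm (fun x => (∑ k ∈ Finset.range N, splineSum n l k (β k) x) - φ x) r
                  (volume.restrict K)) Filter.atTop (nhds 0)) ∧
          tildeBnorm n l p q r t φ ≤ C * lqNorm q (fun k : ℕ => lqNorm p (fun m : Fin n → ℤ =>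
              tkm n p t k m * ENNReal.ofReal |β k m|)) := by
  set u := min (uu p) (min (uu q) (uu r)) with hu_def
  have hu : 0 < u := lt_min (uu_pos hp) (lt_min (uu_pos hq) (uu_pos hr))
  have hu1 : u ≤ 1 := (min_le_left _ _).trans uu_le_one
  have hup : ENNReal.ofReal u ≤ p := (ENNReal.ofReal_le_ofReal (min_le_left _ _)).trans uu_le
  have huq : ENNReal.ofReal u ≤ q :=
    (ENNReal.ofReal_le_ofReal ((min_le_right _ _).trans (min_le_left _ _))).trans uu_le
  have hur : ENNReal.ofReal u ≤ r :=
    (ENNReal.ofReal_le_ofReal ((min_le_right _ _).trans (min_le_right _ _))).trans uu_le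
  clear_value u
  obtain ⟨ε', hε', h1, h2⟩ : ∃ ε' : ℝ, 0 < ε' ∧ ε' ≤ ε ∧ ε' ≤ l - α₂ :=
    ⟨min ε (l - α₂), lt_min hε (by linarith), min_le_left _ _, min_le_right _ _⟩
  obtain ⟨Cd, hCd, Hd⟩ := delta_bound hp hr l hT h1 h2
  obtain ⟨Cz, hCz, Hz⟩ := zero_bound hp hr l hT h1
  obtain ⟨Cy, hCy, Hy⟩ := young hq hu huq hε'
  set T := tkm n p t with hTdef
  refine ⟨2 * (Cy * (Cd + Cz)), ENNReal.mul_lt_top (by simp) (ENNReal.mul_lt_top hCy (ENNReal.add_lt_top.2 ⟨hCd, hCz⟩)), fun β hβ => ?_⟩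
  set B : ℕ → ℝ≥0∞ := fun k => lqNorm p (fun m => T k m * ENNReal.ofReal |β k m|) with hB
  set S : ℕ → Rn n → ℝ := fun k => splineSum n l k (β k) with hS
  have hSm : ∀ j, Measurable (S j) := fun j => splineSum_measurable l j (β j)
  choose ad had1 had2 using fun K j => Hd K j (β j)
  choose az haz1 haz2 using fun j => Hz j (β j)
  -- summability on compacts
  have hloc1 : ∀ m j, eLpNorm (S j) r (volume.restrict (dyadicCubeHalf n 0 m)) ≤
      2 ^ (-ε' * (j : ℝ)) * ((T 0 m)⁻¹ * (Cz * lqNorm q B)) := by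
    intro m j
    have hx : (fun i => (m i : ℝ)) ∈ dyadicCubeHalf n 0 m := by intro i; simp
    have a1 : eLpNorm (S j) r (volume.restrict (dyadicCubeHalf n 0 m)) ≤ az j m :=
      (eLpNorm_mono_measure _ (Measure.restrict_mono (half_zero_sub hx) le_rfl)).trans (haz1 j m _ hx)
    have a2 : T 0 m * az j m ≤ Cz * kerD ε' 0 j * B j := (le_lqNorm hp (fun m => T 0 m * az j m) m).trans (haz2 j)
    have a3 : kerD ε' 0 j = 2 ^ (-ε' * (j : ℝ)) := by
      rw [kerD]; congr 2; rw [Nat.cast_zero, zero_sub, abs_neg, Nat.abs_cast]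
    have a4 : B j ≤ lqNorm q B := le_lqNorm hq B j
    calc _ ≤ az j m := a1
      _ = (T 0 m)⁻¹ * (T 0 m * az j m) := by
          rw [← mul_assoc, ENNReal.inv_mul_cancel (hT.pos 0 m).ne' (hT.fin 0 m).ne, one_mul]
      _ ≤ (T 0 m)⁻¹ * (Cz * 2 ^ (-ε' * (j : ℝ)) * lqNorm q B) := by
          rw [← a3]; exact mul_le_mul' le_rfl (a2.trans (mul_le_mul' le_rfl a4))
      _ = _ := by ring
  have hloc : ∀ m, ∑' j, eLpNorm (S j) r (volume.restrict (dyadicCubeHalf n 0 m)) ^ u < ∞ := by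
    intro m
    refine (ENNReal.tsum_le_tsum fun j => ENNReal.rpow_le_rpow (hloc1 m j) hu.le).trans_lt ?_
    simp only [ENNReal.mul_rpow_of_nonneg _ ((T 0 m)⁻¹ * _) hu.le]
    rw [ENNReal.tsum_mul_right]
    refine ENNReal.mul_lt_top (geo_lt hε' hu) (ENNReal.rpow_lt_top_of_nonneg hu.le ?_)
    exact (ENNReal.mul_lt_top (ENNReal.inv_lt_top.2 (hT.pos 0 m)) (ENNReal.mul_lt_top hCz hβ)).ne
  have hae : ∀ᵐ x : Rn n, ∑' j, ‖S j x‖ₑ < ∞ := by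
    rw [← Measure.restrict_univ (μ := (volume : Measure (Rn n))), ← half_cover (n := n) 0, ae_restrict_iUnion_iff]
    intro m
    refine ae_lt_of_lp hr (Measurable.tsum fun j => (hSm j).enorm) ?_
    have a1 := lpNormE_le_tsum (μ := volume.restrict (dyadicCubeHalf n 0 m)) hu hu1 hur (fun x => ∑' j, ‖S j x‖ₑ)
      (fun j x => ‖S j x‖ₑ) (fun j => (hSm j).enorm.aemeasurable) (Eventually.of_forall fun x => le_rfl)
    simp only [← eLpNorm_eq_lpNormE hr] at a1
    have a2 := a1.trans_lt (hloc m)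
    by_contra h
    rw [not_lt, top_le_iff] at h
    rw [h, ENNReal.top_rpow_of_pos hu] at a2
    exact lt_irrefl _ a2
  set φ := serSum S with hφ
  have hφm : Measurable φ := serSum_measurable hSm
  have hsum : ∀ᵐ x : Rn n, HasSum (fun j => S j x) (φ x) := by
    filter_upwards [hae] with x hx using serSum_hasSum hx
  have hLr : MemLrLoc n r φ := by
    refine ⟨hφm, fun K hK => ?_⟩
    obtain ⟨s, hs⟩ := compact_cover hr hK
    refine (hs φ).trans_lt (ENNReal.mul_lt_top (Kq_lt_top hr _) (ENNReal.sum_lt_top.2 fun m _ => ?_))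
    have a1 := (eLp_tsum hr hu hu1 hur hSm (ae_restrict_of_ae (s := dyadicCubeHalf n 0 m) hsum)).trans_lt (hloc m)
    by_contra h
    rw [not_lt, top_le_iff] at h
    rw [h, ENNReal.top_rpow_of_pos hu] at a1
    exact lt_irrefl _ a1
  have hconv : ∀ K : Set (Rn n), IsCompact K →
            Filter.Tendsto (fun N : ℕ =>
                eLpNorm (fun x => (∑ k ∈ Finset.range N, splineSum n l k (β k) x) - φ x) r
                  (volume.restrict K)) Filter.atTop (nhds 0) := by
    intro K hK
    refine tendsto_compact hr _ (fun m => ?_) hK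
    set μ := volume.restrict (dyadicCubeHalf n 0 m) with hμ
    have a1 : ∀ N : ℕ, eLpNorm (fun x => (∑ k ∈ Finset.range N, splineSum n l k (β k) x) - φ x) r μ ≤
        (∑' j, eLpNorm (S (j + N)) r μ ^ u) ^ (1 / u) := by
      intro N
      rw [eLp_symm]
      have a2 := eLp_tsum (μ := μ) (f := fun j => S (j + N)) (g := fun x => φ x - ∑ k ∈ Finset.range N, splineSum n l k (β k) x)
        hr hu hu1 hur (fun j => hSm _) (by
          filter_upwards [ae_restrict_of_ae (s := dyadicCubeHalf n 0 m) hsum] with x hx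
          exact (hasSum_nat_add_iff' N).2 hx)
      have a3 := ENNReal.rpow_le_rpow a2 (z := 1 / u) (by positivity)
      rwa [rpow_one_div_self hu] at a3
    refine tendsto_of_tendsto_of_tendsto_of_le_of_le tendsto_const_nhds ?_ (fun _ => zero_le) a1
    have a4 := ENNReal.tendsto_sum_nat_add (fun j => eLpNorm (S j) r μ ^ u) (hloc m).ne
    have a5 := (ENNReal.continuous_rpow_const (y := 1 / u)).tendsto 0 |>.comp a4
    rw [ENNReal.zero_rpow_of_pos (by positivity)] at a5
    exact a5
  -- the norm estimate
  set bk : ℕ → ℝ≥0∞ := fun k => lpNormE p volume (fun x => ENNReal.ofReal (t (k + 1) x) *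
    deltaE n l r ((2 : ℝ) ^ (1 - ((k : ℤ) + 1))) (openCube x ((2 : ℝ) ^ (-((k : ℤ) + 1)))) φ) with hbk
  set b0 : ℝ≥0∞ := lpNormE p volume (fun x => ENNReal.ofReal (t 0 x) * eLpNorm φ r (volume.restrict (openCube x 1))) with hb0
  have hnorm : tildeBnorm n l p q r t φ = lqNorm q bk + b0 := rfl
  set Cc := Cd + Cz with hCc
  have hb0' : b0 ^ u ≤ ∑' j, (kerD ε' 0 j * (Cc * B j)) ^ u := by
    refine link_tsum hp ht hu hup 0 (fun x => eLpNorm φ r (volume.restrict (openCube x 1))) az _ (fun m0 x0 hx0 => ?_) (fun j => ?_)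
    · exact (eLp_tsum hr hu hu1 hur hSm (ae_restrict_of_ae hsum)).trans
        (ENNReal.tsum_le_tsum fun j => ENNReal.rpow_le_rpow (haz1 j m0 x0 hx0) hu.le)
    · refine (haz2 j).trans ?_
      rw [mul_comm Cz, mul_assoc]
      exact mul_le_mul' le_rfl (mul_le_mul' le_add_self le_rfl)
  have hbk' : ∀ k, bk k ^ u ≤ ∑' j, (kerD ε' (k + 1) j * (Cc * B j)) ^ u := by
    intro k
    have e1 : (2 : ℝ) ^ (1 - ((k : ℤ) + 1)) = 2 / 2 ^ (k + 1) := by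
      rw [zpow_sub₀ (by norm_num), zpow_one]; norm_cast
    have e2 : (2 : ℝ) ^ (-((k : ℤ) + 1)) = 1 / 2 ^ (k + 1) := by
      rw [zpow_neg, one_div]; norm_cast
    refine link_tsum hp ht hu hup (k + 1) (fun x => deltaE n l r ((2 : ℝ) ^ (1 - ((k : ℤ) + 1)))
      (openCube x ((2 : ℝ) ^ (-((k : ℤ) + 1)))) φ) (ad (k + 1)) _ (fun m0 x0 hx0 => ?_) (fun j => ?_)
    · rw [e1, e2]
      exact (delta_tsum l hr hu hu1 hur hSm hsum _ _ _).trans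
        (ENNReal.tsum_le_tsum fun j => ENNReal.rpow_le_rpow (had1 (k + 1) j m0 x0 hx0) hu.le)
    · refine (had2 (k + 1) j).trans ?_
      rw [mul_comm Cd, mul_assoc]
      exact mul_le_mul' le_rfl (mul_le_mul' le_self_add le_rfl)
  set b : ℕ → ℝ≥0∞ := fun k => Nat.casesOn k b0 bk with hb
  have hbb := Hy b (fun j => Cc * B j) (fun k => by
    cases k with
    | zero => exact hb0'
    | succ k => exact hbk' k)
  rw [lqNorm_const_mul hq] at hbb
  have hfinal : tildeBnorm n l p q r t φ ≤ 2 * (Cy * Cc) * lqNorm q B := by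
    rw [hnorm, mul_assoc, two_mul, mul_assoc]
    refine add_le_add (le_trans ?_ hbb) (le_trans ?_ hbb)
    · exact lqNorm_comp_le b (add_left_injective 1)
    · exact le_lqNorm hq b 0
  refine ⟨φ, ⟨hLr, hfinal.trans_lt ?_⟩, hconv, hfinal⟩
  exact ENNReal.mul_lt_top (ENNReal.mul_lt_top (by simp) (ENNReal.mul_lt_top hCy (ENNReal.add_lt_top.2 ⟨hCd, hCz⟩))) hβ

end P22

/-- **Corollary 4.4: atomic (spline) decomposition of `B̃^l_{p,q,r}(ℝⁿ,{t_k})`.** -/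
theorem atomic_decomposition (n l : ℕ) (hn : 0 < n) (hl : 0 < l)
    (p q r θ : ℝ≥0∞) (hp : 0 < p) (hq : 0 < q) (hr : 0 < r)
    (hθ0 : 0 < θ) (hθp : θ ≤ p) (hθr : θ ≤ r)
    (α₁ α₂ α₃ : ℝ) (hα₃ : 0 ≤ α₃)
    (hα₁ : (n : ℝ) * (1 / θ.toReal - 1 / r.toReal) < α₁) (hα₂ : α₂ < l)
    (t : ℕ → Rn n → ℝ)
    (ht : MemX n α₁ α₂ α₃ (θ * conjE (pTheta p θ)) p p t) :
    ∃ C : ℝ≥0∞, 0 < C ∧ C < ∞ ∧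
      (∀ φ : Rn n → ℝ, MemTildeB n l p q r t φ →
        ∃ β : ℕ → (Fin n → ℤ) → ℝ,
          (∀ K : Set (Rn n), IsCompact K →
            Filter.Tendsto (fun N : ℕ =>
                eLpNorm (fun x => (∑ k ∈ Finset.range N, splineSum n l k (β k) x) - φ x) r
                  (volume.restrict K)) Filter.atTop (nhds 0)) ∧
          lqNorm q (fun k : ℕ => lqNorm p (fun m : Fin n → ℤ =>
              tkm n p t k m * ENNReal.ofReal |β k m|)) ≤
            C * tildeBnorm n l p q r t φ) ∧
      (∀ β : ℕ → (Fin n → ℤ) → ℝ,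
        lqNorm q (fun k : ℕ => lqNorm p (fun m : Fin n → ℤ =>
            tkm n p t k m * ENNReal.ofReal |β k m|)) < ∞ →
        ∃ φ : Rn n → ℝ, MemTildeB n l p q r t φ ∧
          (∀ K : Set (Rn n), IsCompact K →
            Filter.Tendsto (fun N : ℕ =>
                eLpNorm (fun x => (∑ k ∈ Finset.range N, splineSum n l k (β k) x) - φ x) r
                  (volume.restrict K)) Filter.atTop (nhds 0)) ∧
          tildeBnorm n l p q r t φ ≤
            C * lqNorm q (fun k : ℕ => lqNorm p (fun m : Fin n → ℤ =>
                tkm n p t k m * ENNReal.ofReal |β k m|))) := by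
  obtain ⟨C0, A, hT⟩ := weights_WT hp hθ0 hθp hθr hα₃ ht
  obtain ⟨C1, hC1, H1⟩ := part1 hl hp hq hr ht.1 (sub_pos.2 hα₁) hT
  obtain ⟨C2, hC2, H2⟩ := part2 (l := l) (q := q) hp hq hr ht.1 (sub_pos.2 hα₁) hα₂ hT
  refine ⟨C1 + C2 + 1, lt_of_lt_of_le one_pos le_add_self,
    ENNReal.add_lt_top.2 ⟨ENNReal.add_lt_top.2 ⟨hC1, hC2⟩, ENNReal.one_lt_top⟩,
    fun φ hφ => ?_, fun β hβ => ?_⟩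
  · obtain ⟨β, a, b⟩ := H1 φ hφ
    exact ⟨β, a, b.trans (mul_le_mul' (le_self_add.trans le_self_add) le_rfl)⟩
  · obtain ⟨φ, a, b, c⟩ := H2 β hβ
    exact ⟨φ, a, b, c.trans (mul_le_mul' (le_add_self.trans le_self_add) le_rfl)⟩

end
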